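/- Let [Δ, c⃗, ε⃗] be a semitoric polygon with hidden and Delzant corners p₁, …, p_d labeled clockwise starting from the lexicographically minimal vertex, let ℓᵢ be the SL₂(ℤ)-length of the semitoric edge from pᵢ to pᵢ₊₁ (indices cyclic), and let αᵢ ∈ [0,∞] be the marked-point bound at pᵢ. Then the map Λ : 𝒫_ST([Δ,c⃗,ε⃗]) → ℝᵈ sending a semitoric packing to the tuple of SL₂(ℤ)-sizes of its packed triangles is a bijection from 𝒫_ST([Δ,c⃗,ε⃗]) onto the compact convex polytope 𝒫̃_ST([Δ,c⃗,ε⃗]) = {(λ₁, …, λ_d) ∈ ℝᵈ : λᵢ ≥ 0, λᵢ + λᵢ₊₁ ≤ ℓᵢ, and λᵢ ≤ αᵢ for all i}, and moreover area([P]) = ½‖Λ([P])‖² for every semitoric packing [P]. -/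

import Mathlib

open Matrix MeasureTheory Set

/-- Points of the plane. -/
abbrev Pt := Fin 2 → ℝ

/-- The action of `SL₂(ℤ)` on `ℝ²` by matrix-vector multiplication. -/
noncomputable def sl2Apply (M : Matrix.SpecialLinearGroup (Fin 2) ℤ) (x : Pt) : Pt :=
  ((M : Matrix (Fin 2) (Fin 2) ℤ).map (Int.cast : ℤ → ℝ)).mulVec x

/-- The model triangle `B(λ) = {(x,y) : x ≥ 0, y ≥ 0, x + y < λ}`. -/
def modelTriangle (lam : ℝ) : Set Pt :=
  {x | 0 ≤ x 0 ∧ 0 ≤ x 1 ∧ x 0 + x 1 < lam}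

/-- The area (Lebesgue measure) of a subset of the plane. -/
noncomputable def area (S : Set Pt) : ℝ := (volume S).toReal

/-- The element of the group `𝒯 × G_m` determined by a global power `n` of
`T = [[1,0],[1,1]]`, a vertical translation `t`, and cut flips `u` (with `u j ∈ {0, ε_j}`;
flipping the cut at the marked point `c j` applies `T^{± 1}` on the half-plane to its
right), as a piecewise affine map of the plane. -/
noncomputable def stMap {m : ℕ} (c : Fin m → Pt) (n : ℤ) (t : ℝ) (u : Fin m → ℤ)
    (x : Pt) : Pt :=
  ![x 0, x 1 + (n : ℝ) * x 0 + t + ∑ j, (u j : ℝ) * max (x 0 - c j 0) 0]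

/-- `B` is an admissibly packed triangle of `SL₂(ℤ)`-size `lam` at the point `p` of the
semitoric polygon with underlying set `Δ`, marked points `c` and cut directions `eps`:
in some equivalent representative (image under an element `σ` of `𝒯 × G_m`), `σ(B)` has
the form `M(B(lam)) + σ(p)` with `M ∈ SL₂(ℤ)`, coincides with the polygon near `σ(p)`,
and contains no marked point. -/
def IsSTPackedTriangleIn {m : ℕ} (Δ : Set Pt) (c : Fin m → Pt) (eps : Fin m → ℤ)
    (p : Pt) (lam : ℝ) (B : Set Pt) : Prop :=
  0 < lam ∧ B ⊆ Δ ∧ (∀ j, c j ∉ B) ∧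
  ∃ (n : ℤ) (t : ℝ) (u : Fin m → ℤ), (∀ j, u j = 0 ∨ u j = eps j) ∧
    (∃ M : Matrix.SpecialLinearGroup (Fin 2) ℤ,
        stMap c n t u '' B =
          (fun x => sl2Apply M x + stMap c n t u p) '' modelTriangle lam) ∧
    ∃ U : Set Pt, IsOpen U ∧ stMap c n t u p ∈ U ∧
      (stMap c n t u '' B) ∩ U = (stMap c n t u '' Δ) ∩ U

/-- `P` is a semitoric packing of the semitoric polygon `(Δ, c, eps)`: a finite union of
pairwise disjoint admissibly packed triangles, at most one at each vertex. -/
def IsSTPackingIn {m : ℕ} (Δ : Set Pt) (c : Fin m → Pt) (eps : Fin m → ℤ)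
    (P : Set Pt) : Prop :=
  ∃ (N : ℕ) (pt : Fin N → Pt) (lam : Fin N → ℝ) (tri : Fin N → Set Pt),
    P = (⋃ a, tri a) ∧ Function.Injective pt ∧
    (∀ a, pt a ∈ Set.extremePoints ℝ Δ) ∧
    (∀ a, IsSTPackedTriangleIn Δ c eps (pt a) (lam a) (tri a)) ∧
    Pairwise (Function.onFun Disjoint tri)

/-- The set of densities `area P / area Δ` of semitoric packings `P` of `(Δ, c, eps)`;
the semitoric packing density `ρ_ST` is its supremum. -/
def stDensitySet {m : ℕ} (Δ : Set Pt) (c : Fin m → Pt) (eps : Fin m → ℤ) : Set ℝ :=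
  {r : ℝ | ∃ P, IsSTPackingIn Δ c eps P ∧ r = area P / area Δ}

/-- The determinant of a pair of integer vectors in the plane. -/
def detZ (u v : Fin 2 → ℤ) : ℤ := u 0 * v 1 - u 1 * v 0

/-- The matrix `Tⁿ`, where `T = [[1,0],[1,1]]`. -/
def Tpow (n : ℤ) : Matrix (Fin 2) (Fin 2) ℤ := !![1, 0; n, 1]

/-- The combinatorial data of a semitoric polygon representative: a convex polygon with
vertices `V i` listed in clockwise order, the edge from `V i` to `V (i+1)` directed along
the primitive integer vector `dir i` with `SL₂(ℤ)`-length `len i`, together with marked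
points `c j` and cut directions `eps j ∈ {±1}`. -/
structure STRep (d m : ℕ) where
  V : Fin d → Pt
  dir : Fin d → Fin 2 → ℤ
  len : Fin d → ℝ
  c : Fin m → Pt
  eps : Fin m → ℤ

namespace STRep

variable {d m : ℕ}

/-- The underlying polygon (as a subset of the plane). -/
noncomputable def carrier (R : STRep d m) : Set Pt := convexHull ℝ (Set.range R.V)

/-- The cut of the marked point `c j` (the vertical ray from `c j` in the direction
`eps j`) meets the boundary of the polygon at the point `z`. -/
def CutHits (R : STRep d m) (j : Fin m) (z : Pt) : Prop :=
  z ∈ frontier R.carrier ∧ z 0 = R.c j 0 ∧ 0 ≤ (R.eps j : ℝ) * (z 1 - R.c j 1)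

/-- The number of cuts meeting the boundary of the polygon at the vertex `V i`. -/
noncomputable def numCuts (R : STRep d m) (i : Fin d) : ℕ :=
  Set.ncard {j | R.CutHits j (R.V i)}

/-- The first primitive integer vector emanating from the vertex `V i`
(so that `det (u1, u2) > 0` for a clockwise polygon). -/
def u1 [NeZero d] (R : STRep d m) (i : Fin d) : Fin 2 → ℤ := fun k => - R.dir (i - 1) k

/-- The second primitive integer vector emanating from the vertex `V i`. -/
def u2 (R : STRep d m) (i : Fin d) : Fin 2 → ℤ := R.dir i

/-- The vertex `V i` is a fake corner: at least one cut meets it and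
`det (u₁, Tᵏ u₂) = 0` where `k` is the number of cuts meeting it. -/
def IsFakeCorner [NeZero d] (R : STRep d m) (i : Fin d) : Prop :=
  0 < R.numCuts i ∧ detZ (R.u1 i) ((Tpow (R.numCuts i : ℤ)).mulVec (R.u2 i)) = 0

/-- The vertex `V i` is a hidden or Delzant corner (i.e. not a fake corner). -/
def IsHDCorner [NeZero d] (R : STRep d m) (i : Fin d) : Prop := ¬ R.IsFakeCorner i

/-- `R` is a valid semitoric polygon representative: the polygon is convex and rational
with vertices in clockwise order, the marked points lie in the interior, the cut
directions are `±1`, every point where exactly `k ≥ 1` cuts meet the boundary is a vertex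
satisfying the fake (`det (u₁, Tᵏ u₂) = 0`) or hidden (`det (u₁, Tᵏ u₂) = 1`) corner
condition, and every other vertex satisfies the Delzant condition
`det (u₁, u₂) = ±1`. -/
structure IsValid [NeZero d] (R : STRep d m) : Prop where
  three_le : 3 ≤ d
  len_pos : ∀ i, 0 < R.len i
  primitive : ∀ i, Int.gcd (R.dir i 0) (R.dir i 1) = 1
  edge_eq : ∀ i k, R.V (i + 1) k - R.V i k = R.len i * (R.dir i k : ℝ)
  clockwise : ∀ i, detZ (R.dir i) (R.dir (i + 1)) < 0
  edges_boundary : ∀ i, segment ℝ (R.V i) (R.V (i + 1)) ⊆ frontier R.carrier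
  marked_interior : ∀ j, R.c j ∈ interior R.carrier
  eps_pm : ∀ j, R.eps j = 1 ∨ R.eps j = -1
  cuts_at_vertices : ∀ j z, R.CutHits j z → ∃ i, z = R.V i
  corner_delzant : ∀ i, R.numCuts i = 0 →
    detZ (R.u1 i) (R.u2 i) = 1 ∨ detZ (R.u1 i) (R.u2 i) = -1
  corner_cut : ∀ i, 0 < R.numCuts i →
    detZ (R.u1 i) ((Tpow (R.numCuts i : ℤ)).mulVec (R.u2 i)) = 0 ∨
    detZ (R.u1 i) ((Tpow (R.numCuts i : ℤ)).mulVec (R.u2 i)) = 1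

end STRep

/-- An admissibly packed triangle in the semitoric polygon representative `R`. -/
def IsSTPackedTriangle {d m : ℕ} (R : STRep d m) (p : Pt) (lam : ℝ) (B : Set Pt) :
    Prop :=
  IsSTPackedTriangleIn R.carrier R.c R.eps p lam B

/-- `g` enumerates the hidden and Delzant corners of `R` in (clockwise) cyclic order:
`g` is strictly monotone and its range is exactly the set of hidden/Delzant corners. -/
def IsCornerEnum {d m D : ℕ} [NeZero d] (R : STRep d m) (g : Fin D → Fin d) : Prop :=
  StrictMono g ∧ ∀ i, R.IsHDCorner i ↔ ∃ a, g a = i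

/-- `P` is a semitoric packing of `R` whose triangle at the hidden/Delzant corner
`V (g a)` has `SL₂(ℤ)`-size `sz a` (with `sz a = 0` if no triangle is packed there). -/
def IsSTPacking {d m D : ℕ} (R : STRep d m) (g : Fin D → Fin d)
    (sz : Fin D → ℝ) (P : Set Pt) : Prop :=
  ∃ tri : Fin D → Set Pt,
    P = (⋃ a, tri a) ∧
    (∀ a, (sz a = 0 ∧ tri a = ∅) ∨
       IsSTPackedTriangle R (R.V (g a)) (sz a) (tri a)) ∧
    Pairwise (Function.onFun Disjoint tri)

/-- The number of steps from `s` to `i` going cyclically forwards in `Fin d`. -/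
def distCyc {d : ℕ} (s i : Fin d) : ℕ := (i.val + d - s.val) % d

/-- The number of edges in the cyclic chain of edges from vertex `s` to vertex `e`
(the whole cycle when `e = s`). -/
def chainLen {d : ℕ} (s e : Fin d) : ℕ := if e = s then d else distCyc s e

/-- The `SL₂(ℤ)`-length `ℓ_a` of the `a`-th semitoric edge: the sum of the
`SL₂(ℤ)`-lengths of the edges in the chain (joined at fake corners) connecting the
hidden/Delzant corner `V (g a)` to the next one `V (g (a+1))`. -/
noncomputable def stEdgeLen {d m D : ℕ} [NeZero D] (R : STRep d m) (g : Fin D → Fin d)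
    (a : Fin D) : ℝ :=
  ∑ i : Fin d, if distCyc (g a) i < chainLen (g a) (g (a + 1)) then R.len i else 0

/-- The point `q` lies on one of the two semitoric edges emanating from the
hidden/Delzant corner `V (g a)`, and `t` is the `SL₂(ℤ)`-length of the boundary path
(contained in that single semitoric edge) from `V (g a)` to `q`. -/
def OnEmanating {d m D : ℕ} [NeZero D] (R : STRep d m) (g : Fin D → Fin d)
    (a : Fin D) (q : Pt) (t : ℝ) : Prop :=
  (∃ (i : Fin d) (s : ℝ), distCyc (g a) i < chainLen (g a) (g (a + 1)) ∧
      0 ≤ s ∧ s ≤ R.len i ∧ (∀ k, q k = R.V i k + s * (R.dir i k : ℝ)) ∧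
      t = (∑ i' : Fin d, if distCyc (g a) i' < distCyc (g a) i then R.len i' else 0) + s) ∨
  (∃ (i : Fin d) (s : ℝ), distCyc (g (a - 1)) i < chainLen (g (a - 1)) (g a) ∧
      0 ≤ s ∧ s ≤ R.len i ∧ (∀ k, q k = R.V i k + s * (R.dir i k : ℝ)) ∧
      t = (∑ i' : Fin d, if distCyc (g (a - 1)) i < distCyc (g (a - 1)) i' ∧
              distCyc (g (a - 1)) i' < chainLen (g (a - 1)) (g a) then R.len i' else 0)
          + (R.len i - s))

/-- `lam ≤ α_a`, where `α_a` is the marked-point bound at the hidden/Delzant corner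
`V (g a)`: for each marked point `c j` whose vertical line meets a semitoric edge
emanating from `V (g a)`, taking the intersection point `q` whose boundary path from the
corner has minimal `SL₂(ℤ)`-length `t`, one has `lam ≤ t + b · |v₁ − w₁|`, where `b` is
the vertical distance from `c j` to `q` and `v, w` are the primitive integer vectors
directing the edges emanating from the corner. (`α_a = ∞` when there is no such marked
point, in which case this is no condition.) -/
def AlphaBound {d m D : ℕ} [NeZero d] [NeZero D] (R : STRep d m) (g : Fin D → Fin d)
    (a : Fin D) (lam : ℝ) : Prop :=
  ∀ (j : Fin m) (q : Pt) (t : ℝ),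
    OnEmanating R g a q t → q 0 = R.c j 0 →
    (∀ (q' : Pt) (t' : ℝ), OnEmanating R g a q' t' → q' 0 = R.c j 0 → t ≤ t') →
    lam ≤ t + |q 1 - R.c j 1| * |((R.dir (g a) 0 + R.dir (g a - 1) 0 : ℤ) : ℝ)|

/-- The polytope `𝒫̃_ST` of admissible size tuples:
`sz a ≥ 0`, `sz a + sz (a+1) ≤ ℓ_a` and `sz a ≤ α_a` for all `a` (cyclically). -/
def STPolytope {d m D : ℕ} [NeZero d] [NeZero D] (R : STRep d m)
    (g : Fin D → Fin d) : Set (Fin D → ℝ) :=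
  {sz | ∀ a, 0 ≤ sz a ∧ sz a + sz (a + 1) ≤ stEdgeLen R g a ∧ AlphaBound R g a (sz a)}

namespace STRep

variable {d m : ℕ}

/-- `det (dir i, z - V i)`, which is nonpositive on the polygon. -/
noncomputable def side (R : STRep d m) (i : Fin d) (z : Pt) : ℝ :=
  (R.dir i 0 : ℝ) * (z 1 - R.V i 1) - (R.dir i 1 : ℝ) * (z 0 - R.V i 0)

lemma V_mem (R : STRep d m) (i : Fin d) : R.V i ∈ R.carrier :=
  subset_convexHull ℝ _ (mem_range_self i)

lemma carrier_convex (R : STRep d m) : Convex ℝ R.carrier := convex_convexHull ℝ _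

lemma carrier_isCompact (R : STRep d m) : IsCompact R.carrier :=
  (finite_range R.V).isCompact_convexHull ℝ

lemma carrier_isClosed (R : STRep d m) : IsClosed R.carrier := R.carrier_isCompact.isClosed

variable [NeZero d] {R : STRep d m}

lemma IsValid.dir_det (hR : R.IsValid) (i : Fin d) :
    (R.dir i 0 : ℝ) * R.dir (i + 1) 1 - (R.dir i 1 : ℝ) * R.dir (i + 1) 0 < 0 := by
  have := hR.clockwise i
  unfold detZ at this
  exact_mod_cast this

lemma IsValid.dir_det_pred (hR : R.IsValid) (i : Fin d) :
    (R.dir (i - 1) 0 : ℝ) * R.dir i 1 - (R.dir (i - 1) 1 : ℝ) * R.dir i 0 < 0 := by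
  have := hR.dir_det (i - 1)
  rwa [sub_add_cancel] at this

lemma IsValid.V_succ (hR : R.IsValid) (i : Fin d) (k : Fin 2) :
    R.V (i + 1) k = R.V i k + R.len i * (R.dir i k : ℝ) := by
  have := hR.edge_eq i k
  linarith

lemma IsValid.V_pred (hR : R.IsValid) (i : Fin d) (k : Fin 2) :
    R.V i k = R.V (i - 1) k + R.len (i - 1) * (R.dir (i - 1) k : ℝ) := by
  have := hR.V_succ (i - 1) k
  rwa [sub_add_cancel] at this

lemma IsValid.carrier_interior_nonempty (hR : R.IsValid) : (interior R.carrier).Nonempty := by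
  rw [carrier, interior_convexHull_nonempty_iff_affineSpan_eq_top]
  have hne : ((affineSpan ℝ (range R.V) : AffineSubspace ℝ Pt) : Set Pt).Nonempty :=
    ⟨R.V 0, mem_affineSpan ℝ (mem_range_self _)⟩
  rw [← AffineSubspace.direction_eq_top_iff_of_nonempty hne, eq_top_iff]
  intro v _
  have h (i : Fin d) : (fun k => (R.dir i k : ℝ)) ∈ (affineSpan ℝ (range R.V)).direction := by
    have h1 : R.V (i + 1) -ᵥ R.V i ∈ (affineSpan ℝ (range R.V)).direction :=
      AffineSubspace.vsub_mem_direction (mem_affineSpan ℝ (mem_range_self _))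
        (mem_affineSpan ℝ (mem_range_self _))
    have h2 := Submodule.smul_mem _ (R.len i)⁻¹ h1
    convert h2 using 1
    ext k
    have := hR.V_succ i k
    have := (hR.len_pos i).ne'
    simp [hR.edge_eq]
    field_simp
  have hd := (hR.dir_det 0).ne
  set D : ℝ := (R.dir 0 0 : ℝ) * R.dir (0 + 1) 1 - (R.dir 0 1 : ℝ) * R.dir (0 + 1) 0 with hD
  have := Submodule.add_mem _
    (Submodule.smul_mem _ ((v 0 * R.dir (0 + 1) 1 - v 1 * R.dir (0 + 1) 0) / D) (h 0))
    (Submodule.smul_mem _ ((v 1 * R.dir 0 0 - v 0 * R.dir 0 1) / D) (h (0 + 1)))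
  convert this using 1
  ext k
  simp only [Pi.add_apply, Pi.smul_apply, smul_eq_mul]
  rw [div_mul_eq_mul_div, div_mul_eq_mul_div, ← add_div, eq_div_iff hd]
  fin_cases k <;> simp [hD] <;> ring

lemma IsValid.exists_support (hR : R.IsValid) {w : Pt} (hw : w ∈ frontier R.carrier) :
    ∃ A B : ℝ, (∀ z ∈ R.carrier, A * z 0 + B * z 1 ≤ A * w 0 + B * w 1) ∧
      (A ≠ 0 ∨ B ≠ 0) := by
  obtain ⟨f, hf⟩ := geometric_hahn_banach_open_point R.carrier_convex.interior isOpen_interior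
    (x := w) (fun h => hw.2 h)
  have hfe (z : Pt) : f z = f (Pi.single 0 1) * z 0 + f (Pi.single 1 1) * z 1 := by
    have : z = z 0 • Pi.single 0 1 + z 1 • Pi.single 1 1 := by
      ext k; fin_cases k <;> simp
    conv_lhs => rw [this]
    simp [mul_comm]
  refine ⟨f (Pi.single 0 1), f (Pi.single 1 1), fun z hz => ?_, ?_⟩
  · rw [← hfe, ← hfe]
    have hcl := R.carrier_convex.closure_interior_eq_closure_of_nonempty_interior
      hR.carrier_interior_nonempty
    have hz' : z ∈ closure (interior R.carrier) := hcl ▸ subset_closure hz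
    exact closure_minimal (fun a ha => (hf a ha).le)
      (isClosed_le f.continuous continuous_const) hz'
  · obtain ⟨o, ho⟩ := hR.carrier_interior_nonempty
    have := hf o ho
    by_contra hcon
    push Not at hcon
    rw [hfe, hfe w, hcon.1, hcon.2] at this
    simp at this

lemma IsValid.dir_sq_pos (hR : R.IsValid) (i : Fin d) :
    0 < (R.dir i 0 : ℝ) ^ 2 + (R.dir i 1 : ℝ) ^ 2 := by
  have hd := hR.dir_det i
  by_contra h
  have h0 : (R.dir i 0 : ℝ) = 0 := by nlinarith [sq_nonneg (R.dir i 0 : ℝ), sq_nonneg (R.dir i 1 : ℝ)]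
  have h1 : (R.dir i 1 : ℝ) = 0 := by nlinarith [sq_nonneg (R.dir i 0 : ℝ), sq_nonneg (R.dir i 1 : ℝ)]
  simp [h0, h1] at hd

lemma IsValid.edge_mem_frontier (hR : R.IsValid) {i : Fin d} {s : ℝ} (h0 : 0 ≤ s)
    (h1 : s ≤ R.len i) {z : Pt} (hz : ∀ k, z k = R.V i k + s * (R.dir i k : ℝ)) :
    z ∈ frontier R.carrier := by
  apply hR.edges_boundary i
  have hl := hR.len_pos i
  refine ⟨1 - s / R.len i, s / R.len i, ?_, by positivity, by ring, ?_⟩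
  · rw [sub_nonneg, div_le_one hl]; exact h1
  · ext k
    simp only [Pi.add_apply, Pi.smul_apply, smul_eq_mul, hR.V_succ, hz]
    field_simp
    ring

lemma IsValid.side_nonpos (hR : R.IsValid) (i : Fin d) {z : Pt} (hz : z ∈ R.carrier) :
    R.side i z ≤ 0 := by
  have hl := hR.len_pos i
  set w : Pt := fun k => R.V i k + R.len i / 2 * (R.dir i k : ℝ) with hw
  obtain ⟨A, B, hAB, hne⟩ := hR.exists_support
    (hR.edge_mem_frontier (i := i) (s := R.len i / 2) (z := w) (by positivity) (by linarith)
      (fun k => rfl))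
  have e0 := hAB _ (R.V_mem i)
  have e1 := hAB _ (R.V_mem (i + 1))
  have e2 := hAB _ (R.V_mem (i + 1 + 1))
  have e3 := hAB _ hz
  have hd := hR.dir_det i
  have hl' := hR.len_pos (i + 1)
  have hsq := hR.dir_sq_pos i
  simp only [hw, hR.V_succ] at e0 e1 e2 e3
  unfold side
  set a : ℝ := (R.dir i 0 : ℝ)
  set b : ℝ := (R.dir i 1 : ℝ)
  set a' : ℝ := (R.dir (i + 1) 0 : ℝ)
  set b' : ℝ := (R.dir (i + 1) 1 : ℝ)
  have hz0 : A * a + B * b = 0 := by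
    have h1 : R.len i * (A * a + B * b) ≤ 0 := by linarith
    have h2 : 0 ≤ R.len i * (A * a + B * b) := by linarith
    have : R.len i * (A * a + B * b) = 0 := le_antisymm h1 h2
    rcases mul_eq_zero.1 this with h | h
    · exact absurd h hl.ne'
    · exact h
  set μ := (B * a - A * b) / (a ^ 2 + b ^ 2) with hμ
  have hA : A = -μ * b := by
    rw [hμ]; field_simp; linear_combination a * hz0
  have hB : B = μ * a := by
    rw [hμ]; field_simp; linear_combination b * hz0
  have hμ0 : μ ≠ 0 := by
    rintro h; rw [h] at hA hB; simp at hA hB; simp [hA, hB] at hne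
  rw [hA, hB] at e2 e3
  have e2' : R.len (i + 1) * (μ * (a * b' - b * a')) ≤ 0 := by linarith
  have hμ1 : 0 ≤ μ := by
    have : μ * (a * b' - b * a') ≤ 0 := by
      by_contra h; push Not at h
      have := mul_pos hl' h
      linarith
    nlinarith
  have hμ2 : 0 < μ := lt_of_le_of_ne hμ1 hμ0.symm
  by_contra h
  push Not at h
  have := mul_pos hμ2 h
  linarith

lemma IsValid.side_pred_eq (hR : R.IsValid) (i : Fin d) (z : Pt) :
    R.side (i - 1) z = (R.dir (i - 1) 0 : ℝ) * (z 1 - R.V i 1) -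
      (R.dir (i - 1) 1 : ℝ) * (z 0 - R.V i 0) := by
  rw [side, hR.V_pred i 0, hR.V_pred i 1]; ring

lemma IsValid.side_pred_nonpos (hR : R.IsValid) (i : Fin d) {z : Pt} (hz : z ∈ R.carrier) :
    (R.dir (i - 1) 0 : ℝ) * (z 1 - R.V i 1) -
      (R.dir (i - 1) 1 : ℝ) * (z 0 - R.V i 0) ≤ 0 := by
  rw [← hR.side_pred_eq]; exact hR.side_nonpos _ hz

lemma IsValid.side_neg_of_interior (hR : R.IsValid) (i : Fin d) {z : Pt}
    (hz : z ∈ interior R.carrier) : R.side i z < 0 := by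
  have hc : Filter.Tendsto (fun ε : ℝ => z + ε • ![-(R.dir i 1 : ℝ), (R.dir i 0 : ℝ)])
      (nhdsWithin 0 (Ioi 0)) (nhds z) := by
    have : Continuous fun ε : ℝ => z + ε • ![-(R.dir i 1 : ℝ), (R.dir i 0 : ℝ)] := by fun_prop
    have h := this.tendsto 0
    simp only [zero_smul, add_zero] at h
    exact h.mono_left nhdsWithin_le_nhds
  have hev := hc.eventually (isOpen_interior.mem_nhds hz)
  obtain ⟨ε, hε, hpos⟩ := (hev.and self_mem_nhdsWithin).exists
  have h1 := hR.side_nonpos i (interior_subset hε)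
  have h2 := hR.dir_sq_pos i
  have hpos' : 0 < ε := hpos
  have h3 := mul_pos hpos' h2
  simp only [side, Pi.add_apply, Pi.smul_apply, smul_eq_mul, Matrix.cons_val_zero,
    Matrix.cons_val_one] at h1 ⊢
  nlinarith

/-- The boundary of the polygon is the union of its edges. -/
lemma IsValid.exists_edge_of_frontier (hR : R.IsValid) {w : Pt}
    (hw : w ∈ frontier R.carrier) : ∃ i, R.side i w = 0 := by
  obtain ⟨A, B, hAB, hne⟩ := hR.exists_support hw
  have hwc : w ∈ R.carrier := R.carrier_isClosed.frontier_subset hw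
  obtain ⟨k, hk⟩ : ∃ k, A * w 0 + B * w 1 ≤ A * R.V k 0 + B * R.V k 1 := by
    by_contra hcon
    push Not at hcon
    have hconv : Convex ℝ {z : Pt | A * z 0 + B * z 1 < A * w 0 + B * w 1} := by
      intro x hx y hy a b ha hb hab
      simp only [mem_ofPred_eq, Pi.add_apply, Pi.smul_apply, smul_eq_mul] at *
      rcases ha.eq_or_lt with rfl | ha
      · have : b = 1 := by linarith
        subst this; linarith
      · have h1 := mul_lt_mul_of_pos_left hx ha
        have h2 := mul_le_mul_of_nonneg_left hy.le hb
        have h3 : a * (A * w 0 + B * w 1) + b * (A * w 0 + B * w 1) = A * w 0 + B * w 1 := by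
          rw [← add_mul, hab, one_mul]
        linarith
    have : R.carrier ⊆ _ := convexHull_min (by rintro _ ⟨i, rfl⟩; exact hcon i) hconv
    simpa using this hwc
  have hd := hR.dir_det_pred k
  have s1 := hR.side_pred_nonpos k hwc
  have s2 := hR.side_nonpos k hwc
  have f1 := hAB _ (R.V_mem (k + 1))
  have f2 := hAB _ (R.V_mem (k - 1))
  have f3 := hAB _ (R.V_mem k)
  have hl := hR.len_pos k
  have hl' := hR.len_pos (k - 1)
  by_contra hcon
  push Not at hcon
  have n1 := hcon (k - 1)
  have n2 := hcon k
  rw [hR.side_pred_eq] at n1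
  have p0 := hR.V_pred k 0
  have p1 := hR.V_pred k 1
  rw [hR.V_succ, hR.V_succ] at f1
  unfold side at s2 n2
  set a : ℝ := (R.dir (k - 1) 0 : ℝ)
  set b : ℝ := (R.dir (k - 1) 1 : ℝ)
  set a' : ℝ := (R.dir k 0 : ℝ)
  set b' : ℝ := (R.dir k 1 : ℝ)
  have g1 : A * a' + B * b' ≤ 0 := by
    have : R.len k * (A * a' + B * b') ≤ 0 := by linarith
    exact nonpos_of_mul_nonpos_right this hl
  have g2 : 0 ≤ A * a + B * b := by
    have : R.len (k - 1) * (-(A * a + B * b)) ≤ 0 := by rw [p0, p1] at hk; linarith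
    have := nonpos_of_mul_nonpos_right this hl'
    linarith
  have s1' := lt_of_le_of_ne s1 n1
  have s2' := lt_of_le_of_ne s2 n2
  set X := w 0 - R.V k 0
  set Y := w 1 - R.V k 1
  have key : (A * X + B * Y) * (a * b' - b * a') =
      (a * Y - b * X) * (A * a' + B * b') - (a' * Y - b' * X) * (A * a + B * b) := by ring
  have hz : A * X + B * Y = 0 := by simp only [X, Y]; linarith
  rw [hz, zero_mul] at key
  have k1 := mul_nonneg_of_nonpos_of_nonpos s1'.le g1
  have k2 := mul_nonpos_of_nonpos_of_nonneg s2'.le g2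
  have k3 : A * a' + B * b' = 0 := by
    have : (a * Y - b * X) * (A * a' + B * b') = 0 := by linarith
    exact (mul_eq_zero.1 this).resolve_left s1'.ne
  have k4 : A * a + B * b = 0 := by
    have : (a' * Y - b' * X) * (A * a + B * b) = 0 := by linarith
    exact (mul_eq_zero.1 this).resolve_left s2'.ne
  have hA : A * (a * b' - b * a') = 0 := by linear_combination b' * k4 - b * k3
  have hB : B * (a * b' - b * a') = 0 := by linear_combination a * k3 - a' * k4
  rcases hne with h | h
  · exact h ((mul_eq_zero.1 hA).resolve_right hd.ne)
  · exact h ((mul_eq_zero.1 hB).resolve_right hd.ne)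

/-- The polygon is the intersection of the half-planes cut out by its edges. -/
lemma IsValid.mem_carrier_iff (hR : R.IsValid) {z : Pt} :
    z ∈ R.carrier ↔ ∀ i, R.side i z ≤ 0 := by
  refine ⟨fun hz i => hR.side_nonpos i hz, fun hz => ?_⟩
  by_contra hzc
  obtain ⟨o, ho⟩ := hR.carrier_interior_nonempty
  have hcon : IsPreconnected (segment ℝ o z) := (convex_segment o z).isPreconnected
  obtain ⟨w, hws, hwf⟩ : (segment ℝ o z ∩ frontier R.carrier).Nonempty := by
    have := isPreconnected_iff_subset_of_disjoint.1 hcon (interior R.carrier) (R.carrierᶜ)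
      isOpen_interior R.carrier_isClosed.isOpen_compl
    by_contra hemp
    rw [not_nonempty_iff_eq_empty] at hemp
    have hsub : segment ℝ o z ⊆ interior R.carrier ∪ R.carrierᶜ := by
      intro x hx
      by_cases hxc : x ∈ R.carrier
      · left
        by_contra hxi
        have : x ∈ segment ℝ o z ∩ frontier R.carrier := ⟨hx, subset_closure hxc, hxi⟩
        rw [hemp] at this
        exact this
      · right; exact hxc
    have hdis : segment ℝ o z ∩ (interior R.carrier ∩ R.carrierᶜ) = ∅ := by
      ext x
      simp only [mem_inter_iff, mem_compl_iff, mem_empty_iff_false, iff_false]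
      rintro ⟨_, h1, h2⟩
      exact h2 (interior_subset h1)
    rcases this hsub hdis with h | h
    · exact hzc (interior_subset (h (right_mem_segment ℝ o z)))
    · exact h (left_mem_segment ℝ o z) (interior_subset ho)
  obtain ⟨i, hi⟩ := hR.exists_edge_of_frontier hwf
  obtain ⟨a, b, ha, hb, hab, rfl⟩ := hws
  have h1 := hR.side_neg_of_interior i ho
  have h2 := hz i
  have h3 : R.side i (a • o + b • z) = a * R.side i o + b * R.side i z := by
    simp only [side, Pi.add_apply, Pi.smul_apply, smul_eq_mul]
    have : b = 1 - a := by linarith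
    subst this; ring
  rw [h3] at hi
  have ha0 : a = 0 := by
    by_contra hne
    have := mul_neg_of_pos_of_neg (lt_of_le_of_ne ha (Ne.symm hne)) h1
    have := mul_nonpos_of_nonneg_of_nonpos hb h2
    linarith
  subst ha0
  have : b = 1 := by linarith
  subst this
  simp at hwf
  exact hzc (R.carrier_isClosed.frontier_subset hwf)

end STRep

lemma Int.eq_or_neg_of_parallel {a b a' b' : ℤ} (h : Int.gcd a b = 1) (h' : Int.gcd a' b' = 1)
    (hd : a * b' - b * a' = 0) : (a' = a ∧ b' = b) ∨ (a' = -a ∧ b' = -b) := by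
  obtain ⟨u, v, huv⟩ := Int.isCoprime_iff_gcd_eq_one.2 h
  obtain ⟨u', v', huv'⟩ := Int.isCoprime_iff_gcd_eq_one.2 h'
  have ha : a' = a * (u * a' + v * b') := by linear_combination (-a') * huv - v * hd
  have hb : b' = b * (u * a' + v * b') := by linear_combination (-b') * huv + u * hd
  have ht : (u' * a + v' * b) * (u * a' + v * b') = 1 := by
    linear_combination huv' - u' * ha - v' * hb
  rcases Int.isUnit_iff.1 (IsUnit.of_mul_eq_one_right _ ht) with h1 | h1
  · left; rw [h1] at ha hb; omega
  · right; rw [h1] at ha hb; omega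

namespace STRep

variable {d m : ℕ} [NeZero d] {R : STRep d m}

lemma IsValid.vertex_notMem_open_edge (hR : R.IsValid) {i k : Fin d} {s : ℝ} (h0 : 0 < s)
    (h1 : s < R.len i) (h : ∀ l, R.V k l = R.V i l + s * (R.dir i l : ℝ)) : False := by
  have a1 := hR.side_pred_nonpos k (R.V_mem i)
  have a2 := hR.side_pred_nonpos k (R.V_mem (i + 1))
  have b1 := hR.side_nonpos k (R.V_mem i)
  have b2 := hR.side_nonpos k (R.V_mem (i + 1))
  have hd := hR.dir_det_pred k
  have hsq := hR.dir_sq_pos i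
  unfold side at b1 b2
  rw [hR.V_succ, hR.V_succ, h, h] at a2 b2
  rw [h, h] at a1 b1
  set a : ℝ := (R.dir (k - 1) 0 : ℝ)
  set b : ℝ := (R.dir (k - 1) 1 : ℝ)
  set a' : ℝ := (R.dir k 0 : ℝ)
  set b' : ℝ := (R.dir k 1 : ℝ)
  set x : ℝ := (R.dir i 0 : ℝ)
  set y : ℝ := (R.dir i 1 : ℝ)
  have hA : a * y - b * x = 0 := by
    apply le_antisymm
    · have : (R.len i - s) * (a * y - b * x) ≤ 0 := by linarith
      exact nonpos_of_mul_nonpos_right this (by linarith)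
    · have : s * (-(a * y - b * x)) ≤ 0 := by linarith
      have := nonpos_of_mul_nonpos_right this h0
      linarith
  have hB : a' * y - b' * x = 0 := by
    apply le_antisymm
    · have : (R.len i - s) * (a' * y - b' * x) ≤ 0 := by linarith
      exact nonpos_of_mul_nonpos_right this (by linarith)
    · have : s * (-(a' * y - b' * x)) ≤ 0 := by linarith
      have := nonpos_of_mul_nonpos_right this h0
      linarith
  have hx : x * (a * b' - b * a') = 0 := by linear_combination a' * hA - a * hB
  have hy : y * (a * b' - b * a') = 0 := by linear_combination b' * hA - b * hB
  have hx := (mul_eq_zero.1 hx).resolve_right hd.ne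
  have hy := (mul_eq_zero.1 hy).resolve_right hd.ne
  simp [hx, hy] at hsq

lemma IsValid.dir_eq_of_V_eq (hR : R.IsValid) {i k : Fin d} (h : R.V i = R.V k) :
    R.dir i = R.dir k ∧ R.V (i + 1) = R.V (k + 1) := by
  have a1 := hR.side_nonpos i (R.V_mem (k + 1))
  have a2 := hR.side_nonpos k (R.V_mem (i + 1))
  have a3 := hR.side_pred_nonpos i (R.V_mem (k + 1))
  have hd := hR.dir_det_pred i
  have hli := hR.len_pos i
  have hlk := hR.len_pos k
  unfold side at a1 a2
  rw [hR.V_succ, hR.V_succ] at a1 a2 a3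
  rw [h] at a1 a2 a3
  have hpar : (R.dir i 0 : ℝ) * R.dir k 1 - R.dir i 1 * R.dir k 0 = 0 := by
    apply le_antisymm
    · have : R.len k * ((R.dir i 0 : ℝ) * R.dir k 1 - R.dir i 1 * R.dir k 0) ≤ 0 := by linarith
      exact nonpos_of_mul_nonpos_right this hlk
    · have : R.len i * (-((R.dir i 0 : ℝ) * R.dir k 1 - R.dir i 1 * R.dir k 0)) ≤ 0 := by
        linarith
      have := nonpos_of_mul_nonpos_right this hli
      linarith
  have hdir : R.dir i = R.dir k := by
    rcases Int.eq_or_neg_of_parallel (hR.primitive i) (hR.primitive k)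
      (by exact_mod_cast hpar) with ⟨h0, h1⟩ | ⟨h0, h1⟩
    · ext l; fin_cases l <;> simp [h0, h1]
    · exfalso
      rw [h0, h1] at a3
      push_cast at a3
      have := mul_neg_of_pos_of_neg hlk hd
      linarith
  refine ⟨hdir, ?_⟩
  have hlen : R.len i = R.len k := by
    rcases lt_trichotomy (R.len i) (R.len k) with hlt | heq | hgt
    · exact (hR.vertex_notMem_open_edge (k := i + 1) (i := k) hli hlt
        (fun l => by rw [hR.V_succ, h, hdir])).elim
    · exact heq
    · exact (hR.vertex_notMem_open_edge (k := k + 1) (i := i) hlk hgt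
        (fun l => by rw [hR.V_succ, h, hdir])).elim
  ext l
  rw [hR.V_succ, hR.V_succ, h, hlen, hdir]

open Fin.NatCast in
lemma IsValid.V_injective (hR : R.IsValid) {D : ℕ} [NeZero D] {g : Fin D → Fin d}
    (hg : IsCornerEnum R g)
    (hlex : ∀ a : Fin D, a ≠ 0 →
      R.V (g 0) 0 < R.V (g a) 0 ∨
        (R.V (g 0) 0 = R.V (g a) 0 ∧ R.V (g 0) 1 < R.V (g a) 1)) :
    Function.Injective R.V := by
  intro i k hik
  by_contra hne
  have hper (n : ℕ) : R.V (i + (n : Fin d)) = R.V (k + (n : Fin d)) := by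
    induction n with
    | zero => simpa using hik
    | succ n ih =>
      have := (hR.dir_eq_of_V_eq ih).2
      rw [add_assoc, add_assoc] at this
      exact_mod_cast this
  have hper' (j : Fin d) : R.V j = R.V (j + (k - i)) := by
    have := hper (j - i).val
    rw [Fin.cast_val_eq_self] at this
    convert this using 2 <;> abel
  set r := k - i with hr
  have hr0 : r ≠ 0 := by rw [hr]; exact sub_ne_zero.2 (Ne.symm hne)
  have hdir (j : Fin d) : R.dir j = R.dir (j + r) := (hR.dir_eq_of_V_eq (hper' j)).1
  have hnum (j : Fin d) : R.numCuts j = R.numCuts (j + r) := by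
    unfold numCuts; rw [hper' j]
  have hfake : R.IsHDCorner (g 0 + r) := by
    have h0 := (hg.2 (g 0)).2 ⟨0, rfl⟩
    unfold IsHDCorner IsFakeCorner u1 u2 at h0 ⊢
    rw [← hnum, ← hdir, add_sub_right_comm, ← hdir]
    exact h0
  obtain ⟨a, ha⟩ := (hg.2 _).1 hfake
  have ha0 : a ≠ 0 := by
    rintro rfl
    exact hr0 (left_eq_add.1 ha)
  have := hlex a ha0
  rw [ha, ← hper'] at this
  simp at this

lemma IsValid.edge_point_unique (hR : R.IsValid) (hinj : Function.Injective R.V)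
    {i k : Fin d} {s r : ℝ} (hs0 : 0 ≤ s) (hs : s < R.len i) (hr0 : 0 ≤ r) (hr : r < R.len k)
    (h : ∀ l, R.V i l + s * (R.dir i l : ℝ) = R.V k l + r * (R.dir k l : ℝ)) :
    i = k ∧ s = r := by
  rcases hs0.eq_or_lt with rfl | hs1
  · rcases hr0.eq_or_lt with rfl | hr1
    · exact ⟨hinj (by ext l; have := h l; linarith), rfl⟩
    · exact (hR.vertex_notMem_open_edge hr1 hr (k := i) (fun l => by rw [← h l]; ring)).elim
  rcases hr0.eq_or_lt with rfl | hr1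
  · exact (hR.vertex_notMem_open_edge hs1 hs (k := k) (fun l => by rw [h l]; ring)).elim
  have a1 := hR.side_nonpos i (R.V_mem k)
  have a2 := hR.side_nonpos i (R.V_mem (k + 1))
  have a3 := hR.side_nonpos k (R.V_mem (i + 1 + 1))
  have h0 := h 0
  have h1 := h 1
  unfold side at a1 a2 a3
  simp only [hR.V_succ] at a2 a3
  have e0 : R.V k 0 = R.V i 0 + s * (R.dir i 0 : ℝ) - r * (R.dir k 0 : ℝ) := by linarith
  have e1 : R.V k 1 = R.V i 1 + s * (R.dir i 1 : ℝ) - r * (R.dir k 1 : ℝ) := by linarith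
  rw [e0, e1] at a1 a2 a3
  have hpar : (R.dir i 0 : ℝ) * R.dir k 1 - R.dir i 1 * R.dir k 0 = 0 := by
    apply le_antisymm
    · have : (R.len k - r) * ((R.dir i 0 : ℝ) * R.dir k 1 - R.dir i 1 * R.dir k 0) ≤ 0 := by
        linarith
      exact nonpos_of_mul_nonpos_right this (by linarith)
    · have : r * (-((R.dir i 0 : ℝ) * R.dir k 1 - R.dir i 1 * R.dir k 0)) ≤ 0 := by
        linarith
      have := nonpos_of_mul_nonpos_right this hr1
      linarith
  rcases Int.eq_or_neg_of_parallel (hR.primitive i) (hR.primitive k)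
    (by exact_mod_cast hpar) with ⟨p0, p1⟩ | ⟨p0, p1⟩
  · rcases lt_trichotomy s r with hlt | heq | hgt
    · refine (hR.vertex_notMem_open_edge (k := i) (i := k) (s := r - s) (by linarith)
        (by linarith) (fun l => ?_)).elim
      have := h l
      have hl : R.dir k l = R.dir i l := by fin_cases l <;> simp [p0, p1]
      rw [hl] at this ⊢
      linarith
    · refine ⟨hinj ?_, heq⟩
      ext l
      have := h l
      have hl : R.dir k l = R.dir i l := by fin_cases l <;> simp [p0, p1]
      rw [hl, heq] at this
      linarith
    · refine (hR.vertex_notMem_open_edge (k := k) (i := i) (s := s - r) (by linarith)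
        (by linarith) (fun l => ?_)).elim
      have := h l
      have hl : R.dir k l = R.dir i l := by fin_cases l <;> simp [p0, p1]
      rw [hl] at this
      linarith
  · exfalso
    rw [p0, p1] at a3
    push_cast at a3
    have := mul_neg_of_pos_of_neg (hR.len_pos (i + 1)) (hR.dir_det i)
    linarith

/-- The vertex `V k` lies on the upper (`s = 1`) or lower (`s = -1`) part of the boundary,
and is neither leftmost nor rightmost. -/
def IsSide (R : STRep d m) (s : ℤ) (k : Fin d) : Prop :=
  0 < s * R.dir (k - 1) 0 ∧ 0 < s * R.dir k 0

lemma IsValid.V_mem_frontier (hR : R.IsValid) (k : Fin d) : R.V k ∈ frontier R.carrier :=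
  hR.edges_boundary k (left_mem_segment ℝ _ _)

lemma IsValid.c_side (hR : R.IsValid) (j : Fin m) (k : Fin d) :
    (R.dir k 0 : ℝ) * (R.c j 1 - R.V k 1) - (R.dir k 1 : ℝ) * (R.c j 0 - R.V k 0) < 0 :=
  hR.side_neg_of_interior k (hR.marked_interior j)

lemma IsValid.c_side_pred (hR : R.IsValid) (j : Fin m) (k : Fin d) :
    (R.dir (k - 1) 0 : ℝ) * (R.c j 1 - R.V k 1) -
      (R.dir (k - 1) 1 : ℝ) * (R.c j 0 - R.V k 0) < 0 := by
  rw [← hR.side_pred_eq]; exact hR.side_neg_of_interior _ (hR.marked_interior j)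

lemma IsValid.isSide_of_c_eq (hR : R.IsValid) {j : Fin m} {k : Fin d}
    (h : R.c j 0 = R.V k 0) : R.IsSide 1 k ∨ R.IsSide (-1) k := by
  have h1 := hR.c_side j k
  have h2 := hR.c_side_pred j k
  rw [h, sub_self, mul_zero, sub_zero] at h1 h2
  unfold IsSide
  rcases mul_neg_iff.1 h1 with ⟨a, b⟩ | ⟨a, b⟩
  · rcases mul_neg_iff.1 h2 with ⟨a', b'⟩ | ⟨a', b'⟩
    · left; constructor <;> rw [one_mul]
      · exact_mod_cast a'
      · exact_mod_cast a
    · linarith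
  · rcases mul_neg_iff.1 h2 with ⟨a', b'⟩ | ⟨a', b'⟩
    · linarith
    · right; constructor <;> rw [neg_one_mul, neg_pos]
      · exact_mod_cast a'
      · exact_mod_cast a

lemma IsValid.cutHits_iff (hR : R.IsValid) {s : ℤ} (hs : s = 1 ∨ s = -1) {k : Fin d}
    (hk : R.IsSide s k) (j : Fin m) :
    R.CutHits j (R.V k) ↔ R.c j 0 = R.V k 0 ∧ R.eps j = s := by
  have key (h : R.c j 0 = R.V k 0) : 0 < (s : ℝ) * (R.V k 1 - R.c j 1) := by
    have h1 := hR.c_side j k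
    rw [h, sub_self, mul_zero, sub_zero] at h1
    have h2 : (0 : ℝ) < s * R.dir k 0 := by exact_mod_cast hk.2
    have hs2 : (s : ℝ) * s = 1 := by rcases hs with rfl | rfl <;> norm_num
    by_contra hcon
    push Not at hcon
    have := mul_nonneg_of_nonpos_of_nonpos hcon (neg_nonpos.2 h2.le)
    have e : (s : ℝ) * (R.V k 1 - R.c j 1) * -(s * R.dir k 0)
      = (s * s) * (R.dir k 0 * (R.c j 1 - R.V k 1)) := by ring
    rw [e, hs2] at this
    linarith
  constructor
  · rintro ⟨_, h0, h1⟩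
    have hk' := key h0.symm
    refine ⟨h0.symm, ?_⟩
    rcases hR.eps_pm j with he | he <;> rcases hs with rfl | rfl <;> rw [he] at h1 ⊢ <;>
      push_cast at h1 hk' <;> exfalso <;> linarith
  · rintro ⟨h0, h1⟩
    refine ⟨hR.V_mem_frontier k, h0.symm, ?_⟩
    rw [h1]; exact (key h0).le

lemma IsValid.numCuts_eq (hR : R.IsValid) {s : ℤ} (hs : s = 1 ∨ s = -1) {k : Fin d}
    (hk : R.IsSide s k) :
    (R.numCuts k : ℤ) = ∑ j, if R.c j 0 = R.V k 0 ∧ R.eps j = s then 1 else 0 := by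
  classical
  unfold numCuts
  simp only [hR.cutHits_iff hs hk]
  rw [Set.ncard_eq_toFinset_card']
  simp

omit [NeZero d] in
lemma numCuts_eq_zero {k : Fin d}
    (hk : ∀ j, R.c j 0 ≠ R.V k 0) : R.numCuts k = 0 := by
  unfold numCuts
  have : {j | R.CutHits j (R.V k)} = ∅ := by
    ext j
    simp only [mem_empty_iff_false, iff_false]
    rintro ⟨_, h, _⟩
    exact hk j h.symm
  rw [this, Set.ncard_empty]

lemma IsValid.isSide_of_isFakeCorner (hR : R.IsValid) {k : Fin d} (hk : R.IsFakeCorner k) :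
    R.IsSide 1 k ∨ R.IsSide (-1) k := by
  by_contra hcon
  have : R.numCuts k = 0 := numCuts_eq_zero fun j hj => hcon (hR.isSide_of_c_eq hj)
  exact absurd hk.1 (by omega)

/-- At a vertex which is not a fake corner, unbending all cuts yields determinant one. -/
lemma IsValid.det_hd (hR : R.IsValid) {k : Fin d} (hk : R.IsHDCorner k) :
    -(R.dir (k - 1) 0 * R.dir k 1) + R.dir (k - 1) 1 * R.dir k 0 -
      R.numCuts k * (R.dir (k - 1) 0 * R.dir k 0) = 1 := by
  have hcl := hR.clockwise (k - 1)
  rw [sub_add_cancel] at hcl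
  unfold detZ at hcl
  rcases Nat.eq_zero_or_pos (R.numCuts k) with h0 | h0
  · have := hR.corner_delzant k h0
    simp only [detZ, u1, u2] at this
    rw [h0]; push_cast
    rcases this with h | h <;> linarith
  · have h := hR.corner_cut k h0
    rcases h with h | h
    · exact absurd ⟨h0, h⟩ hk
    · simp [detZ, u1, u2, Tpow, Matrix.mulVec, dotProduct, Fin.sum_univ_two] at h
      linarith

lemma IsValid.det_corner_nonneg (hR : R.IsValid) (k : Fin d) :
    0 ≤ -(R.dir (k - 1) 0 * R.dir k 1) + R.dir (k - 1) 1 * R.dir k 0 -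
      R.numCuts k * (R.dir (k - 1) 0 * R.dir k 0) := by
  by_cases hk : R.IsFakeCorner k
  · have h := hk.2
    simp [detZ, u1, u2, Tpow, Matrix.mulVec, dotProduct, Fin.sum_univ_two] at h
    linarith
  · rw [hR.det_hd hk]; norm_num

/-- At a fake corner the incoming direction is the image under `Tᵏ` of the outgoing one. -/
lemma IsValid.dir_fake (hR : R.IsValid) {k : Fin d} (hk : R.IsFakeCorner k) :
    R.dir (k - 1) 0 = R.dir k 0 ∧
      R.dir (k - 1) 1 = R.dir k 1 + R.numCuts k * R.dir k 0 := by
  have h := hk.2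
  simp [detZ, u1, u2, Tpow, Matrix.mulVec, dotProduct, Fin.sum_univ_two] at h
  have hg : Int.gcd (R.dir k 0) (R.dir k 1 + R.numCuts k * R.dir k 0) = 1 := by
    have := hR.primitive k
    rwa [Int.gcd_add_mul_right_right]
  have hs := hR.isSide_of_isFakeCorner hk
  unfold IsSide at hs
  rcases Int.eq_or_neg_of_parallel hg (hR.primitive (k - 1)) (by linarith) with ⟨h0, h1⟩ | ⟨h0, h1⟩
  · exact ⟨h0, h1⟩
  · omega

end STRep

/-- A continuous function on an interval which near every interior point lies below an affine
function touching it there lies above its chord. -/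
lemma chord_le_of_local_support {a b : ℝ} {f : ℝ → ℝ} (hf : ContinuousOn f (Icc a b))
    (hs : ∀ c ∈ Ioo a b, ∃ k : ℝ, ∀ᶠ x in nhds c, f x ≤ f c + k * (x - c))
    {y : ℝ} (hy : y ∈ Icc a b) : (b - y) * f a + (y - a) * f b ≤ (b - a) * f y := by
  rcases (hy.1.trans hy.2).eq_or_lt with rfl | hab
  · have : y = a := le_antisymm hy.2 hy.1
    subst this; linarith
  set h : ℝ → ℝ := fun x => (b - a) * f x - ((b - x) * f a + (x - a) * f b) with hh
  have hc : ContinuousOn h (Icc a b) := by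
    apply ContinuousOn.sub (continuousOn_const.mul hf)
    fun_prop
  by_contra hlt
  push Not at hlt
  obtain ⟨c₀, hc₀, hmin⟩ := isCompact_Icc.exists_isMinOn ⟨y, hy⟩ hc
  set S : Set ℝ := Icc a b ∩ h ⁻¹' {h c₀}
  have hS : IsCompact S :=
    isCompact_Icc.of_isClosed_subset
      (hc.preimage_isClosed_of_isClosed isClosed_Icc isClosed_singleton) inter_subset_left
  obtain ⟨c, ⟨hcI, hcv⟩, hleast⟩ := hS.exists_isLeast ⟨c₀, hc₀, rfl⟩
  have hneg : h c < 0 := by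
    have := hmin hy
    rw [mem_preimage, mem_singleton_iff] at hcv
    simp only [mem_ofPred_eq] at this
    rw [hcv]; refine lt_of_le_of_lt this ?_
    simp only [hh]; linarith
  have hca : a ≠ c := by
    rintro rfl
    simp only [hh] at hneg; linarith
  have hcb : c ≠ b := by
    rintro rfl
    simp only [hh] at hneg; linarith
  have hcIoo : c ∈ Ioo a b := ⟨lt_of_le_of_ne hcI.1 hca, lt_of_le_of_ne hcI.2 hcb⟩
  obtain ⟨k, hk⟩ := hs c hcIoo
  have hk' : ∀ᶠ x in nhds c, 0 ≤ ((b - a) * k + f a - f b) * (x - c) ∧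
      h x ≤ h c + ((b - a) * k + f a - f b) * (x - c) := by
    filter_upwards [hk, Ioo_mem_nhds hcIoo.1 hcIoo.2] with x hx hxI
    have h1 : h x ≤ h c + ((b - a) * k + f a - f b) * (x - c) := by
      have := mul_le_mul_of_nonneg_left hx (sub_pos.2 hab).le
      simp only [hh]; linarith
    refine ⟨?_, h1⟩
    have := hmin ⟨hxI.1.le, hxI.2.le⟩
    simp only [mem_ofPred_eq] at this
    rw [mem_preimage, mem_singleton_iff] at hcv
    linarith
  obtain ⟨ε, hε, hball⟩ := Metric.eventually_nhds_iff_ball.1 hk'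
  have m1 := hball (c + ε / 2) (by rw [Metric.mem_ball, Real.dist_eq, abs_lt]; constructor <;> linarith)
  have m2 := hball (c - ε / 2) (by rw [Metric.mem_ball, Real.dist_eq, abs_lt]; constructor <;> linarith)
  have hk0 : (b - a) * k + f a - f b = 0 := by
    have e1 := m1.1
    have e2 := m2.1
    nlinarith
  rw [hk0] at hk'
  have hlow : ∀ᶠ x in nhds c, x ∈ S := by
    filter_upwards [hk', Ioo_mem_nhds hcIoo.1 hcIoo.2] with x hx hxI
    refine ⟨⟨hxI.1.le, hxI.2.le⟩, ?_⟩
    have := hmin ⟨hxI.1.le, hxI.2.le⟩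
    simp only [mem_ofPred_eq] at this
    rw [mem_preimage, mem_singleton_iff] at hcv ⊢
    linarith [hx.2]
  obtain ⟨ε', hε', hball'⟩ := Metric.eventually_nhds_iff_ball.1 hlow
  have := hleast (hball' (c - ε' / 2)
    (by rw [Metric.mem_ball, Real.dist_eq, abs_lt]; constructor <;> linarith))
  linarith

namespace STRep

section Shear

variable {d m : ℕ} (R : STRep d m)

/-- The vertical displacement at horizontal coordinate `x` produced by the cut flips `u`. -/
noncomputable def shift (u : Fin m → ℤ) (x : ℝ) : ℝ :=
  ∑ j, (u j : ℝ) * max (x - R.c j 0) 0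

/-- The one-sided slope of `R.shift u` at `x` in the direction `v`. -/
noncomputable def slope (u : Fin m → ℤ) (x v : ℝ) : ℤ :=
  ∑ j, if R.c j 0 < x ∨ (R.c j 0 = x ∧ 0 < v) then u j else 0

/-- The jump of the slope of `R.shift u` at `x`. -/
noncomputable def jump (u : Fin m → ℤ) (x : ℝ) : ℤ :=
  ∑ j, if R.c j 0 = x then u j else 0

/-- The cut flips `u` are admissible. -/
def Adm (u : Fin m → ℤ) : Prop := ∀ j, u j = 0 ∨ u j = R.eps j

/-- The cut flips unbending all cuts which go in direction `s`. -/
def flips (s : ℤ) (j : Fin m) : ℤ := if R.eps j = s then s else 0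

variable {R} {u : Fin m → ℤ}

lemma adm_flips (s : ℤ) : R.Adm (R.flips s) := by
  intro j
  unfold flips
  split_ifs with h
  · exact Or.inr h.symm
  · exact Or.inl rfl

lemma continuous_shift : Continuous (R.shift u) := by
  unfold shift; fun_prop

lemma shift_add {x h : ℝ} (hb : ∀ j, u j ≠ 0 → 0 ≤ (R.c j 0 - x) * (R.c j 0 - (x + h))) :
    R.shift u (x + h) = R.shift u x + h * R.slope u x h := by
  unfold shift slope
  push_cast
  rw [Finset.mul_sum, ← Finset.sum_add_distrib]
  refine Finset.sum_congr rfl fun j _ => ?_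
  by_cases hu : u j = 0
  · simp [hu]
  have hj := hb j hu
  rcases lt_trichotomy (R.c j 0) x with hlt | heq | hgt
  · have h2 : R.c j 0 ≤ x + h := by
      by_contra hcon; push Not at hcon
      nlinarith
    rw [if_pos (Or.inl hlt), max_eq_left (by linarith), max_eq_left (by linarith)]; ring
  · rcases lt_or_ge 0 h with h0 | h0
    · rw [if_pos (Or.inr ⟨heq, h0⟩), max_eq_left (by linarith), max_eq_left (by linarith)]
      rw [heq]; ring
    · rw [if_neg (by rintro (h1 | h1) <;> linarith), max_eq_right (by linarith),
        max_eq_right (by linarith)]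
      simp
  · have h2 : x + h ≤ R.c j 0 := by
      by_contra hcon; push Not at hcon
      nlinarith
    rw [if_neg (by rintro (h1 | h1) <;> linarith), max_eq_right (by linarith),
        max_eq_right (by linarith)]
    simp

lemma slope_of_pos {x v : ℝ} (hv : 0 < v) : R.slope u x v = R.slope u x 0 + R.jump u x := by
  unfold slope jump
  rw [← Finset.sum_add_distrib]
  refine Finset.sum_congr rfl fun j _ => ?_
  rcases lt_trichotomy (R.c j 0) x with hlt | heq | hgt
  · simp [hlt, hlt.ne]
  · simp [heq, hv]
  · simp [hgt.not_gt, hgt.ne']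

lemma slope_of_nonpos {x v : ℝ} (hv : v ≤ 0) : R.slope u x v = R.slope u x 0 := by
  unfold slope
  simp [hv.not_gt]

lemma eventually_between (x : ℝ) :
    ∃ ε > 0, ∀ h : ℝ, |h| < ε → ∀ j, 0 ≤ (R.c j 0 - x) * (R.c j 0 - (x + h)) := by
  have : ∀ᶠ h : ℝ in nhds 0, ∀ j, 0 ≤ (R.c j 0 - x) * (R.c j 0 - (x + h)) := by
    rw [Filter.eventually_all]
    intro j
    by_cases hj : R.c j 0 = x
    · simp [hj]
    · have hc : Continuous fun h : ℝ => (R.c j 0 - x) * (R.c j 0 - (x + h)) := by fun_prop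
      have h0 : 0 < (R.c j 0 - x) * (R.c j 0 - (x + 0)) := by
        rw [add_zero]
        exact mul_self_pos.2 (sub_ne_zero.2 hj)
      filter_upwards [hc.continuousAt.eventually (lt_mem_nhds h0)] with h hh using hh.le
  obtain ⟨ε, hε, hb⟩ := Metric.eventually_nhds_iff.1 this
  exact ⟨ε, hε, fun h hh => hb (by simpa [Real.dist_eq] using hh)⟩

lemma Adm.jump_le (hu : R.Adm u) {s : ℤ} (hs : s = 1 ∨ s = -1) (heps : ∀ j, R.eps j = 1 ∨ R.eps j = -1)
    (x : ℝ) : s * R.jump u x ≤ ∑ j, if R.c j 0 = x ∧ R.eps j = s then 1 else 0 := by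
  unfold jump
  rw [Finset.mul_sum]
  refine Finset.sum_le_sum fun j _ => ?_
  by_cases hx : R.c j 0 = x
  · simp only [hx, if_true, true_and]
    rcases hu j with h | h <;> rcases heps j with h' | h' <;> rcases hs with rfl | rfl <;>
      simp [h, h']
  · simp [hx]

end Shear

variable {d m : ℕ} [NeZero d] {R : STRep d m}

/-- The height at horizontal coordinate `x` of the line through the edge `i`. -/
noncomputable def lineHt (R : STRep d m) (i : Fin d) (x : ℝ) : ℝ :=
  R.V i 1 + (R.dir i 1 : ℝ) / R.dir i 0 * (x - R.V i 0)

omit [NeZero d] in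
lemma side_eq_mul {i : Fin d} (h : R.dir i 0 ≠ 0) (z : Pt) :
    R.side i z = R.dir i 0 * (z 1 - R.lineHt i (z 0)) := by
  have : (R.dir i 0 : ℝ) ≠ 0 := by exact_mod_cast h
  unfold side lineHt
  field_simp
  ring

omit [NeZero d] in
lemma side_nonpos_iff {i : Fin d} {s : ℤ} (hs : s = 1 ∨ s = -1) (h : 0 < s * R.dir i 0) (z : Pt) :
    R.side i z ≤ 0 ↔ s * z 1 ≤ s * R.lineHt i (z 0) := by
  have h0 : R.dir i 0 ≠ 0 := by rintro h0; simp [h0] at h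
  have h' : (0 : ℝ) < s * R.dir i 0 := by exact_mod_cast h
  rw [side_eq_mul h0]
  rcases hs with rfl | rfl <;> push_cast at h' ⊢
  · rw [one_mul, one_mul]
    rw [one_mul] at h'
    constructor
    · intro h1; have := nonpos_of_mul_nonpos_right h1 h'; linarith
    · intro h1; exact mul_nonpos_of_nonneg_of_nonpos h'.le (by linarith)
  · constructor
    · intro h1
      have := nonpos_of_mul_nonpos_right (a := -1 * (R.dir i 0 : ℝ))
        (b := -(z 1 - R.lineHt i (z 0))) (by linarith) h'
      linarith
    · intro h1
      have := mul_nonpos_of_nonneg_of_nonpos h'.le (b := -(z 1 - R.lineHt i (z 0))) (by linarith)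
      linarith

/-- If a cut in direction `s` lies above an `s`-side boundary point, that point is a vertex
on the `s`-side of the polygon. -/
lemma IsValid.exists_isSide_of_cut (hR : R.IsValid) {s : ℤ} (hs : s = 1 ∨ s = -1) {i : Fin d}
    {j : Fin m} (hj : R.eps j = s) (hi : 0 < s * R.dir i 0)
    (hmin : ∀ k, 0 < s * R.dir k 0 → s * R.lineHt i (R.c j 0) ≤ s * R.lineHt k (R.c j 0)) :
    ∃ k, R.IsSide s k ∧ R.V k 0 = R.c j 0 ∧ R.V k 1 = R.lineHt i (R.c j 0) := by
  set q : Pt := ![R.c j 0, R.lineHt i (R.c j 0)] with hq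
  have hcj : R.c j ∈ R.carrier := interior_subset (hR.marked_interior j)
  have hci := (side_nonpos_iff hs hi _).1 (hR.side_nonpos i hcj)
  have hns : -s = 1 ∨ -s = -1 := by rcases hs with rfl | rfl <;> simp
  have hqc : q ∈ R.carrier := by
    rw [hR.mem_carrier_iff]
    intro k
    rcases lt_trichotomy 0 (s * R.dir k 0) with h | h | h
    · rw [side_nonpos_iff hs h]
      simpa [hq] using hmin k h
    · have h0 : R.dir k 0 = 0 := by rcases hs with rfl | rfl <;> omega
      have := hR.side_nonpos k hcj
      unfold side at this ⊢
      rw [h0] at this ⊢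
      simpa [hq] using this
    · have h' : 0 < -s * R.dir k 0 := by linarith
      have := (side_nonpos_iff hns h' _).1 (hR.side_nonpos k hcj)
      rw [side_nonpos_iff hns h']
      push_cast at this ⊢
      simp only [hq, cons_val_zero, cons_val_one]
      linarith
  have hqf : q ∈ frontier R.carrier := by
    rw [frontier, R.carrier_isClosed.closure_eq]
    refine ⟨hqc, fun hint => ?_⟩
    have := hR.side_neg_of_interior i hint
    rw [side_eq_mul (by rintro h0; simp [h0] at hi)] at this
    simp [hq] at this
  obtain ⟨k, hk⟩ := hR.cuts_at_vertices j q ⟨hqf, by simp [hq], by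
    rw [hj]; simp only [hq, cons_val_one, cons_val_fin_one]; linarith⟩
  have hk0 : R.V k 0 = R.c j 0 := by rw [← hk]; simp [hq]
  have hk1 : R.V k 1 = R.lineHt i (R.c j 0) := by rw [← hk]; simp [hq]
  refine ⟨k, ?_, hk0, hk1⟩
  by_contra hcon
  have hside : R.IsSide (-s) k := by
    rcases hR.isSide_of_c_eq hk0.symm with h | h <;> rcases hs with rfl | rfl
    · exact absurd h hcon
    · simpa using h
    · exact h
    · exact absurd h hcon
  have h1 := hR.side_neg_of_interior k (hR.marked_interior j)
  have h2 : (0 : ℝ) < -s * R.dir k 0 := by exact_mod_cast hside.2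
  unfold side at h1
  rw [hk0, sub_self, mul_zero, sub_zero, hk1] at h1
  have h3 : (s : ℝ) * s = 1 := by rcases hs with rfl | rfl <;> norm_num
  have h4 := mul_nonneg h2.le (sub_nonneg.2 hci)
  have h5 : -(s : ℝ) * R.dir k 0 * (s * R.lineHt i (R.c j 0) - s * R.c j 1) =
    (s * s) * (R.dir k 0 * (R.c j 1 - R.lineHt i (R.c j 0))) := by ring
  rw [h5, h3] at h4
  linarith

lemma IsValid.chord_le_lineHt (hR : R.IsValid) {u : Fin m → ℤ} (hu : R.Adm u) {s : ℤ}
    (hs : s = 1 ∨ s = -1) {z w : Pt} (hz : z ∈ R.carrier) (hw : w ∈ R.carrier)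
    (hzw : z 0 ≤ w 0) {x y : ℝ} (hx : x ∈ Icc (z 0) (w 0))
    (hy : (w 0 - z 0) * (y + R.shift u x) = (w 0 - x) * (z 1 + R.shift u (z 0)) +
      (x - z 0) * (w 1 + R.shift u (w 0)))
    {i : Fin d} (hi : 0 < s * R.dir i 0) :
    (w 0 - z 0) * (s * y) ≤ (w 0 - z 0) * (s * R.lineHt i x) := by
  classical
  set F : Finset (Fin d) := Finset.univ.filter fun i => 0 < s * R.dir i 0 with hF
  have hne : F.Nonempty := ⟨i, by simp [hF, hi]⟩
  set h : ℝ → ℝ := fun x => F.inf' hne fun i => s * R.lineHt i x with hh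
  have hle (x : ℝ) {k : Fin d} (hk : 0 < s * R.dir k 0) : h x ≤ s * R.lineHt k x :=
    Finset.inf'_le (fun i => (s : ℝ) * R.lineHt i x) (by simp [hF, hk])
  have hzle {z : Pt} (hz : z ∈ R.carrier) : s * z 1 ≤ h (z 0) := by
    refine Finset.le_inf' _ _ fun k hk => ?_
    exact (side_nonpos_iff hs (by simpa [hF] using hk) z).1 (hR.side_nonpos k hz)
  have hcont : Continuous fun x => h x + s * R.shift u x := by
    apply Continuous.add
    · simp only [hh]
      apply Continuous.finset_inf'_apply
      intro k _
      unfold lineHt; fun_prop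
    · exact continuous_const.mul continuous_shift
  have hloc : ∀ c ∈ Ioo (z 0) (w 0), ∃ k : ℝ, ∀ᶠ x in nhds c,
      h x + s * R.shift u x ≤ h c + s * R.shift u c + k * (x - c) := by
    intro c hc
    obtain ⟨ε, hε, hb⟩ := R.eventually_between c
    have hev : ∀ᶠ x in nhds c, R.shift u x = R.shift u c + (x - c) * R.slope u c (x - c) := by
      filter_upwards [Metric.ball_mem_nhds c hε] with x hx
      have := R.shift_add (u := u) (x := c) (h := x - c) (fun j _ => hb _ hx j)
      rwa [add_sub_cancel] at this
    obtain ⟨k, hk, hkc⟩ := Finset.exists_mem_eq_inf' hne fun i => (s : ℝ) * R.lineHt i c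
    have hk' : 0 < s * R.dir k 0 := by simpa [hF] using hk
    have hmin (l : Fin d) (hl : 0 < s * R.dir l 0) : s * R.lineHt k c ≤ s * R.lineHt l c := by
      rw [← hkc]; exact hle c hl
    have hj := hu.jump_le hs hR.eps_pm c
    by_cases hex : ∃ j, R.c j 0 = c ∧ R.eps j = s
    · obtain ⟨j, rfl, hjs⟩ := hex
      obtain ⟨l, hl, hl0, hl1⟩ := hR.exists_isSide_of_cut hs hjs hk' hmin
      have hdet := hR.det_corner_nonneg l
      rw [← hl0, ← hR.numCuts_eq hs hl, hl0] at hj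
      have hprod : 0 < R.dir (l - 1) 0 * R.dir l 0 := by
        have := mul_pos hl.1 hl.2
        rcases hs with rfl | rfl <;> linarith
      have ha0 : (R.dir (l - 1) 0 : ℝ) ≠ 0 := by
        have : R.dir (l - 1) 0 ≠ 0 := by rintro h0; simp [h0] at hprod
        exact_mod_cast this
      have hb0 : (R.dir l 0 : ℝ) ≠ 0 := by
        have : R.dir l 0 ≠ 0 := by rintro h0; simp [h0] at hprod
        exact_mod_cast this
      set A : ℝ := (R.dir (l - 1) 1 : ℝ) / R.dir (l - 1) 0 with hA
      set B : ℝ := (R.dir l 1 : ℝ) / R.dir l 0 with hB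
      have hAB : (s : ℝ) * R.jump u (R.c j 0) ≤ A - B := by
        have h1 : (R.numCuts l : ℝ) ≤ A - B := by
          rw [hA, hB, div_sub_div _ _ ha0 hb0, le_div_iff₀ (by exact_mod_cast hprod)]
          have : (R.numCuts l : ℤ) * (R.dir (l - 1) 0 * R.dir l 0) ≤
            R.dir (l - 1) 1 * R.dir l 0 - R.dir (l - 1) 0 * R.dir l 1 := by linarith
          exact_mod_cast this
        refine le_trans ?_ h1
        exact_mod_cast hj
      have hkc' : h (R.c j 0) = s * R.V l 1 := by
        rw [hl1]; exact hkc
      have e1 (x : ℝ) : h x ≤ s * R.V l 1 + s * (B * (x - R.c j 0)) := by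
        refine (hle x hl.2).trans (le_of_eq ?_)
        unfold lineHt; rw [hl0]; ring
      have e2 (x : ℝ) : h x ≤ s * R.V l 1 + s * (A * (x - R.c j 0)) := by
        refine (hle x hl.1).trans (le_of_eq ?_)
        unfold lineHt
        rw [hR.V_pred l 1, ← hl0, hR.V_pred l 0, hA]
        field_simp
        ring
      refine ⟨max (s * A) (s * B) + s * R.slope u (R.c j 0) 0, ?_⟩
      filter_upwards [hev] with x hx
      rw [hkc', hx]
      rcases le_or_gt (x - R.c j 0) 0 with hx0 | hx0
      · rw [slope_of_nonpos hx0]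
        have h3 := e1 x
        have h4 := e2 x
        rcases max_choice ((s : ℝ) * A) (s * B) with hm | hm <;> rw [hm] <;> nlinarith
      · rw [slope_of_pos hx0]
        push_cast
        have h3 := e1 x
        have h4 := e2 x
        have h5 := mul_le_mul_of_nonneg_left hAB hx0.le
        rcases hs with rfl | rfl
        · have h6 := mul_le_mul_of_nonneg_left (le_max_left (((1 : ℤ) : ℝ) * A) (((1 : ℤ) : ℝ) * B)) hx0.le
          push_cast at *
          nlinarith
        · have h6 := mul_le_mul_of_nonneg_left (le_max_right (((-1 : ℤ) : ℝ) * A) (((-1 : ℤ) : ℝ) * B)) hx0.le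
          push_cast at *
          nlinarith
    · have hj0 : s * R.jump u c ≤ 0 := by
        refine hj.trans (le_of_eq (Finset.sum_eq_zero fun j _ => if_neg fun h => hex ⟨j, h⟩))
      refine ⟨s * ((R.dir k 1 : ℝ) / R.dir k 0) + s * R.slope u c 0, ?_⟩
      filter_upwards [hev] with x hx
      have h1 := hle x hk'
      have h2 : h c = s * R.lineHt k c := hkc
      rw [hx, h2]
      have h3 : (s : ℝ) * R.lineHt k x =
          s * R.lineHt k c + s * ((R.dir k 1 : ℝ) / R.dir k 0) * (x - c) := by
        unfold lineHt; ring
      rcases le_or_gt (x - c) 0 with hx0 | hx0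
      · rw [slope_of_nonpos hx0]; nlinarith
      · rw [slope_of_pos hx0]
        push_cast
        have h4 : (s : ℝ) * R.jump u c ≤ 0 := by exact_mod_cast hj0
        have := mul_nonpos_of_nonneg_of_nonpos hx0.le h4
        nlinarith
  have hch := chord_le_of_local_support hcont.continuousOn hloc hx
  have h1 := mul_le_mul_of_nonneg_left (hle x hi) (sub_nonneg.2 hzw)
  have h2 := mul_le_mul_of_nonneg_left (hzle hz) (sub_nonneg.2 hx.2)
  have h3 := mul_le_mul_of_nonneg_left (hzle hw) (sub_nonneg.2 hx.1)
  have h4 : (w 0 - z 0) * (s * y) + (w 0 - z 0) * (s * R.shift u x) =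
    (w 0 - x) * (s * z 1) + (w 0 - x) * (s * R.shift u (z 0)) +
      ((x - z 0) * (s * w 1) + (x - z 0) * (s * R.shift u (w 0))) := by
    linear_combination s * hy
  linarith

/-- The sheared polygon is convex. -/
lemma IsValid.shear_convex (hR : R.IsValid) {u : Fin m → ℤ} (hu : R.Adm u) {z w v : Pt}
    (hz : z ∈ R.carrier) (hw : w ∈ R.carrier) {α β : ℝ} (hα : 0 ≤ α) (hβ : 0 ≤ β)
    (hαβ : α + β = 1) (h0 : v 0 = α * z 0 + β * w 0)
    (h1 : v 1 + R.shift u (v 0) = α * (z 1 + R.shift u (z 0)) + β * (w 1 + R.shift u (w 0))) :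
    v ∈ R.carrier := by
  wlog hzw : z 0 ≤ w 0 generalizing z w α β
  · exact this hw hz hβ hα (by linarith) (by linarith) (by linarith) (by linarith)
  rcases hzw.eq_or_lt with heq | hlt
  · have hv0 : v 0 = z 0 := by rw [h0, ← heq, ← add_mul, hαβ, one_mul]
    have hv : v = α • z + β • w := by
      ext k
      fin_cases k
      · simpa using h0
      · simp only [Pi.add_apply, Pi.smul_apply, smul_eq_mul, Fin.mk_one]
        rw [hv0, ← heq] at h1
        have : R.shift u (z 0) = (α + β) * R.shift u (z 0) := by rw [hαβ, one_mul]
        linarith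
    rw [hv]
    exact R.carrier_convex hz hw hα hβ hαβ
  have hx : v 0 ∈ Icc (z 0) (w 0) := by
    have hα' : α = 1 - β := by linarith
    subst hα'
    constructor <;> nlinarith
  have hy : (w 0 - z 0) * (v 1 + R.shift u (v 0)) = (w 0 - v 0) * (z 1 + R.shift u (z 0)) +
      (v 0 - z 0) * (w 1 + R.shift u (w 0)) := by
    have hα' : α = 1 - β := by linarith
    rw [h1, h0, hα']; ring
  rw [hR.mem_carrier_iff]
  intro i
  have key {s : ℤ} (hs : s = 1 ∨ s = -1) (hi : 0 < s * R.dir i 0) : R.side i v ≤ 0 := by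
    rw [side_nonpos_iff hs hi]
    exact le_of_mul_le_mul_left (hR.chord_le_lineHt hu hs hz hw hzw hx hy hi) (sub_pos.2 hlt)
  rcases lt_trichotomy 0 (R.dir i 0) with h | h | h
  · exact key (Or.inl rfl) (by linarith)
  · have a1 := hR.side_nonpos i hz
    have a2 := hR.side_nonpos i hw
    unfold side at a1 a2 ⊢
    rw [← h] at a1 a2 ⊢
    simp only [Int.cast_zero, zero_mul, zero_sub] at a1 a2 ⊢
    rw [h0]
    have := mul_nonpos_of_nonneg_of_nonpos hα a1
    have := mul_nonpos_of_nonneg_of_nonpos hβ a2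
    have hα' : α = 1 - β := by linarith
    subst hα'
    linarith
  · exact key (Or.inr rfl) (by linarith)

end STRep

namespace STRep

variable {d m : ℕ} [NeZero d] {R : STRep d m} {u : Fin m → ℤ} {k : Fin d}

omit [NeZero d] in
lemma slope_eq_of_forall_ne {x : ℝ} (h : ∀ j, R.c j 0 ≠ x) (v w : ℝ) :
    R.slope u x v = R.slope u x w := by
  unfold slope
  simp [h]

omit [NeZero d] in
lemma slope_eq_of_mul_pos {x v w : ℝ} (h : 0 < v * w) : R.slope u x v = R.slope u x w := by
  rcases pos_and_pos_or_neg_and_neg_of_mul_pos h with ⟨h1, h2⟩ | ⟨h1, h2⟩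
  · rw [slope_of_pos h1, slope_of_pos h2]
  · rw [slope_of_nonpos h1.le, slope_of_nonpos h2.le]

/-- The first primitive vector emanating from `V k` after applying the cut flips `u`. -/
noncomputable def e1 (R : STRep d m) (u : Fin m → ℤ) (k : Fin d) : Fin 2 → ℤ :=
  ![-R.dir (k - 1) 0,
    -R.dir (k - 1) 1 - R.slope u (R.V k 0) (-R.dir (k - 1) 0) * R.dir (k - 1) 0]

/-- The second primitive vector emanating from `V k` after applying the cut flips `u`. -/
noncomputable def e2 (R : STRep d m) (u : Fin m → ℤ) (k : Fin d) : Fin 2 → ℤ :=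
  ![R.dir k 0, R.dir k 1 + R.slope u (R.V k 0) (R.dir k 0) * R.dir k 0]

@[simp] lemma e1_zero : R.e1 u k 0 = -R.dir (k - 1) 0 := rfl

@[simp] lemma e1_one : R.e1 u k 1 =
    -R.dir (k - 1) 1 - R.slope u (R.V k 0) (-R.dir (k - 1) 0) * R.dir (k - 1) 0 := rfl

omit [NeZero d] in
@[simp] lemma e2_zero : R.e2 u k 0 = R.dir k 0 := rfl

omit [NeZero d] in
@[simp] lemma e2_one : R.e2 u k 1 =
    R.dir k 1 + R.slope u (R.V k 0) (R.dir k 0) * R.dir k 0 := rfl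

/-- The direction of cuts which are unbent in the canonical representative at `V k`. -/
def sgn (R : STRep d m) (k : Fin d) : ℤ := if -R.dir (k - 1) 0 ≤ R.dir k 0 then 1 else -1

lemma sgn_eq (k : Fin d) : R.sgn k = 1 ∨ R.sgn k = -1 := by
  unfold sgn; split_ifs <;> simp

lemma sgn_of_isSide {s : ℤ} (hs : s = 1 ∨ s = -1) (h : R.IsSide s k) : R.sgn k = s := by
  unfold IsSide at h
  unfold sgn
  rcases hs with rfl | rfl
  · rw [if_pos (by omega)]
  · rw [if_neg (by omega)]

lemma sgn_mul (k : Fin d) :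
    (R.sgn k : ℝ) * (R.dir (k - 1) 0 + R.dir k 0) = |(R.dir (k - 1) 0 + R.dir k 0 : ℝ)| := by
  unfold sgn
  split_ifs with h
  · have : -(R.dir (k - 1) 0 : ℝ) ≤ R.dir k 0 := by exact_mod_cast h
    rw [abs_of_nonneg (by linarith)]; simp
  · push Not at h
    have : (R.dir k 0 : ℝ) < -R.dir (k - 1) 0 := by exact_mod_cast h
    rw [abs_of_neg (by linarith)]; simp

lemma IsValid.isSide_sgn (hR : R.IsValid) {j : Fin m} (h : R.c j 0 = R.V k 0) :
    R.IsSide (R.sgn k) k := by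
  rcases hR.isSide_of_c_eq h with h | h
  · rwa [sgn_of_isSide (Or.inl rfl) h]
  · rwa [sgn_of_isSide (Or.inr rfl) h]

lemma slope_sub_of_isSide {s : ℤ} (hs : s = 1 ∨ s = -1) (h : R.IsSide s k) :
    R.slope u (R.V k 0) (R.dir k 0) - R.slope u (R.V k 0) (-R.dir (k - 1) 0) =
      s * R.jump u (R.V k 0) := by
  have h1 : (0 : ℝ) < s * R.dir (k - 1) 0 := by exact_mod_cast h.1
  have h2 : (0 : ℝ) < s * R.dir k 0 := by exact_mod_cast h.2
  rcases hs with rfl | rfl <;> push_cast at h1 h2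
  · rw [slope_of_pos (by linarith), slope_of_nonpos (v := -_) (by linarith)]; ring
  · rw [slope_of_nonpos (by linarith), slope_of_pos (v := -_) (by linarith)]; ring

lemma IsValid.detZ_e (hR : R.IsValid) (hk : R.IsHDCorner k) :
    detZ (R.e1 u k) (R.e2 u k) = 1 ∨ ∃ j, R.c j 0 = R.V k 0 ∧
      detZ (R.e1 u k) (R.e2 u k) = 1 + (R.numCuts k - R.sgn k * R.jump u (R.V k 0)) *
        (R.dir (k - 1) 0 * R.dir k 0) := by
  have hd := hR.det_hd hk
  by_cases hj : ∃ j, R.c j 0 = R.V k 0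
  · obtain ⟨j, hj⟩ := hj
    refine Or.inr ⟨j, hj, ?_⟩
    have hs := hR.isSide_sgn hj
    rw [← slope_sub_of_isSide (R.sgn_eq k) hs]
    simp only [detZ, e1_zero, e1_one, e2_zero, e2_one]
    linear_combination hd
  · push Not at hj
    left
    rw [numCuts_eq_zero hj] at hd
    simp only [detZ, e1_zero, e1_one, e2_zero, e2_one]
    rw [slope_eq_of_forall_ne hj (-(R.dir (k - 1) 0 : ℝ)) (R.dir k 0)]
    push_cast at hd
    linear_combination hd

lemma IsSide.mul_pos {s : ℤ} (hs : s = 1 ∨ s = -1) (h : R.IsSide s k) :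
    0 < R.dir (k - 1) 0 * R.dir k 0 := by
  have := _root_.mul_pos h.1 h.2
  rcases hs with rfl | rfl <;> linarith

lemma IsValid.detZ_pos (hR : R.IsValid) (hk : R.IsHDCorner k) (hu : R.Adm u) :
    1 ≤ detZ (R.e1 u k) (R.e2 u k) := by
  rcases hR.detZ_e (u := u) hk with h | ⟨j, hj, h⟩
  · exact h.ge
  · have hs := hR.isSide_sgn hj
    have h1 := hu.jump_le (R.sgn_eq k) hR.eps_pm (R.V k 0)
    rw [← hR.numCuts_eq (R.sgn_eq k) hs] at h1
    have := mul_nonneg (sub_nonneg.2 h1) (IsSide.mul_pos (R.sgn_eq k) hs).le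
    rw [h]; linarith

lemma IsValid.detZ_sgn (hR : R.IsValid) (hk : R.IsHDCorner k) :
    detZ (R.e1 (R.flips (R.sgn k)) k) (R.e2 (R.flips (R.sgn k)) k) = 1 := by
  rcases hR.detZ_e (u := R.flips (R.sgn k)) hk with h | ⟨j, hj, h⟩
  · exact h
  · have hs := hR.isSide_sgn hj
    have h2 : R.sgn k * R.sgn k = 1 := by rcases R.sgn_eq k with h | h <;> rw [h] <;> rfl
    have h1 : R.sgn k * R.jump (R.flips (R.sgn k)) (R.V k 0) = R.numCuts k := by
      rw [hR.numCuts_eq (R.sgn_eq k) hs, jump, Finset.mul_sum]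
      refine Finset.sum_congr rfl fun j _ => ?_
      by_cases h1 : R.c j 0 = R.V k 0 <;> by_cases h3 : R.eps j = R.sgn k <;>
        simp [flips, h1, h3, h2]
    rw [h, h1]; ring

lemma IsValid.eq_flips_of_detZ (hR : R.IsValid) (hu : R.Adm u)
    (hk : R.IsHDCorner k) (hdet : detZ (R.e1 u k) (R.e2 u k) = 1) {j : Fin m}
    (hj : R.c j 0 = R.V k 0) : u j = R.flips (R.sgn k) j := by
  have hs := hR.isSide_sgn hj
  have hpos := IsSide.mul_pos (R.sgn_eq k) hs
  have hd := hR.det_hd hk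
  have hsl := slope_sub_of_isSide (u := u) (R.sgn_eq k) hs
  simp only [detZ, e1_zero, e1_one, e2_zero, e2_one] at hdet
  have h0 : (R.numCuts k - R.sgn k * R.jump u (R.V k 0)) *
        (R.dir (k - 1) 0 * R.dir k 0) = 0 := by
    rw [← hsl]; linear_combination hdet - hd
  have h1 := (mul_eq_zero.1 h0).resolve_right hpos.ne'
  rw [hR.numCuts_eq (R.sgn_eq k) hs, jump, Finset.mul_sum, ← Finset.sum_sub_distrib,
    Finset.sum_eq_zero_iff_of_nonneg] at h1
  · have := h1 j (Finset.mem_univ j)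
    simp only [hj, if_true, true_and] at this
    unfold flips
    rcases R.sgn_eq k with h | h <;> rw [h] at this ⊢ <;> split_ifs at this ⊢ <;> omega
  · intro i _
    by_cases hi : R.c i 0 = R.V k 0
    · simp only [hi, if_true, true_and]
      rcases hu i with h | h <;> rcases hR.eps_pm i with h' | h' <;>
        rcases R.sgn_eq k with h2 | h2 <;> simp [h, h', h2]
    · simp [hi]

/-- The horizontal position relative to the vertex `V k`. -/
def relX (R : STRep d m) (k : Fin d) (z : Pt) : ℝ := z 0 - R.V k 0

/-- The vertical position relative to the vertex `V k` after applying the cut flips `u`. -/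
noncomputable def relY (R : STRep d m) (u : Fin m → ℤ) (k : Fin d) (z : Pt) : ℝ :=
  z 1 + R.shift u (z 0) - (R.V k 1 + R.shift u (R.V k 0))

/-- The first coordinate of a point in the frame of edge vectors at `V k`, when the frame
is unimodular. -/
noncomputable def crd1 (R : STRep d m) (u : Fin m → ℤ) (k : Fin d) (z : Pt) : ℝ :=
  R.relX k z * R.e2 u k 1 - R.relY u k z * R.e2 u k 0

/-- The second coordinate of a point in the frame of edge vectors at `V k`, when the frame
is unimodular. -/
noncomputable def crd2 (R : STRep d m) (u : Fin m → ℤ) (k : Fin d) (z : Pt) : ℝ :=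
  R.e1 u k 0 * R.relY u k z - R.e1 u k 1 * R.relX k z

lemma detZ_mul_relX (z : Pt) : (detZ (R.e1 u k) (R.e2 u k) : ℝ) * R.relX k z =
    R.crd1 u k z * R.e1 u k 0 + R.crd2 u k z * R.e2 u k 0 := by
  unfold detZ crd1 crd2; push_cast; ring

lemma detZ_mul_relY (z : Pt) : (detZ (R.e1 u k) (R.e2 u k) : ℝ) * R.relY u k z =
    R.crd1 u k z * R.e1 u k 1 + R.crd2 u k z * R.e2 u k 1 := by
  unfold detZ crd1 crd2; push_cast; ring

/-- The sheared polygon is contained in the cone at `V k` spanned by the sheared edges. -/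
lemma IsValid.crd_nonneg (hR : R.IsValid) (hk : R.IsHDCorner k) (hu : R.Adm u) {z : Pt}
    (hz : z ∈ R.carrier) : 0 ≤ R.crd1 u k z ∧ 0 ≤ R.crd2 u k z := by
  have hD := hR.detZ_pos hk hu
  have hX := R.detZ_mul_relX (u := u) (k := k) z
  obtain ⟨X, hXdef⟩ : ∃ X, R.relX k z = X := ⟨_, rfl⟩
  obtain ⟨Y, hYdef⟩ : ∃ Y, R.relY u k z = Y := ⟨_, rfl⟩
  set ν : ℝ := ((R.slope u (R.V k 0) X : ℤ) : ℝ) with hν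
  obtain ⟨δ, hδ, hb⟩ := R.eventually_between (R.V k 0)
  obtain ⟨ε, hε, hε1, hεX⟩ : ∃ ε : ℝ, 0 < ε ∧ ε ≤ 1 ∧ |ε * X| < δ := by
    refine ⟨min 1 (δ / (|X| + 1)), by positivity, min_le_left _ _, ?_⟩
    rw [abs_mul, abs_of_pos (by positivity)]
    calc min 1 (δ / (|X| + 1)) * |X| ≤ δ / (|X| + 1) * |X| := by gcongr; exact min_le_right _ _
      _ < δ / (|X| + 1) * (|X| + 1) := by gcongr; linarith
      _ = δ := by field_simp
  have hsh : R.shift u (R.V k 0 + ε * X) = R.shift u (R.V k 0) + ε * X * ν := by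
    rw [shift_add fun j _ => hb _ hεX j, hν]
    congr 3
    rcases eq_or_ne X 0 with h0 | h0
    · simp [h0]
    · exact slope_eq_of_mul_pos (by have := mul_self_pos.2 h0; nlinarith)
  set v : Pt := ![R.V k 0 + ε * X, R.V k 1 + ε * Y - ε * X * ν] with hv
  have hvc : v ∈ R.carrier := by
    refine hR.shear_convex hu (R.V_mem k) hz (α := 1 - ε) (β := ε) (by linarith) hε.le
      (by ring) ?_ ?_
    · simp only [hv, cons_val_zero, ← hXdef, relX]; ring
    · simp only [hv, cons_val_zero, cons_val_one, cons_val_fin_one, hsh]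
      simp only [← hYdef, relY]; ring
  have hA := hR.side_pred_nonpos k hvc
  have hB := hR.side_nonpos k hvc
  unfold side at hB
  simp only [hv, cons_val_zero, cons_val_one, cons_val_fin_one] at hA hB
  have hA : (R.dir (k - 1) 0 : ℝ) * (Y - X * ν) - R.dir (k - 1) 1 * X ≤ 0 := by
    refine nonpos_of_mul_nonpos_right (a := ε) ?_ hε
    linarith
  have hB : (R.dir k 0 : ℝ) * (Y - X * ν) - R.dir k 1 * X ≤ 0 := by
    refine nonpos_of_mul_nonpos_right (a := ε) ?_ hε
    linarith
  unfold crd1 crd2 at hX ⊢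
  simp only [e1_zero, e1_one, e2_zero, e2_one] at hX ⊢
  rw [hXdef, hYdef] at hX ⊢
  have hD' : (1 : ℝ) ≤ detZ (R.e1 u k) (R.e2 u k) := by exact_mod_cast hD
  set Δ : ℝ := ((detZ (R.e1 u k) (R.e2 u k) : ℤ) : ℝ)
  push_cast at hX ⊢
  set a : ℝ := (R.dir (k - 1) 0 : ℝ)
  set b : ℝ := (R.dir (k - 1) 1 : ℝ)
  set a' : ℝ := (R.dir k 0 : ℝ)
  set b' : ℝ := (R.dir k 1 : ℝ)
  by_cases hj : ∃ j, R.c j 0 = R.V k 0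
  · obtain ⟨j, hj⟩ := hj
    have haa : (0 : ℝ) < (R.dir (k - 1) 0 : ℝ) * R.dir k 0 := by
      exact_mod_cast IsSide.mul_pos (R.sgn_eq k) (hR.isSide_sgn hj)
    change 0 < a * a' at haa
    have ha : a ≠ 0 := left_ne_zero_of_mul haa.ne'
    have ha' : a' ≠ 0 := right_ne_zero_of_mul haa.ne'
    rcases lt_trichotomy 0 (a * X) with h | h | h
    · have ha'X : 0 < a' * X := by
        have h2 := mul_pos haa h
        have h3 : a * a' * (a * X) = (a * a) * (a' * X) := by ring
        rw [h3] at h2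
        exact pos_of_mul_pos_right h2 (mul_self_nonneg a)
      have hν2 : (R.slope u (R.V k 0) a' : ℝ) = ν := by rw [hν, slope_eq_of_mul_pos ha'X]
      rw [hν2] at hX ⊢
      have g2 : 0 ≤ X * (b' + ν * a') - Y * a' := by linarith
      refine ⟨g2, ?_⟩
      set G := -a * Y - (-b - (R.slope u (R.V k 0) (-a) : ℝ) * a) * X
      have h1 : G * (a' * a') = Δ * (a' * X) + (X * (b' + ν * a') - Y * a') * (a * a') := by
        linear_combination (-a') * hX
      have h2 : 0 ≤ G * (a' * a') := by
        rw [h1]; positivity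
      exact nonneg_of_mul_nonneg_left h2 (mul_self_pos.2 ha')
    · have hX0 : X = 0 := (mul_eq_zero.1 h.symm).resolve_left ha
      rw [hX0] at hA hB ⊢
      constructor <;> linarith
    · have ha'X : a' * X < 0 := by
        have h2 := mul_neg_of_pos_of_neg haa h
        have h3 : a * a' * (a * X) = (a * a) * (a' * X) := by ring
        rw [h3] at h2
        by_contra hcon
        push Not at hcon
        have := mul_nonneg (mul_self_nonneg a) hcon
        linarith
      have hν1 : (R.slope u (R.V k 0) (-a) : ℝ) = ν := by
        rw [hν, slope_eq_of_mul_pos (v := -a) (w := X) (by linarith)]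
      rw [hν1] at hX ⊢
      have g1 : 0 ≤ -a * Y - (-b - ν * a) * X := by linarith
      refine ⟨?_, g1⟩
      set G := X * (b' + (R.slope u (R.V k 0) a' : ℝ) * a') - Y * a'
      have h1 : G * (a * a) = Δ * (-(a * X)) + (-a * Y - (-b - ν * a) * X) * (a * a') := by
        linear_combination a * hX
      have h2 : 0 ≤ G * (a * a) := by
        rw [h1]
        have : 0 ≤ -(a * X) := by linarith
        positivity
      exact nonneg_of_mul_nonneg_left h2 (mul_self_pos.2 ha)
  · push Not at hj
    rw [slope_eq_of_forall_ne hj a' X, slope_eq_of_forall_ne hj (-a) X, ← hν]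
    constructor <;> linarith

end STRep

section Cyclic

variable {d : ℕ} [NeZero d]

/-- The vertex reached from `s` after `n` cyclic steps. -/
def step (s : Fin d) (n : ℕ) : Fin d := s + Fin.ofNat d n

lemma step_val (s : Fin d) (n : ℕ) : (step s n).val = (s.val + n) % d := by
  simp [step, Fin.val_add]

@[simp] lemma step_zero (s : Fin d) : step s 0 = s := by
  ext; rw [step_val, add_zero, Nat.mod_eq_of_lt s.isLt]

lemma step_add (s : Fin d) (n n' : ℕ) : step s (n + n') = step (step s n) n' := by
  ext; simp only [step_val, Nat.mod_add_mod, add_assoc]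

lemma step_one (s : Fin d) : step s 1 = s + 1 := by
  ext; simp [step_val, Fin.val_add]

lemma step_succ (s : Fin d) (n : ℕ) : step s (n + 1) = step s n + 1 := by
  rw [step_add, step_one]

lemma step_left_injective (n : ℕ) : Function.Injective fun s : Fin d => step s n :=
  fun _ _ h => add_right_cancel h

lemma step_distCyc (s i : Fin d) : step s (distCyc s i) = i := by
  ext
  have h1 := s.isLt
  have h2 := i.isLt
  rw [step_val, distCyc, Nat.add_mod_mod, show s.val + (i.val + d - s.val) = i.val + d by omega,
    Nat.add_mod_right, Nat.mod_eq_of_lt h2]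

lemma distCyc_lt (s i : Fin d) : distCyc s i < d := Nat.mod_lt _ (NeZero.pos d)

lemma distCyc_step (s : Fin d) {n : ℕ} (hn : n < d) : distCyc s (step s n) = n := by
  have h1 := s.isLt
  rw [distCyc, step_val]
  rcases lt_or_ge (s.val + n) d with h | h
  · rw [Nat.mod_eq_of_lt h, show s.val + n + d - s.val = n + d by omega, Nat.add_mod_right,
      Nat.mod_eq_of_lt hn]
  · have e : (s.val + n) % d = s.val + n - d := by
      rw [Nat.mod_eq_sub_mod h, Nat.mod_eq_of_lt (by omega)]
    rw [e, show s.val + n - d + d - s.val = n by omega, Nat.mod_eq_of_lt hn]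

lemma sum_distCyc (s : Fin d) (F : ℕ → Fin d → ℝ) :
    ∑ i, F (distCyc s i) i = ∑ n ∈ Finset.range d, F n (step s n) := by
  refine Finset.sum_nbij' (fun i => distCyc s i) (fun n => step s n) ?_ ?_ ?_ ?_ ?_
  · intro i _; exact Finset.mem_range.2 (distCyc_lt s i)
  · intro n _; exact Finset.mem_univ _
  · intro i _; exact step_distCyc s i
  · intro n hn; exact distCyc_step s (Finset.mem_range.1 hn)
  · intro i _; simp only [step_distCyc]

lemma chainLen_le (s e : Fin d) : chainLen s e ≤ d := by
  unfold chainLen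
  split_ifs
  · exact le_rfl
  · exact (distCyc_lt s e).le

lemma step_chainLen (s e : Fin d) : step s (chainLen s e) = e := by
  unfold chainLen
  split_ifs with h
  · ext; rw [step_val, Nat.add_mod_right, Nat.mod_eq_of_lt s.isLt, h]
  · exact step_distCyc s e

lemma chainLen_pos (s e : Fin d) : 0 < chainLen s e := by
  by_contra h
  have h0 : chainLen s e = 0 := by omega
  have h1 := step_chainLen s e
  rw [h0, step_zero] at h1
  unfold chainLen at h0
  rw [if_pos h1.symm] at h0
  exact NeZero.ne d h0

end Cyclic

namespace STRep

variable {d m : ℕ} [NeZero d] {R : STRep d m}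

/-- The total length of the first `n` edges following the vertex `s`. -/
def pathLen (R : STRep d m) (s : Fin d) (n : ℕ) : ℝ := ∑ k ∈ Finset.range n, R.len (step s k)

@[simp] lemma pathLen_zero (s : Fin d) : R.pathLen s 0 = 0 := by simp [pathLen]

lemma pathLen_succ (s : Fin d) (n : ℕ) :
    R.pathLen s (n + 1) = R.pathLen s n + R.len (step s n) := Finset.sum_range_succ _ _

lemma IsValid.pathLen_mono (hR : R.IsValid) (s : Fin d) : Monotone (R.pathLen s) :=
  monotone_nat_of_le_succ fun n => by
    rw [pathLen_succ]; linarith [hR.len_pos (step s n)]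

lemma sum_if_distCyc_lt (s : Fin d) {N : ℕ} (hN : N ≤ d) :
    (∑ i : Fin d, if distCyc s i < N then R.len i else 0) = R.pathLen s N := by
  rw [sum_distCyc s (fun n i => if n < N then R.len i else 0), ← Finset.sum_filter, pathLen]
  congr 1
  ext n; simp; omega

lemma sum_if_distCyc_between (s : Fin d) {n N : ℕ} (hn : n < N) (hN : N ≤ d) :
    (∑ i : Fin d, if n < distCyc s i ∧ distCyc s i < N then R.len i else 0) =
      R.pathLen s N - R.pathLen s (n + 1) := by
  rw [sum_distCyc s (fun k i => if n < k ∧ k < N then R.len i else 0), ← Finset.sum_filter,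
    pathLen, pathLen, ← Finset.sum_Ico_eq_sub _ (by omega : n + 1 ≤ N)]
  congr 1
  ext k; simp; omega

/-- No cut in direction `s` meets the relative interior of an edge on the `s`-side. -/
lemma IsValid.no_cut_inside (hR : R.IsValid) {s : ℤ} (hs : s = 1 ∨ s = -1) {i : Fin d}
    (hi : 0 < s * R.dir i 0) {r : ℝ} (h0 : 0 ≤ r) (h1 : r ≤ R.len i) {j : Fin m}
    (hj : R.flips s j ≠ 0) :
    0 ≤ (R.c j 0 - R.V i 0) * (R.c j 0 - (R.V i 0 + r * R.dir i 0)) := by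
  have hi' : (0 : ℝ) < s * R.dir i 0 := by exact_mod_cast hi
  have hd0 : (R.dir i 0 : ℝ) ≠ 0 := right_ne_zero_of_mul hi'.ne'
  have hjs : R.eps j = s := by
    by_contra h; simp [flips, h] at hj
  by_contra hcon
  push Not at hcon
  set t : ℝ := (R.c j 0 - R.V i 0) / R.dir i 0 with ht
  have hct : R.c j 0 = R.V i 0 + t * R.dir i 0 := by rw [ht]; field_simp; ring
  have hcon' : t * (t - r) * (R.dir i 0 * R.dir i 0) < 0 := by
    rw [hct] at hcon; linarith
  have htr : t * (t - r) < 0 := by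
    by_contra h; push Not at h
    have := mul_nonneg h (mul_self_nonneg (R.dir i 0 : ℝ)); linarith
  have ht0 : 0 < t := by
    by_contra h; push Not at h
    nlinarith
  have htr' : t < r := by
    by_contra h; push Not at h
    nlinarith
  set z : Pt := fun k => R.V i k + t * R.dir i k with hz
  have hzf : z ∈ frontier R.carrier :=
    hR.edge_mem_frontier ht0.le (by linarith) fun k => rfl
  have hcj := (side_nonpos_iff hs hi _).1 (hR.side_nonpos i (interior_subset (hR.marked_interior j)))
  have hz1 : z 1 = R.lineHt i (R.c j 0) := by
    simp only [hz, lineHt, hct]; field_simp; ring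
  obtain ⟨k, hk⟩ := hR.cuts_at_vertices j z ⟨hzf, hct.symm, by rw [hjs, hz1]; linarith⟩
  exact hR.vertex_notMem_open_edge ht0 (by linarith) (k := k) fun l => by rw [← hk]

lemma IsValid.edge_shift (hR : R.IsValid) {s : ℤ} (hs : s = 1 ∨ s = -1) {i : Fin d}
    (hi : 0 ≤ s * R.dir i 0) {r : ℝ} (h0 : 0 ≤ r) (h1 : r ≤ R.len i) :
    R.shift (R.flips s) (R.V i 0 + r * R.dir i 0) = R.shift (R.flips s) (R.V i 0) +
      r * (R.slope (R.flips s) (R.V i 0) (R.dir i 0) * R.dir i 0) := by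
  rcases hi.eq_or_lt with h | hi
  · have : R.dir i 0 = 0 := by rcases hs with rfl | rfl <;> omega
    simp [this]
  rcases h0.eq_or_lt with rfl | h0
  · simp
  have hi' : (0 : ℝ) < s * R.dir i 0 := by exact_mod_cast hi
  have hd0 : (R.dir i 0 : ℝ) ≠ 0 := right_ne_zero_of_mul hi'.ne'
  rw [shift_add, slope_eq_of_mul_pos (v := r * R.dir i 0) (w := R.dir i 0)]
  · ring
  · rw [mul_assoc]; exact _root_.mul_pos h0 (mul_self_pos.2 hd0)
  exact fun j hj => hR.no_cut_inside hs hi h0.le h1 hj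

/-- Along an edge the sheared direction is constant. -/
lemma IsValid.e1_succ (hR : R.IsValid) {s : ℤ} (hs : s = 1 ∨ s = -1) {i : Fin d}
    (hi : 0 ≤ s * R.dir i 0) :
    R.e1 (R.flips s) (i + 1) = -R.e2 (R.flips s) i := by
  ext l
  fin_cases l
  · simp
  · have h1 := hR.edge_shift hs hi (hR.len_pos i).le le_rfl
    rcases hi.eq_or_lt with h | hi
    · have : R.dir i 0 = 0 := by rcases hs with rfl | rfl <;> omega
      simp [this]
    have hi' : (0 : ℝ) < s * R.dir i 0 := by exact_mod_cast hi
    have hd0 : (R.dir i 0 : ℝ) ≠ 0 := right_ne_zero_of_mul hi'.ne'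
    have hb : ∀ j, R.flips s j ≠ 0 →
        0 ≤ (R.c j 0 - R.V (i + 1) 0) * (R.c j 0 - (R.V (i + 1) 0 + -(R.len i * R.dir i 0))) := by
      intro j hj
      have := hR.no_cut_inside hs hi (hR.len_pos i).le le_rfl hj
      rw [hR.V_succ]
      linarith
    have h2 := shift_add hb
    have hpos : (0 : ℝ) < R.len i * (R.dir i 0 * R.dir i 0) :=
      _root_.mul_pos (hR.len_pos i) (mul_self_pos.2 hd0)
    rw [slope_eq_of_mul_pos (v := -(R.len i * R.dir i 0)) (w := -R.dir i 0) (by linarith),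
      hR.V_succ, show R.V i 0 + R.len i * (R.dir i 0 : ℝ) + -(R.len i * R.dir i 0) = R.V i 0 by ring,
      h1] at h2
    have h3 : R.slope (R.flips s) (R.V i 0) (R.dir i 0) =
        R.slope (R.flips s) (R.V (i + 1) 0) (-R.dir i 0) := by
      have : R.len i * R.dir i 0 * ((R.slope (R.flips s) (R.V i 0) (R.dir i 0) : ℝ) -
        R.slope (R.flips s) (R.V (i + 1) 0) (-R.dir i 0)) = 0 := by
        rw [hR.V_succ]; linarith
      rcases mul_eq_zero.1 this with h | h
      · exact absurd h (mul_ne_zero (hR.len_pos i).ne' hd0)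
      · exact_mod_cast sub_eq_zero.1 h
    simp [← h3]
    ring

end STRep

namespace STRep

variable {d m D : ℕ} [NeZero d] [NeZero D] {R : STRep d m} {g : Fin D → Fin d} {a : Fin D}

omit [NeZero D] in
lemma IsValid.sgn_mul_jump (hR : R.IsValid) {s : ℤ} (hs : s = 1 ∨ s = -1) {k : Fin d}
    (hk : R.IsSide s k) : s * R.jump (R.flips s) (R.V k 0) = R.numCuts k := by
  have h2 : s * s = 1 := by rcases hs with rfl | rfl <;> rfl
  rw [hR.numCuts_eq hs hk, jump, Finset.mul_sum]
  refine Finset.sum_congr rfl fun j _ => ?_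
  by_cases h1 : R.c j 0 = R.V k 0 <;> by_cases h3 : R.eps j = s <;>
    simp [flips, h1, h3, h2]

omit [NeZero D] in
/-- Fake corners are straightened by unbending the cuts meeting them. -/
lemma IsValid.e2_fake (hR : R.IsValid) {s : ℤ} (hs : s = 1 ∨ s = -1) {k : Fin d}
    (hk : R.IsFakeCorner k) (hks : 0 ≤ s * R.dir k 0) :
    R.e2 (R.flips s) k = -R.e1 (R.flips s) k := by
  obtain ⟨h0, h1⟩ := hR.dir_fake hk
  have hside : R.IsSide s k := by
    rcases hR.isSide_of_isFakeCorner hk with h | h <;> rcases hs with rfl | rfl <;>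
      first | exact h | (have := h.2; omega)
  have hj := hR.sgn_mul_jump hs hside
  have hsl := slope_sub_of_isSide (u := R.flips s) hs hside
  ext l
  fin_cases l
  · simp [h0]
  · simp only [Fin.mk_one, e2_one, Pi.neg_apply, e1_one]
    rw [hj] at hsl
    rw [h1, h0] at *
    linear_combination R.dir k 0 * hsl

/-- The point `q` lies on the semitoric edge following the corner `V (g a)`, at affine
distance `t` along it. -/
def OnEdge (R : STRep d m) (g : Fin D → Fin d) (a : Fin D) (q : Pt) (t : ℝ) : Prop :=
  ∃ n < chainLen (g a) (g (a + 1)), ∃ r, 0 ≤ r ∧ r ≤ R.len (step (g a) n) ∧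
    (∀ k, q k = R.V (step (g a) n) k + r * R.dir (step (g a) n) k) ∧
    t = R.pathLen (g a) n + r

lemma stEdgeLen_eq (a : Fin D) :
    stEdgeLen R g a = R.pathLen (g a) (chainLen (g a) (g (a + 1))) :=
  sum_if_distCyc_lt _ (chainLen_le _ _)

lemma onEmanating_iff {q : Pt} {t : ℝ} : OnEmanating R g a q t ↔
    R.OnEdge g a q t ∨ R.OnEdge g (a - 1) q (stEdgeLen R g (a - 1) - t) := by
  refine or_congr ?_ ?_
  · constructor
    · rintro ⟨i, s, hi, h0, h1, hq, ht⟩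
      refine ⟨distCyc (g a) i, hi, s, h0, ?_⟩
      rw [step_distCyc]
      exact ⟨h1, hq, by rw [ht, sum_if_distCyc_lt _ (distCyc_lt _ _).le]⟩
    · rintro ⟨n, hn, r, h0, h1, hq, ht⟩
      have hnd := hn.trans_le (chainLen_le _ _)
      refine ⟨step (g a) n, r, ?_, h0, h1, hq, ?_⟩
      · rwa [distCyc_step _ hnd]
      · rw [distCyc_step _ hnd, sum_if_distCyc_lt _ hnd.le, ht]
  · rw [stEdgeLen_eq, OnEdge, sub_add_cancel]
    constructor
    · rintro ⟨i, s, hi, h0, h1, hq, ht⟩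
      refine ⟨distCyc (g (a - 1)) i, hi, s, h0, ?_⟩
      rw [step_distCyc]
      refine ⟨h1, hq, ?_⟩
      rw [ht, sum_if_distCyc_between _ hi (chainLen_le _ _), pathLen_succ, step_distCyc]
      ring
    · rintro ⟨n, hn, r, h0, h1, hq, ht⟩
      have hnd := hn.trans_le (chainLen_le _ _)
      refine ⟨step (g (a - 1)) n, r, ?_, h0, h1, hq, ?_⟩
      · rwa [distCyc_step _ hnd]
      · rw [distCyc_step _ hnd, sum_if_distCyc_between _ hn (chainLen_le _ _), pathLen_succ]
        linarith

lemma isFakeCorner_step (hg : IsCornerEnum R g) {n : ℕ} (h0 : 0 < n)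
    (hn : n < chainLen (g a) (g (a + 1))) : R.IsFakeCorner (step (g a) n) := by
  by_contra hk
  obtain ⟨b, hb⟩ := (hg.2 _).1 hk
  have hv := congrArg Fin.val hb
  rw [step_val] at hv
  have hga := (g a).isLt
  have hgb := (g b).isLt
  by_cases hlast : a.val + 1 < D
  · have hval : (a + 1).val = a.val + 1 := by
      rw [Fin.val_add_one_of_lt' hlast]
    have hlt : g a < g (a + 1) := hg.1 (by rw [Fin.lt_def]; omega)
    have hlt' : (g a).val < (g (a + 1)).val := hlt
    have hga1 := (g (a + 1)).isLt
    rw [chainLen, if_neg hlt.ne', distCyc,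
      show (g (a + 1)).val + d - (g a).val = ((g (a + 1)).val - (g a).val) + d by omega,
      Nat.add_mod_right, Nat.mod_eq_of_lt (by omega)] at hn
    rw [Nat.mod_eq_of_lt (by omega)] at hv
    have h1 : a < b := hg.1.lt_iff_lt.1 (by rw [Fin.lt_def]; omega)
    have h2 : b < a + 1 := hg.1.lt_iff_lt.1 (by rw [Fin.lt_def]; omega)
    rw [Fin.lt_def] at h1 h2
    omega
  · have hD := a.isLt
    have ha1 : a + 1 = 0 := by
      ext
      rw [Fin.val_add, Fin.val_one', Nat.add_mod_mod, Fin.val_zero,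
        show a.val + 1 = D by omega, Nat.mod_self]
    have hle : g 0 ≤ g a := hg.1.monotone (Fin.zero_le a)
    have hle' : (g 0).val ≤ (g a).val := hle
    have hL : chainLen (g a) (g (a + 1)) = (g 0).val + d - (g a).val := by
      rw [ha1, chainLen]
      split_ifs with h
      · rw [h]; omega
      · have : (g 0).val ≠ (g a).val := fun h' => h (Fin.ext h')
        rw [distCyc, Nat.mod_eq_of_lt (by omega)]
    rw [hL] at hn
    rcases lt_or_ge ((g a).val + n) d with h | h
    · rw [Nat.mod_eq_of_lt h] at hv
      have h1 : a < b := hg.1.lt_iff_lt.1 (by rw [Fin.lt_def]; omega)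
      rw [Fin.lt_def] at h1
      have := b.isLt
      omega
    · rw [Nat.mod_eq_sub_mod h, Nat.mod_eq_of_lt (by omega)] at hv
      have h1 : b < 0 := hg.1.lt_iff_lt.1 (by rw [Fin.lt_def]; omega)
      exact absurd h1 (by simp)

omit [NeZero D] in
lemma isHDCorner_g (hg : IsCornerEnum R g) (a : Fin D) : R.IsHDCorner (g a) :=
  (hg.2 _).2 ⟨a, rfl⟩

lemma step_eq_step (hg : IsCornerEnum R g) {a b : Fin D} {n n' : ℕ}
    (hn : n < chainLen (g a) (g (a + 1))) (hn' : n' < chainLen (g b) (g (b + 1)))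
    (h : step (g a) n = step (g b) n') : a = b ∧ n = n' := by
  wlog hle : n ≤ n' generalizing a b n n'
  · obtain ⟨h1, h2⟩ := this hn' hn h.symm (by omega)
    exact ⟨h1.symm, h2.symm⟩
  have h1 : step (step (g b) (n' - n)) n = step (g a) n := by
    rw [← step_add, h]; congr 1; omega
  have h2 := step_left_injective n h1
  rcases Nat.eq_zero_or_pos (n' - n) with h0 | h0
  · rw [h0, step_zero] at h2
    exact ⟨hg.1.injective h2.symm, by omega⟩
  · have := isFakeCorner_step hg h0 (by omega : n' - n < chainLen (g b) (g (b + 1)))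
    rw [h2] at this
    exact absurd this (isHDCorner_g hg a)

lemma OnEdge.mem_frontier (hR : R.IsValid) {q : Pt} {t : ℝ} (h : R.OnEdge g a q t) :
    q ∈ frontier R.carrier := by
  obtain ⟨n, -, r, h0, h1, hq, -⟩ := h
  exact hR.edge_mem_frontier h0 h1 hq

lemma OnEdge.mem_carrier (hR : R.IsValid) {q : Pt} {t : ℝ} (h : R.OnEdge g a q t) :
    q ∈ R.carrier := R.carrier_isClosed.frontier_subset (h.mem_frontier hR)

lemma OnEdge.nonneg (hR : R.IsValid) {q : Pt} {t : ℝ} (h : R.OnEdge g a q t) : 0 ≤ t := by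
  obtain ⟨n, -, r, h0, -, -, ht⟩ := h
  have := hR.pathLen_mono (g a) (Nat.zero_le n)
  rw [pathLen_zero] at this
  linarith

lemma OnEdge.le_stEdgeLen (hR : R.IsValid) {q : Pt} {t : ℝ} (h : R.OnEdge g a q t) :
    t ≤ stEdgeLen R g a := by
  obtain ⟨n, hn, r, -, h1, -, ht⟩ := h
  have := hR.pathLen_mono (g a) (Nat.succ_le_of_lt hn)
  rw [Nat.succ_eq_add_one, pathLen_succ] at this
  rw [stEdgeLen_eq]
  linarith

lemma stEdgeLen_pos (hR : R.IsValid) (a : Fin D) : 0 < stEdgeLen R g a := by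
  rw [stEdgeLen_eq]
  have := hR.pathLen_mono (g a) (Nat.succ_le_of_lt (chainLen_pos (g a) (g (a + 1))))
  rw [Nat.succ_eq_add_one, pathLen_succ, pathLen_zero] at this
  linarith [hR.len_pos (step (g a) 0)]

lemma exists_onEdge (R : STRep d m) (g : Fin D → Fin d) (a : Fin D) {t : ℝ}
    (h0 : 0 ≤ t) (h1 : t ≤ stEdgeLen R g a) : ∃ q, R.OnEdge g a q t := by
  rw [stEdgeLen_eq] at h1
  have key (N : ℕ) (hN : N ≤ chainLen (g a) (g (a + 1))) (hN0 : 0 < N)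
      (h : t ≤ R.pathLen (g a) N) : ∃ q, R.OnEdge g a q t := by
    induction N with
    | zero => omega
    | succ N ih =>
      rcases le_or_gt (R.pathLen (g a) N) t with hle | hlt
      · rw [pathLen_succ] at h
        exact ⟨fun k => R.V (step (g a) N) k + (t - R.pathLen (g a) N) * R.dir (step (g a) N) k,
          N, by omega, t - R.pathLen (g a) N, by linarith, by linarith, fun k => rfl, by ring⟩
      · rcases Nat.eq_zero_or_pos N with h0' | h0'
        · rw [h0', pathLen_zero] at hlt; linarith
        · exact ih (by omega) h0' hlt.le
  exact key _ le_rfl (chainLen_pos _ _) h1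

lemma onEdge_end (hR : R.IsValid) (g : Fin D → Fin d) (a : Fin D) :
    R.OnEdge g a (R.V (g (a + 1))) (stEdgeLen R g a) := by
  have hL := chainLen_pos (g a) (g (a + 1))
  obtain ⟨n, hn⟩ : ∃ n, chainLen (g a) (g (a + 1)) = n + 1 := ⟨_, (Nat.succ_pred_eq_of_pos hL).symm⟩
  refine ⟨n, by omega, R.len (step (g a) n), (hR.len_pos _).le, le_rfl, fun k => ?_, ?_⟩
  · rw [← hR.V_succ, ← step_succ, ← hn, step_chainLen]
  · rw [stEdgeLen_eq, hn, pathLen_succ]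

lemma onEdge_start (hR : R.IsValid) (g : Fin D → Fin d) (a : Fin D) :
    R.OnEdge g a (R.V (g a)) 0 :=
  ⟨0, chainLen_pos _ _, 0, le_rfl, (hR.len_pos _).le, fun k => by simp, by simp⟩

/-- Distinct affine positions along the boundary give distinct points. -/
lemma OnEdge.inj (hR : R.IsValid) (hg : IsCornerEnum R g) (hinj : Function.Injective R.V)
    {a b : Fin D} {q : Pt} {t t' : ℝ} (h : R.OnEdge g a q t) (h' : R.OnEdge g b q t')
    (ht : t < stEdgeLen R g a) (ht' : t' < stEdgeLen R g b) : a = b ∧ t = t' := by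
  have key {a : Fin D} {t : ℝ} (h : R.OnEdge g a q t) (ht : t < stEdgeLen R g a) :
      ∃ n < chainLen (g a) (g (a + 1)), ∃ r, 0 ≤ r ∧ r < R.len (step (g a) n) ∧
      (∀ k, q k = R.V (step (g a) n) k + r * R.dir (step (g a) n) k) ∧
      t = R.pathLen (g a) n + r := by
    obtain ⟨n, hn, r, h0, h1, hq, htr⟩ := h
    rcases h1.eq_or_lt with rfl | hlt
    · rw [stEdgeLen_eq, htr, ← pathLen_succ] at ht
      have hne : n + 1 ≠ chainLen (g a) (g (a + 1)) := by
        intro h; rw [h] at ht; exact lt_irrefl _ ht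
      refine ⟨n + 1, by omega, 0, le_rfl, hR.len_pos _, fun k => ?_, ?_⟩
      · rw [step_succ, hR.V_succ, hq]; ring
      · rw [pathLen_succ, htr]; ring
    · exact ⟨n, hn, r, h0, hlt, hq, htr⟩
  obtain ⟨n, hn, r, h0, h1, hq, rfl⟩ := key h ht
  obtain ⟨n', hn', r', h0', h1', hq', rfl⟩ := key h' ht'
  obtain ⟨hs, rfl⟩ := hR.edge_point_unique hinj h0 h1 h0' h1' fun l => by rw [← hq, hq']
  obtain ⟨rfl, rfl⟩ := step_eq_step hg hn hn' hs
  exact ⟨rfl, rfl⟩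

lemma IsValid.chain_aux (hR : R.IsValid) (hg : IsCornerEnum R g) {s : ℤ} (hs : s = 1 ∨ s = -1)
    (ha : 0 ≤ s * R.dir (g a) 0) {n : ℕ} (hn : n < chainLen (g a) (g (a + 1))) :
    R.e2 (R.flips s) (step (g a) n) = R.e2 (R.flips s) (g a) ∧
      R.relX (g a) (R.V (step (g a) n)) = R.pathLen (g a) n * R.e2 (R.flips s) (g a) 0 ∧
      R.relY (R.flips s) (g a) (R.V (step (g a) n)) =
        R.pathLen (g a) n * R.e2 (R.flips s) (g a) 1 := by
  induction n with
  | zero => simp [relX, relY]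
  | succ n ih =>
    obtain ⟨h1, h2, h3⟩ := ih (by omega)
    have hfake := isFakeCorner_step hg (Nat.succ_pos n) hn
    rw [Nat.succ_eq_add_one, step_succ] at hfake
    have hd0 := (hR.dir_fake hfake).1
    rw [add_sub_cancel_right] at hd0
    have hdn : R.dir (step (g a) n) 0 = R.dir (g a) 0 := congrFun h1 0
    have hsn : 0 ≤ s * R.dir (step (g a) n) 0 := by rwa [hdn]
    have he : R.e2 (R.flips s) (step (g a) n + 1) = R.e2 (R.flips s) (g a) := by
      rw [hR.e2_fake hs hfake (by rwa [← hd0]), hR.e1_succ hs hsn, neg_neg, h1]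
    have hsh := hR.edge_shift hs hsn (hR.len_pos _).le le_rfl
    have h4 := congrFun h1 1
    rw [e2_one, hdn] at h4
    have h4' : (R.dir (step (g a) n) 1 : ℝ) +
      R.slope (R.flips s) (R.V (step (g a) n) 0) (R.dir (g a) 0) * R.dir (g a) 0 =
        R.e2 (R.flips s) (g a) 1 := by exact_mod_cast h4
    rw [step_succ, pathLen_succ]
    refine ⟨he, ?_, ?_⟩
    · unfold relX at h2 ⊢
      rw [hR.V_succ, hdn]
      rw [e2_zero] at h2 ⊢
      linear_combination h2
    · unfold relY at h3 ⊢
      rw [hR.V_succ, hR.V_succ, hsh]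
      rw [hdn]
      linear_combination h3 + R.len (step (g a) n) * h4'

/-- A semitoric edge becomes straight after unbending the cuts on its side. -/
lemma OnEdge.rel_eq (hR : R.IsValid) (hg : IsCornerEnum R g) {s : ℤ} (hs : s = 1 ∨ s = -1)
    (ha : 0 ≤ s * R.dir (g a) 0) {q : Pt} {t : ℝ} (h : R.OnEdge g a q t) :
    R.relX (g a) q = t * R.e2 (R.flips s) (g a) 0 ∧
      R.relY (R.flips s) (g a) q = t * R.e2 (R.flips s) (g a) 1 := by
  obtain ⟨n, hn, r, h0, h1, hq, rfl⟩ := h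
  obtain ⟨i1, i2, i3⟩ := hR.chain_aux hg hs ha hn
  have hdn : R.dir (step (g a) n) 0 = R.dir (g a) 0 := congrFun i1 0
  have hsh := hR.edge_shift hs (i := step (g a) n) (by rwa [hdn]) h0 h1
  have h4 := congrFun i1 1
  rw [e2_one, hdn] at h4
  have h4' : (R.dir (step (g a) n) 1 : ℝ) +
    R.slope (R.flips s) (R.V (step (g a) n) 0) (R.dir (g a) 0) * R.dir (g a) 0 =
      R.e2 (R.flips s) (g a) 1 := by exact_mod_cast h4
  constructor
  · unfold relX at i2 ⊢
    rw [hq, hdn]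
    rw [e2_zero] at i2 ⊢
    linear_combination i2
  · unfold relY at i3 ⊢
    rw [hq, hq, hsh, hdn]
    linear_combination i3 + r * h4'

lemma IsValid.e1_next (hR : R.IsValid) (hg : IsCornerEnum R g) {s : ℤ} (hs : s = 1 ∨ s = -1)
    (ha : 0 ≤ s * R.dir (g a) 0) :
    R.e1 (R.flips s) (g (a + 1)) = -R.e2 (R.flips s) (g a) := by
  have hL := chainLen_pos (g a) (g (a + 1))
  obtain ⟨n, hn⟩ : ∃ n, chainLen (g a) (g (a + 1)) = n + 1 := ⟨_, (Nat.succ_pred_eq_of_pos hL).symm⟩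
  obtain ⟨i1, -, -⟩ := hR.chain_aux hg hs ha (n := n) (by omega)
  have hdn : R.dir (step (g a) n) 0 = R.dir (g a) 0 := congrFun i1 0
  rw [← step_chainLen (g a) (g (a + 1)), hn, step_succ, hR.e1_succ hs (by rwa [hdn]), i1]

lemma OnEdge.relX_eq (hR : R.IsValid) (hg : IsCornerEnum R g) {q : Pt} {t : ℝ}
    (h : R.OnEdge g a q t) : R.relX (g a) q = t * R.dir (g a) 0 := by
  rcases le_total 0 (R.dir (g a) 0) with h0 | h0
  · exact (h.rel_eq hR hg (Or.inl rfl) (by omega)).1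
  · exact (h.rel_eq hR hg (Or.inr rfl) (by omega)).1

lemma IsValid.dir_next (hR : R.IsValid) (hg : IsCornerEnum R g) (a : Fin D) :
    R.dir (g (a + 1) - 1) 0 = R.dir (g a) 0 := by
  rcases le_total 0 (R.dir (g a) 0) with h0 | h0
  · have := congrFun (hR.e1_next hg (a := a) (Or.inl rfl) (by omega)) 0
    simpa using this
  · have := congrFun (hR.e1_next hg (a := a) (Or.inr rfl) (by omega)) 0
    simpa using this

lemma IsValid.exists_ne_zero_e2 (hR : R.IsValid) (u : Fin m → ℤ) (k : Fin d) :
    R.e2 u k 0 ≠ 0 ∨ R.e2 u k 1 ≠ 0 := by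
  by_contra hcon
  push Not at hcon
  have hp := hR.primitive k
  obtain ⟨h0, h1⟩ := hcon
  rw [e2_zero] at h0
  rw [e2_one, h0, mul_zero, add_zero] at h1
  simp [h0, h1] at hp

lemma IsValid.add_one_ne (hR : R.IsValid) (hg : IsCornerEnum R g) (a : Fin D) : a + 1 ≠ a := by
  intro h
  obtain ⟨s, hs, h0⟩ : ∃ s : ℤ, (s = 1 ∨ s = -1) ∧ 0 ≤ s * R.dir (g a) 0 := by
    rcases le_total 0 (R.dir (g a) 0) with h0 | h0
    · exact ⟨1, Or.inl rfl, by omega⟩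
    · exact ⟨-1, Or.inr rfl, by omega⟩
  have he := onEdge_end hR g a
  rw [h] at he
  have hl := stEdgeLen_pos (g := g) hR a
  obtain ⟨h1, h2⟩ := he.rel_eq hR hg hs h0
  have h1 : 0 = stEdgeLen R g a * R.e2 (R.flips s) (g a) 0 := by simpa [relX] using h1
  have h2 : 0 = stEdgeLen R g a * R.e2 (R.flips s) (g a) 1 := by simpa [relY] using h2
  rcases hR.exists_ne_zero_e2 (R.flips s) (g a) with h | h
  · exact h (by exact_mod_cast (mul_eq_zero.1 h1.symm).resolve_left hl.ne')
  · exact h (by exact_mod_cast (mul_eq_zero.1 h2.symm).resolve_left hl.ne')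

end STRep

namespace STRep

variable {d m D : ℕ} [NeZero d] [NeZero D] {R : STRep d m} {g : Fin D → Fin d} {a : Fin D}
  {u : Fin m → ℤ} {k : Fin d}

/-- The point `q` lies at affine distance `t` from `V (g a)` on the outgoing (`true`) or
incoming (`false`) semitoric edge. -/
def Leg (R : STRep d m) (g : Fin D → Fin d) (i : Bool) (a : Fin D) (q : Pt) (t : ℝ) : Prop :=
  if i then R.OnEdge g a q t else R.OnEdge g (a - 1) q (stEdgeLen R g (a - 1) - t)

/-- The length of the outgoing or incoming semitoric edge. -/
noncomputable def legLen (R : STRep d m) (g : Fin D → Fin d) (i : Bool) (a : Fin D) : ℝ :=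
  if i then stEdgeLen R g a else stEdgeLen R g (a - 1)

/-- The direction of the outgoing or incoming edge after applying the cut flips `u`. -/
noncomputable def ev (R : STRep d m) (u : Fin m → ℤ) (k : Fin d) (i : Bool) : Fin 2 → ℤ :=
  if i then R.e2 u k else R.e1 u k

/-- The orientation sign of the outgoing or incoming edge. -/
def osgn (i : Bool) : ℤ := if i then 1 else -1

lemma onEmanating_iff_leg {q : Pt} {t : ℝ} :
    OnEmanating R g a q t ↔ ∃ i, R.Leg g i a q t := by
  rw [onEmanating_iff, Bool.exists_bool, or_comm]; simp [Leg]

lemma exists_leg (R : STRep d m) (g : Fin D → Fin d) (i : Bool) (a : Fin D) {t : ℝ}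
    (h0 : 0 ≤ t) (h1 : t ≤ R.legLen g i a) : ∃ q, R.Leg g i a q t := by
  cases i
  · exact R.exists_onEdge g (a - 1) (by simp [legLen] at h1; linarith) (by linarith)
  · exact R.exists_onEdge g a h0 h1

lemma Leg.mem_carrier (hR : R.IsValid) {i : Bool} {q : Pt} {t : ℝ} (h : R.Leg g i a q t) :
    q ∈ R.carrier := by
  cases i
  · exact OnEdge.mem_carrier hR h
  · exact OnEdge.mem_carrier hR h

lemma Leg.nonneg (hR : R.IsValid) {i : Bool} {q : Pt} {t : ℝ} (h : R.Leg g i a q t) :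
    0 ≤ t := by
  cases i
  · have := OnEdge.le_stEdgeLen hR h; linarith
  · exact OnEdge.nonneg hR h

lemma Leg.le_legLen (hR : R.IsValid) {i : Bool} {q : Pt} {t : ℝ} (h : R.Leg g i a q t) :
    t ≤ R.legLen g i a := by
  cases i
  · have := OnEdge.nonneg hR h; simp only [legLen]; simp; linarith
  · exact OnEdge.le_stEdgeLen hR h

lemma IsValid.dir_pred (hR : R.IsValid) (hg : IsCornerEnum R g) (a : Fin D) :
    R.dir (g a - 1) 0 = R.dir (g (a - 1)) 0 := by
  rw [← hR.dir_next hg (a - 1), sub_add_cancel]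

/-- A semitoric edge on the `s`-side is straight after unbending the cuts in direction `s`. -/
lemma Leg.relY_eq (hR : R.IsValid) (hg : IsCornerEnum R g) {s : ℤ} (hs : s = 1 ∨ s = -1)
    {i : Bool} (hi : 0 ≤ s * osgn i * R.ev (R.flips s) (g a) i 0) {q : Pt} {t : ℝ}
    (h : R.Leg g i a q t) :
    R.relY (R.flips s) (g a) q = t * R.ev (R.flips s) (g a) i 1 := by
  cases i
  · simp only [osgn, ev, e1_zero, Bool.false_eq_true, if_false] at hi ⊢
    have ha : 0 ≤ s * R.dir (g (a - 1)) 0 := by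
      rw [← hR.dir_pred hg]; linarith
    have h1 := (OnEdge.rel_eq hR hg hs ha h).2
    have h2 := (OnEdge.rel_eq hR hg hs ha (onEdge_end hR g (a - 1))).2
    have h3 := hR.e1_next hg hs ha
    rw [sub_add_cancel] at h2 h3
    rw [h3]
    unfold relY at h1 h2 ⊢
    simp only [Pi.neg_apply]
    push_cast
    linear_combination h1 - h2
  · exact (OnEdge.rel_eq hR hg hs (by simpa [osgn, ev] using hi) h).2

lemma ev_zero_eq (u v : Fin m → ℤ) (k : Fin d) (i : Bool) : R.ev u k i 0 = R.ev v k i 0 := by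
  cases i <;> rfl

lemma Leg.relX_eq (hR : R.IsValid) (hg : IsCornerEnum R g) {i : Bool} {q : Pt} {t : ℝ}
    (u : Fin m → ℤ) (h : R.Leg g i a q t) : R.relX (g a) q = t * R.ev u (g a) i 0 := by
  cases i
  · have h1 := OnEdge.relX_eq hR hg h
    have h2 := OnEdge.relX_eq hR hg (onEdge_end hR g (a - 1))
    rw [sub_add_cancel] at h2
    simp only [ev, Bool.false_eq_true, if_false, e1_zero]
    rw [hR.dir_pred hg]
    unfold relX at h1 h2 ⊢
    push_cast
    linear_combination h1 - h2
  · exact OnEdge.relX_eq hR hg h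

/-- A point on a semitoric edge on the `s`-side is extremal on its vertical line. -/
lemma OnEdge.extremal (hR : R.IsValid) (hg : IsCornerEnum R g) {s : ℤ} (hs : s = 1 ∨ s = -1)
    (ha : 0 < s * R.dir (g a) 0) {q z : Pt} {t : ℝ} (h : R.OnEdge g a q t)
    (hz : z ∈ R.carrier) (hzq : z 0 = q 0) : s * z 1 ≤ s * q 1 := by
  obtain ⟨n, hn, r, h0, h1, hq, rfl⟩ := h
  have hdn : R.dir (step (g a) n) 0 = R.dir (g a) 0 :=
    congrFun (hR.chain_aux hg hs ha.le hn).1 0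
  rw [← hdn] at ha
  have h2 := (side_nonpos_iff hs ha z).1 (hR.side_nonpos _ hz)
  have hd0 : (R.dir (step (g a) n) 0 : ℝ) ≠ 0 := by
    have : R.dir (step (g a) n) 0 ≠ 0 := by rintro h; simp [h] at ha
    exact_mod_cast this
  have h3 : R.lineHt (step (g a) n) (z 0) = q 1 := by
    rw [hzq, lineHt, hq 0, hq 1]; field_simp; ring
  rwa [h3] at h2

lemma Leg.extremal (hR : R.IsValid) (hg : IsCornerEnum R g) {s : ℤ} (hs : s = 1 ∨ s = -1)
    {i : Bool} (hi : 0 < s * osgn i * R.ev u (g a) i 0) {q z : Pt} {t : ℝ}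
    (h : R.Leg g i a q t) (hz : z ∈ R.carrier) (hzq : z 0 = q 0) : s * z 1 ≤ s * q 1 := by
  cases i
  · simp only [osgn, ev, e1_zero, Bool.false_eq_true, if_false] at hi
    rw [hR.dir_pred hg] at hi
    exact OnEdge.extremal hR hg hs (by linarith) h hz hzq
  · exact OnEdge.extremal hR hg hs (by simpa [osgn, ev] using hi) h hz hzq

/-- The affine function at the corner `V k` whose sublevel sets cut off triangles. -/
noncomputable def ht (R : STRep d m) (u : Fin m → ℤ) (k : Fin d) (z : Pt) : ℝ :=
  R.crd1 u k z + R.crd2 u k z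

/-- The cut flips of the canonical representative at `V k`. -/
def cf (R : STRep d m) (k : Fin d) : Fin m → ℤ := R.flips (R.sgn k)

lemma adm_cf (k : Fin d) : R.Adm (R.cf k) := adm_flips _

lemma IsValid.relX_eq_crd (hR : R.IsValid) (hk : R.IsHDCorner k) (z : Pt) :
    R.relX k z = R.crd1 (R.cf k) k z * R.e1 (R.cf k) k 0 +
      R.crd2 (R.cf k) k z * R.e2 (R.cf k) k 0 := by
  have := R.detZ_mul_relX (u := R.cf k) (k := k) z
  rwa [cf, hR.detZ_sgn hk, Int.cast_one, one_mul] at this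

lemma IsValid.relY_eq_crd (hR : R.IsValid) (hk : R.IsHDCorner k) (z : Pt) :
    R.relY (R.cf k) k z = R.crd1 (R.cf k) k z * R.e1 (R.cf k) k 1 +
      R.crd2 (R.cf k) k z * R.e2 (R.cf k) k 1 := by
  have := R.detZ_mul_relY (u := R.cf k) (k := k) z
  rwa [cf, hR.detZ_sgn hk, Int.cast_one, one_mul] at this

lemma ht_eq_mul_detZ {i : Bool} {z : Pt} {t : ℝ} (hx : R.relX k z = t * R.ev u k i 0)
    (hy : R.relY u k z = t * R.ev u k i 1) : R.ht u k z = t * detZ (R.e1 u k) (R.e2 u k) := by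
  unfold ht crd1 crd2 detZ
  rw [hx, hy]
  cases i
  · simp only [ev, Bool.false_eq_true, if_false]; push_cast; ring
  · simp only [ev, if_true]; push_cast; ring

lemma sgn_mul_e1_le (u : Fin m → ℤ) (k : Fin d) :
    (R.sgn k : ℝ) * R.e1 u k 0 ≤ R.sgn k * R.e2 u k 0 := by
  have := R.sgn_mul k
  have h := abs_nonneg (R.dir (k - 1) 0 + R.dir k 0 : ℝ)
  rw [e1_zero, e2_zero]
  push_cast
  linarith

/-- If `α e₁ + β e₂` and `t eᵢ` have the same horizontal coordinate and the edge `i` is not on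
the side of the canonical cuts, then `α + β ≤ t`. -/
lemma add_le_of_not_good {i : Bool} {t α β : ℝ} (hα : 0 ≤ α) (hβ : 0 ≤ β)
    (hi : R.sgn k * osgn i * R.ev u k i 0 < 0)
    (h : α * R.e1 u k 0 + β * R.e2 u k 0 = t * R.ev u k i 0) : α + β ≤ t := by
  have h1 := sgn_mul_e1_le (R := R) u k
  have hi' : (R.sgn k : ℝ) * osgn i * R.ev u k i 0 < 0 := by exact_mod_cast hi
  cases i
  · simp only [osgn, ev, Bool.false_eq_true, if_false] at hi' h
    push_cast at hi'
    set x : ℝ := (R.e1 u k 0 : ℝ)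
    set y : ℝ := (R.e2 u k 0 : ℝ)
    set s : ℝ := (R.sgn k : ℝ)
    have h2 : 0 < s * x := by linarith
    have h3 : (α + β) * (s * x) ≤ t * (s * x) := by
      have := mul_le_mul_of_nonneg_left h1 hβ
      linear_combination this + s * h
    exact le_of_mul_le_mul_right h3 h2
  · simp only [osgn, ev, if_true] at hi' h
    push_cast at hi'
    set x : ℝ := (R.e1 u k 0 : ℝ)
    set y : ℝ := (R.e2 u k 0 : ℝ)
    set s : ℝ := (R.sgn k : ℝ)
    have h2 : 0 < -(s * y) := by linarith
    have h3 : (α + β) * (-(s * y)) ≤ t * (-(s * y)) := by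
      have := mul_le_mul_of_nonneg_left h1 hα
      linear_combination this - s * h
    exact le_of_mul_le_mul_right h3 h2

lemma Leg.ht_le (hR : R.IsValid) (hg : IsCornerEnum R g) {i : Bool} {q : Pt} {t : ℝ}
    (h : R.Leg g i a q t) : R.ht (R.cf (g a)) (g a) q ≤ t := by
  have hk := isHDCorner_g hg a
  have hx := h.relX_eq hR hg (R.cf (g a))
  rcases lt_or_ge (R.sgn (g a) * osgn i * R.ev (R.cf (g a)) (g a) i 0) 0 with hi | hi
  · obtain ⟨h1, h2⟩ := hR.crd_nonneg hk (adm_cf _) (h.mem_carrier hR)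
    exact add_le_of_not_good h1 h2 hi (by rw [← hR.relX_eq_crd hk, hx])
  · rw [ht_eq_mul_detZ hx (h.relY_eq hR hg (R.sgn_eq _) hi), cf, hR.detZ_sgn hk]
    simp

/-- A point of the cone shares its horizontal coordinate with a point of a side of the cone
lying on the side of the canonical cuts, and this is the closest such point. -/
lemma IsValid.exists_good (hR : R.IsValid) (hk : R.IsHDCorner k) {X α β : ℝ} (hα : 0 ≤ α)
    (hβ : 0 ≤ β) (h : X = α * R.e1 u k 0 + β * R.e2 u k 0) :
    ∃ i t, 0 < R.sgn k * osgn i * R.ev u k i 0 ∧ 0 ≤ t ∧ X = t * R.ev u k i 0 ∧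
      ∀ α' β' : ℝ, 0 ≤ α' → 0 ≤ β' → X = α' * R.e1 u k 0 + β' * R.e2 u k 0 → t ≤ α' + β' := by
  have h1 := sgn_mul_e1_le (R := R) u k
  have hs0 : (R.sgn k : ℝ) ≠ 0 := by rcases R.sgn_eq k with h | h <;> rw [h] <;> norm_num
  have hne : R.e1 u k 0 ≠ 0 ∨ R.e2 u k 0 ≠ 0 := by
    by_contra hcon
    push Not at hcon
    have := hR.detZ_sgn hk
    rw [e1_zero, e2_zero] at hcon
    simp [detZ, hcon.1, hcon.2] at this
  have casePos (hy : 0 < (R.sgn k : ℝ) * R.e2 u k 0) (hX : 0 ≤ R.sgn k * X) :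
      ∃ i t, 0 < R.sgn k * osgn i * R.ev u k i 0 ∧ 0 ≤ t ∧ X = t * R.ev u k i 0 ∧
      ∀ α' β' : ℝ, 0 ≤ α' → 0 ≤ β' → X = α' * R.e1 u k 0 + β' * R.e2 u k 0 → t ≤ α' + β' := by
    have hy0 := right_ne_zero_of_mul hy.ne'
    refine ⟨true, X / R.e2 u k 0, ?_, ?_, ?_, ?_⟩
    · simp only [osgn, ev, if_true, mul_one]; exact_mod_cast hy
    · rw [← mul_div_mul_left _ _ hs0]; positivity
    · simp only [ev, if_true]; field_simp
    · intro α' β' hα' hβ' hX'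
      rw [← mul_div_mul_left _ _ hs0, div_le_iff₀ hy, hX']
      have := mul_le_mul_of_nonneg_left h1 hα'
      linarith
  have caseNeg (hx : (R.sgn k : ℝ) * R.e1 u k 0 < 0) (hX : R.sgn k * X ≤ 0) :
      ∃ i t, 0 < R.sgn k * osgn i * R.ev u k i 0 ∧ 0 ≤ t ∧ X = t * R.ev u k i 0 ∧
      ∀ α' β' : ℝ, 0 ≤ α' → 0 ≤ β' → X = α' * R.e1 u k 0 + β' * R.e2 u k 0 → t ≤ α' + β' := by
    have hx0 := right_ne_zero_of_mul hx.ne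
    refine ⟨false, X / R.e1 u k 0, ?_, ?_, ?_, ?_⟩
    · simp only [osgn, ev, Bool.false_eq_true, if_false]
      have : R.sgn k * R.e1 u k 0 < 0 := by exact_mod_cast hx
      linarith
    · rw [← mul_div_mul_left _ _ hs0]; exact div_nonneg_of_nonpos hX hx.le
    · simp only [ev, Bool.false_eq_true, if_false]; field_simp
    · intro α' β' hα' hβ' hX'
      rw [← mul_div_mul_left _ _ hs0, div_le_iff_of_neg hx, hX']
      have := mul_le_mul_of_nonneg_left h1 hβ'
      linarith
  have hsX : R.sgn k * X = α * (R.sgn k * R.e1 u k 0) + β * (R.sgn k * R.e2 u k 0) := by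
    rw [h]; ring
  rcases lt_or_ge 0 ((R.sgn k : ℝ) * R.e2 u k 0) with hy | hy
  · rcases le_or_gt 0 (R.sgn k * X) with hX | hX
    · exact casePos hy hX
    · refine caseNeg ?_ hX.le
      by_contra hcon
      push Not at hcon
      have := mul_nonneg hα hcon
      have := mul_nonneg hβ hy.le
      linarith
  · have hx : (R.sgn k : ℝ) * R.e1 u k 0 < 0 := by
      rcases (h1.trans hy).eq_or_lt with h0 | h0
      · exfalso
        have h2 : (R.sgn k : ℝ) * R.e2 u k 0 = 0 := le_antisymm hy (h0 ▸ h1)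
        rcases hne with h3 | h3
        · exact h3 (by exact_mod_cast (mul_eq_zero.1 h0).resolve_left hs0)
        · exact h3 (by exact_mod_cast (mul_eq_zero.1 h2).resolve_left hs0)
      · exact h0
    refine caseNeg hx ?_
    have := mul_nonpos_of_nonneg_of_nonpos hα hx.le
    have := mul_nonpos_of_nonneg_of_nonpos hβ hy
    linarith

lemma ht_sub (u : Fin m → ℤ) (k : Fin d) {z w : Pt} (h : z 0 = w 0) :
    R.ht u k z = R.ht u k w + (w 1 - z 1) * (R.dir (k - 1) 0 + R.dir k 0 : ℝ) := by
  unfold ht crd1 crd2 relX relY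
  rw [h, e1_zero, e2_zero]
  push_cast
  ring

/-- Marked points lie outside the triangles satisfying the marked-point bound. -/
lemma IsValid.le_ht_c (hR : R.IsValid) (hg : IsCornerEnum R g) {lam : ℝ}
    (hlam : AlphaBound R g a lam) (hlen : ∀ i, lam ≤ R.legLen g i a) (j : Fin m) :
    lam ≤ R.ht (R.cf (g a)) (g a) (R.c j) := by
  have hk := isHDCorner_g hg a
  have hc : R.c j ∈ R.carrier := interior_subset (hR.marked_interior j)
  obtain ⟨h1, h2⟩ := hR.crd_nonneg hk (adm_cf _) hc
  obtain ⟨i, t, hi, ht0, hX, hmin⟩ := hR.exists_good hk h1 h2 (hR.relX_eq_crd hk _)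
  rcases lt_or_ge (R.legLen g i a) t with htl | htl
  · have := hmin _ _ h1 h2 (hR.relX_eq_crd hk _)
    unfold ht
    linarith [hlen i]
  obtain ⟨q, hq⟩ := R.exists_leg g i a ht0 htl
  have hqx := hq.relX_eq hR hg (R.cf (g a))
  have hqc : q 0 = R.c j 0 := by unfold relX at hqx hX; linarith
  have hb := hlam j q t (onEmanating_iff_leg.2 ⟨i, hq⟩) hqc fun q' t' hq' hqc' => by
    obtain ⟨i', hq'⟩ := onEmanating_iff_leg.1 hq'
    have hle := hq'.ht_le hR hg
    obtain ⟨h1', h2'⟩ := hR.crd_nonneg hk (adm_cf _) (hq'.mem_carrier hR)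
    refine (hmin _ _ h1' h2' ?_).trans hle
    rw [← hR.relX_eq_crd hk]; unfold relX; rw [hqc']
  have hext := hq.extremal hR hg (R.sgn_eq _) hi hc hqc.symm
  have hFq : R.ht (R.cf (g a)) (g a) q = t := by
    rw [ht_eq_mul_detZ hqx (hq.relY_eq hR hg (R.sgn_eq _) hi.le), cf, hR.detZ_sgn hk]
    simp
  rw [ht_sub _ _ hqc.symm, hFq]
  refine hb.trans (le_of_eq ?_)
  have hs := R.sgn_mul (g a)
  have hss : (R.sgn (g a) : ℝ) * R.sgn (g a) = 1 := by
    rcases R.sgn_eq (g a) with h | h <;> rw [h] <;> norm_num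
  have habs : |q 1 - R.c j 1| = R.sgn (g a) * (q 1 - R.c j 1) := by
    rw [← abs_of_nonneg (a := (R.sgn (g a) : ℝ) * (q 1 - R.c j 1)) (by linarith), abs_mul]
    rcases R.sgn_eq (g a) with h | h <;> rw [h] <;> norm_num
  rw [habs]
  push_cast
  rw [add_comm (R.dir (g a) 0 : ℝ), ← hs]
  linear_combination (q 1 - R.c j 1) * (R.dir (g a - 1) 0 + R.dir (g a) 0 : ℝ) * hss

end STRep

namespace STRep

variable {d m D : ℕ} [NeZero d] [NeZero D] {R : STRep d m} {g : Fin D → Fin d} {a : Fin D}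
  {u : Fin m → ℤ} {k : Fin d}

lemma relY_sub_eq_of_noCut {i : Bool} {q : Pt} {t : ℝ} (ht : 0 ≤ t)
    (hX : R.relX k q = t * R.ev u k i 0)
    (hcut : ∀ j, 0 ≤ (R.c j 0 - R.V k 0) * (R.c j 0 - (R.V k 0 + t * R.ev u k i 0))) :
    R.relY u k q - t * R.ev u k i 1 = q 1 - R.V k 1 - t * R.ev 0 k i 1 := by
  have hq : q 0 = R.V k 0 + t * R.ev u k i 0 := by unfold relX at hX; linarith
  have h1 : R.shift u (q 0) = _ := hq ▸ R.shift_add fun j _ => hcut j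
  have h0 : ∀ x v, R.slope (0 : Fin m → ℤ) x v = 0 := by intro x v; simp [slope]
  have h2 : t * (R.slope u (R.V k 0) (t * R.ev u k i 0) * R.ev u k i 0 : ℝ) =
      t * (R.slope u (R.V k 0) (R.ev u k i 0) * R.ev u k i 0) := by
    rcases ht.eq_or_lt with rfl | ht
    · simp
    rcases eq_or_ne (R.ev u k i 0) 0 with h | h
    · simp [h]
    · rw [slope_eq_of_mul_pos (v := t * R.ev u k i 0) (w := R.ev u k i 0)]
      have : (R.ev u k i 0 : ℝ) ≠ 0 := by exact_mod_cast h
      have := mul_self_pos.2 this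
      rw [mul_assoc]; positivity
  have h3 : (R.ev u k i 1 : ℝ) =
      R.ev 0 k i 1 + R.slope u (R.V k 0) (R.ev u k i 0) * R.ev u k i 0 := by
    cases i <;> simp [ev, h0]
    ring
  unfold relY
  rw [h1, h3]
  linear_combination h2

/-- Near a corner away from the marked points, the semitoric edges are straight in the
canonical representative. -/
lemma Leg.relY_eq_cf (hR : R.IsValid) (hg : IsCornerEnum R g) {i : Bool} {q : Pt} {t : ℝ}
    (h : R.Leg g i a q t) (hc : ∀ j, t ≤ R.ht (R.cf (g a)) (g a) (R.c j)) :
    R.relY (R.cf (g a)) (g a) q = t * R.ev (R.cf (g a)) (g a) i 1 := by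
  have hk := isHDCorner_g hg a
  rcases le_or_gt 0 (R.sgn (g a) * osgn i * R.ev (R.cf (g a)) (g a) i 0) with hi | hi
  · exact h.relY_eq hR hg (R.sgn_eq _) hi
  have h' : R.relY (R.flips (-R.sgn (g a))) (g a) q =
      t * R.ev (R.flips (-R.sgn (g a))) (g a) i 1 := by
    refine h.relY_eq hR hg ?_ ?_
    · rcases R.sgn_eq (g a) with h | h <;> simp [h]
    · rw [ev_zero_eq _ (R.cf (g a))]; linarith
  have hcut : ∀ j, 0 ≤ (R.c j 0 - R.V (g a) 0) *
      (R.c j 0 - (R.V (g a) 0 + t * R.ev (R.cf (g a)) (g a) i 0)) := by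
    intro j
    by_contra hcon
    push Not at hcon
    have hcj := interior_subset (hR.marked_interior j)
    obtain ⟨h1, h2⟩ := hR.crd_nonneg hk (adm_cf _) hcj
    have hX := hR.relX_eq_crd hk (R.c j)
    have he0 : (R.ev (R.cf (g a)) (g a) i 0 : ℝ) ≠ 0 := by
      have := right_ne_zero_of_mul hi.ne
      exact_mod_cast this
    have hτ : R.c j 0 - R.V (g a) 0 = (R.c j 0 - R.V (g a) 0) /
        R.ev (R.cf (g a)) (g a) i 0 * R.ev (R.cf (g a)) (g a) i 0 := by field_simp
    set τ := (R.c j 0 - R.V (g a) 0) / R.ev (R.cf (g a)) (g a) i 0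
    have hle := add_le_of_not_good h1 h2 hi (by rw [← hX, relX, hτ])
    have hlt : τ < t := by
      rw [sub_add_eq_sub_sub, hτ] at hcon
      have h3 := mul_self_pos.2 he0
      by_contra hcon'
      push Not at hcon'
      have := mul_nonneg (mul_nonneg ((h.nonneg hR).trans hcon') (sub_nonneg.2 hcon')) h3.le
      linarith
    have := hc j
    unfold ht at this
    linarith
  have ha := relY_sub_eq_of_noCut (h.nonneg hR) (h.relX_eq hR hg (R.cf (g a))) hcut
  have hb := relY_sub_eq_of_noCut (h.nonneg hR) (h.relX_eq hR hg (R.flips (-R.sgn (g a))))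
    (by rwa [ev_zero_eq _ (R.cf (g a))])
  linarith

/-- The size `lam` is small enough for a triangle at the corner `V (g a)`. -/
structure Fits (R : STRep d m) (g : Fin D → Fin d) (a : Fin D) (lam : ℝ) : Prop where
  le_ht_c : ∀ j, lam ≤ R.ht (R.cf (g a)) (g a) (R.c j)
  le_legLen : ∀ i, lam ≤ R.legLen g i a

omit [NeZero d] in
lemma ext_rel {z w : Pt} (h0 : R.relX k z = R.relX k w) (h1 : R.relY u k z = R.relY u k w) :
    z = w := by
  have h : z 0 = w 0 := by unfold relX at h0; linarith
  have h' : z 1 = w 1 := by unfold relY at h1; rw [h] at h1; linarith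
  ext l
  fin_cases l
  · exact h
  · exact h'

lemma Fits.mem_carrier (hR : R.IsValid) (hg : IsCornerEnum R g) {lam : ℝ}
    (hf : R.Fits g a lam) {v : Pt} (h1 : 0 ≤ R.crd1 (R.cf (g a)) (g a) v)
    (h2 : 0 ≤ R.crd2 (R.cf (g a)) (g a) v) (hv : R.ht (R.cf (g a)) (g a) v ≤ lam) :
    v ∈ R.carrier := by
  have hk := isHDCorner_g hg a
  have hX := hR.relX_eq_crd hk v
  have hY := hR.relY_eq_crd hk v
  have hF0 : 0 ≤ R.ht (R.cf (g a)) (g a) v := add_nonneg h1 h2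
  rcases hF0.eq_or_lt with hF | hF
  · have h1' : R.crd1 (R.cf (g a)) (g a) v = 0 := by unfold ht at hF; linarith
    have h2' : R.crd2 (R.cf (g a)) (g a) v = 0 := by unfold ht at hF; linarith
    rw [h1', h2'] at hX hY
    have : v = R.V (g a) := ext_rel (R := R) (u := R.cf (g a)) (k := g a)
      (by rw [hX]; simp [relX]) (by rw [hY]; simp [relY])
    exact this ▸ R.V_mem _
  · obtain ⟨q, hq⟩ := R.exists_leg g false a hF0 (hv.trans (hf.le_legLen _))
    obtain ⟨q', hq'⟩ := R.exists_leg g true a hF0 (hv.trans (hf.le_legLen _))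
    have hqx := hq.relX_eq hR hg (R.cf (g a))
    have hqy := hq.relY_eq_cf hR hg fun j => hv.trans (hf.le_ht_c j)
    have hqx' := hq'.relX_eq hR hg (R.cf (g a))
    have hqy' := hq'.relY_eq_cf hR hg fun j => hv.trans (hf.le_ht_c j)
    simp only [ev, if_true, Bool.false_eq_true, if_false] at hqx hqy hqx' hqy'
    set F := R.ht (R.cf (g a)) (g a) v with hFdef
    have hsum : R.crd1 (R.cf (g a)) (g a) v / F + R.crd2 (R.cf (g a)) (g a) v / F = 1 := by
      rw [← add_div, hFdef, ht, div_self]; exact hF.ne'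
    have e1 : R.crd1 (R.cf (g a)) (g a) v / F * F = R.crd1 (R.cf (g a)) (g a) v := by field_simp
    have e2 : R.crd2 (R.cf (g a)) (g a) v / F * F = R.crd2 (R.cf (g a)) (g a) v := by field_simp
    refine hR.shear_convex (adm_cf (g a)) (hq.mem_carrier hR) (hq'.mem_carrier hR)
      (div_nonneg h1 hF.le) (div_nonneg h2 hF.le) hsum ?_ ?_
    · rw [← e1, ← e2] at hX
      unfold relX at hX hqx hqx'
      linear_combination hX - R.crd1 (R.cf (g a)) (g a) v / F * hqx -
        R.crd2 (R.cf (g a)) (g a) v / F * hqx' - R.V (g a) 0 * hsum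
    · rw [← e1, ← e2] at hY
      unfold relY at hY hqy hqy'
      linear_combination hY - R.crd1 (R.cf (g a)) (g a) v / F * hqy -
        R.crd2 (R.cf (g a)) (g a) v / F * hqy' -
        (R.V (g a) 1 + R.shift (R.cf (g a)) (R.V (g a) 0)) * hsum

lemma OnEdge.point_unique (hR : R.IsValid) (hg : IsCornerEnum R g) {q q' : Pt} {t : ℝ}
    (h : R.OnEdge g a q t) (h' : R.OnEdge g a q' t) : q = q' := by
  have : ∃ s : ℤ, (s = 1 ∨ s = -1) ∧ 0 ≤ s * R.dir (g a) 0 := by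
    rcases le_total 0 (R.dir (g a) 0) with h | h
    · exact ⟨1, .inl rfl, by linarith⟩
    · exact ⟨-1, .inr rfl, by linarith⟩
  obtain ⟨s, hs, ha⟩ := this
  have h1 := h.rel_eq hR hg hs ha
  have h2 := h'.rel_eq hR hg hs ha
  exact ext_rel (h1.1.trans h2.1.symm) (h1.2.trans h2.2.symm)

lemma Leg.normalForm (hR : R.IsValid) (hg : IsCornerEnum R g) {i : Bool} {q : Pt} {t : ℝ}
    (h : R.Leg g i a q t) : ∃ b t', t' < stEdgeLen R g b ∧ R.OnEdge g b q t' ∧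
      ((b = a ∧ t' = t) ∨ (b = a - 1 ∧ t' = stEdgeLen R g (a - 1) - t ∧ 0 < t) ∨
        (b = a + 1 ∧ t' = 0 ∧ t = stEdgeLen R g a)) := by
  cases i
  · rcases (h.nonneg hR).eq_or_lt with ht | ht
    · subst ht
      have h1 : R.OnEdge g (a - 1) q (stEdgeLen R g (a - 1) - 0) := h
      have h2 := onEdge_end hR g (a - 1)
      rw [sub_zero] at h1
      rw [sub_add_cancel] at h2
      rw [h1.point_unique hR hg h2]
      exact ⟨a, 0, stEdgeLen_pos hR a, onEdge_start hR g a, .inl ⟨rfl, rfl⟩⟩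
    · exact ⟨a - 1, _, by linarith, h, .inr (.inl ⟨rfl, rfl, ht⟩)⟩
  · rcases (h.le_legLen hR).eq_or_lt with ht | ht
    · simp only [legLen, if_true] at ht
      subst ht
      rw [OnEdge.point_unique hR hg h (onEdge_end hR g a)]
      exact ⟨a + 1, 0, stEdgeLen_pos hR _, onEdge_start hR g _, .inr (.inr ⟨rfl, rfl, rfl⟩)⟩
    · exact ⟨a, t, ht, h, .inl ⟨rfl, rfl⟩⟩

/-- Initial segments of semitoric edges at distinct corners do not meet. -/
lemma Leg.disjoint (hR : R.IsValid) (hg : IsCornerEnum R g) (hinj : Function.Injective R.V)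
    {sz : Fin D → ℝ} (hsz : ∀ a, 0 ≤ sz a) (hsz' : ∀ a, sz a + sz (a + 1) ≤ stEdgeLen R g a)
    {b : Fin D} (hab : a ≠ b) {i i' : Bool} {q : Pt} {t t' : ℝ} (h : R.Leg g i a q t)
    (h' : R.Leg g i' b q t') (ht : t < sz a) (ht' : t' ≤ sz b) : False := by
  obtain ⟨c, r, hr, hc, h1⟩ := h.normalForm hR hg
  obtain ⟨c', r', hr', hc', h2⟩ := h'.normalForm hR hg
  obtain ⟨rfl, rfl⟩ := hc.inj hR hg hinj hc' hr hr'
  have ha := hsz' a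
  have hb := hsz' b
  have ha' := hsz' (a - 1)
  have hb' := hsz' (b - 1)
  rw [sub_add_cancel] at ha' hb'
  have h3 := hsz (a + 1)
  have h4 := hsz (a - 1)
  have h5 := hsz (b - 1)
  have h6 := h.nonneg hR
  rcases h1 with ⟨rfl, rfl⟩ | ⟨rfl, rfl, h1⟩ | ⟨rfl, rfl, h1⟩
  · rcases h2 with ⟨rfl, -⟩ | ⟨rfl, h2, -⟩ | ⟨rfl, h2, h7⟩
    · exact hab rfl
    · linarith
    · linarith
  · rcases h2 with ⟨rfl, h2⟩ | ⟨h2, -⟩ | ⟨h2, h7, -⟩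
    · linarith
    · exact hab (sub_left_injective h2)
    · linarith
  · linarith

end STRep

namespace STRep

variable {d m D : ℕ} [NeZero d] [NeZero D] {R : STRep d m} {g : Fin D → Fin d} {a : Fin D}
  {u : Fin m → ℤ} {k : Fin d}

omit [NeZero d] in
lemma continuous_relY : Continuous (R.relY u k) := by
  have := (R.continuous_shift (u := u)).comp (continuous_apply (A := fun _ : Fin 2 => ℝ) 0)
  exact ((continuous_apply 1).add this).sub continuous_const

omit [NeZero d] in
lemma continuous_crd1 : Continuous (R.crd1 u k) :=
  (((continuous_apply 0).sub continuous_const).mul continuous_const).sub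
    (continuous_relY.mul continuous_const)

lemma continuous_crd2 : Continuous (R.crd2 u k) :=
  (continuous_const.mul continuous_relY).sub
    (continuous_const.mul ((continuous_apply 0).sub continuous_const))

lemma continuous_ht : Continuous (R.ht u k) := continuous_crd1.add continuous_crd2

lemma Fits.leg_of_frontier (hR : R.IsValid) (hg : IsCornerEnum R g) {lam : ℝ}
    (hf : R.Fits g a lam) {w : Pt} (hw : w ∈ frontier R.carrier)
    (hlt : R.ht (R.cf (g a)) (g a) w < lam) :
    ∃ i, R.Leg g i a w (R.ht (R.cf (g a)) (g a) w) := by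
  have hk := isHDCorner_g hg a
  obtain ⟨h1, h2⟩ := hR.crd_nonneg hk (adm_cf (g a)) (R.carrier_isClosed.frontier_subset hw)
  have hX := hR.relX_eq_crd hk w
  have hY := hR.relY_eq_crd hk w
  have key : ∀ i, R.relX (g a) w = R.ht (R.cf (g a)) (g a) w * R.ev (R.cf (g a)) (g a) i 0 →
      R.relY (R.cf (g a)) (g a) w = R.ht (R.cf (g a)) (g a) w * R.ev (R.cf (g a)) (g a) i 1 →
      R.Leg g i a w (R.ht (R.cf (g a)) (g a) w) := by
    intro i hx hy
    obtain ⟨q, hq⟩ := R.exists_leg g i a (add_nonneg h1 h2) (hlt.le.trans (hf.le_legLen i))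
    have : w = q := ext_rel (R := R) (u := R.cf (g a)) (k := g a)
      (hx.trans (hq.relX_eq hR hg _).symm)
      (hy.trans (hq.relY_eq_cf hR hg fun j => hlt.le.trans (hf.le_ht_c j)).symm)
    rw [this]
    rw [this] at hq
    exact hq
  rcases h1.eq_or_lt with h1 | h1
  · refine ⟨true, key true ?_ ?_⟩
    · rw [hX, ht, ← h1]; simp [ev]
    · rw [hY, ht, ← h1]; simp [ev]
  rcases h2.eq_or_lt with h2 | h2
  · refine ⟨false, key false ?_ ?_⟩
    · rw [hX, ht, ← h2]; simp [ev]
    · rw [hY, ht, ← h2]; simp [ev]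
  exfalso
  have hopen : IsOpen ({z | 0 < R.crd1 (R.cf (g a)) (g a) z} ∩
      ({z | 0 < R.crd2 (R.cf (g a)) (g a) z} ∩ {z | R.ht (R.cf (g a)) (g a) z < lam})) :=
    (isOpen_lt continuous_const continuous_crd1).inter
      ((isOpen_lt continuous_const continuous_crd2).inter
        (isOpen_lt continuous_ht continuous_const))
  exact hw.2 (interior_maximal
    (fun z hz => hf.mem_carrier hR hg hz.1.le hz.2.1.le (le_of_lt hz.2.2)) hopen ⟨h1, h2, hlt⟩)

omit [NeZero d] in
lemma shift_flips_sub (heps : ∀ j, R.eps j = 1 ∨ R.eps j = -1) {s s' : ℤ}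
    (hs : s = 1 ∨ s = -1) (hs' : s' = 1 ∨ s' = -1) (x : ℝ) :
    R.shift (R.flips s) x - R.shift (R.flips s') x =
      (s - s') / 2 * ∑ j, max (x - R.c j 0) 0 := by
  unfold shift
  rw [← Finset.sum_sub_distrib, Finset.mul_sum]
  refine Finset.sum_congr rfl fun j _ => ?_
  rw [← sub_mul]
  congr 1
  unfold flips
  rcases hs with rfl | rfl <;> rcases hs' with rfl | rfl <;> rcases heps j with h | h <;>
    rw [h] <;> norm_num

omit [NeZero d] in
lemma sum_max_le {α β γ x y w z : ℝ} (hα : 0 ≤ α) (hβ : 0 ≤ β) (hγ : 0 ≤ γ)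
    (hsum : α + β + γ = 1) (hz : z = α * x + β * y + γ * w) :
    ∑ j, max (z - R.c j 0) 0 ≤ α * ∑ j, max (x - R.c j 0) 0 + β * ∑ j, max (y - R.c j 0) 0 +
      γ * ∑ j, max (w - R.c j 0) 0 := by
  rw [Finset.mul_sum, Finset.mul_sum, Finset.mul_sum, ← Finset.sum_add_distrib,
    ← Finset.sum_add_distrib]
  refine Finset.sum_le_sum fun j _ => max_le ?_ (by positivity)
  have h1 := mul_le_mul_of_nonneg_left (le_max_left (x - R.c j 0) 0) hα
  have h2 := mul_le_mul_of_nonneg_left (le_max_left (y - R.c j 0) 0) hβ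
  have h3 := mul_le_mul_of_nonneg_left (le_max_left (w - R.c j 0) 0) hγ
  have : z - R.c j 0 = α * (x - R.c j 0) + β * (y - R.c j 0) + γ * (w - R.c j 0) := by
    rw [hz]; linear_combination R.c j 0 * hsum
  linarith

/-- The canonical height at a corner is concave in every canonical representative. -/
lemma ht_concave (heps : ∀ j, R.eps j = 1 ∨ R.eps j = -1) {s : ℤ} (hs : s = 1 ∨ s = -1)
    {α β γ : ℝ} {x y w z : Pt} (hα : 0 ≤ α) (hβ : 0 ≤ β) (hγ : 0 ≤ γ)
    (hsum : α + β + γ = 1) (h0 : z 0 = α * x 0 + β * y 0 + γ * w 0)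
    (h1 : z 1 + R.shift (R.flips s) (z 0) = α * (x 1 + R.shift (R.flips s) (x 0)) +
      β * (y 1 + R.shift (R.flips s) (y 0)) + γ * (w 1 + R.shift (R.flips s) (w 0))) :
    α * R.ht (R.cf k) k x + β * R.ht (R.cf k) k y + γ * R.ht (R.cf k) k w ≤
      R.ht (R.cf k) k z := by
  have hM := R.sum_max_le hα hβ hγ hsum h0
  have hN : ((R.dir (k - 1) 0 : ℝ) + R.dir k 0) * (R.sgn k - s) ≥ 0 := by
    rw [mul_sub, mul_comm, sgn_mul]
    have := neg_abs_le (R.dir (k - 1) 0 + R.dir k 0 : ℝ)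
    have := le_abs_self (R.dir (k - 1) 0 + R.dir k 0 : ℝ)
    rcases hs with rfl | rfl <;> push_cast <;> linarith
  have hkey := mul_nonneg hN (sub_nonneg.2 hM)
  have key : ∀ v : Pt, R.ht (R.cf k) k v = (v 0 - R.V k 0) * (R.e2 (R.cf k) k 1 - R.e1 (R.cf k) k 1) -
      ((R.dir (k - 1) 0 : ℝ) + R.dir k 0) * (v 1 + R.shift (R.flips s) (v 0) +
        (R.sgn k - s) / 2 * (∑ j, max (v 0 - R.c j 0) 0) -
        (R.V k 1 + R.shift (R.cf k) (R.V k 0))) := by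
    intro v
    have := shift_flips_sub heps (R.sgn_eq k) hs (v 0)
    unfold ht crd1 crd2 relX relY cf at *
    rw [← this, e1_zero, e2_zero]
    push_cast
    ring
  rw [key x, key y, key w, key z, h1]
  linear_combination 1 / 2 * hkey - (R.e2 (R.cf k) k 1 - R.e1 (R.cf k) k 1 : ℝ) * h0 +
    (-R.V k 0 * (R.e2 (R.cf k) k 1 - R.e1 (R.cf k) k 1 : ℝ) +
     ((R.dir (k - 1) 0 : ℝ) + R.dir k 0) * (R.V k 1 + R.shift (R.cf k) (R.V k 0))) * hsum

/-- The canonical triangle of size `lam` at the corner `V (g a)`. -/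
def cornerTri (R : STRep d m) (g : Fin D → Fin d) (a : Fin D) (lam : ℝ) : Set Pt :=
  {z | z ∈ R.carrier ∧ R.ht (R.cf (g a)) (g a) z < lam}

lemma cornerTri_disjoint (hR : R.IsValid) (hg : IsCornerEnum R g)
    (hinj : Function.Injective R.V) {sz : Fin D → ℝ} (hsz : ∀ a, 0 ≤ sz a)
    (hsz' : ∀ a, sz a + sz (a + 1) ≤ stEdgeLen R g a) (hf : ∀ a, R.Fits g a (sz a))
    {b : Fin D} (hab : a ≠ b) :
    Disjoint (R.cornerTri g a (sz a)) (R.cornerTri g b (sz b)) := by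
  rw [Set.disjoint_left]
  rintro z ⟨hz, hza⟩ ⟨-, hzb⟩
  have hk := isHDCorner_g hg b
  obtain ⟨h1, h2⟩ := hR.crd_nonneg hk (adm_cf (g b)) hz
  have hb : 0 < sz b := (add_nonneg h1 h2).trans_lt hzb
  have hle : ∀ i q t, R.Leg g i b q t → t ≤ sz b → sz a ≤ R.ht (R.cf (g a)) (g a) q := by
    intro i q t hq ht
    by_contra hcon
    push Not at hcon
    have hqf : q ∈ frontier R.carrier := by
      cases i
      · exact OnEdge.mem_frontier hR hq
      · exact OnEdge.mem_frontier hR hq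
    obtain ⟨i', hq'⟩ := (hf a).leg_of_frontier hR hg hqf hcon
    exact hq'.disjoint hR hg hinj hsz hsz' hab hq hcon ht
  obtain ⟨x, hx⟩ := R.exists_leg g false b hb.le ((hf b).le_legLen _)
  obtain ⟨y, hy⟩ := R.exists_leg g true b hb.le ((hf b).le_legLen _)
  have hp := hle true (R.V (g b)) 0 (onEdge_start hR g b) hb.le
  have hxa := hle _ _ _ hx le_rfl
  have hya := hle _ _ _ hy le_rfl
  have hX := hR.relX_eq_crd hk z
  have hY := hR.relY_eq_crd hk z
  have hxx := hx.relX_eq hR hg (R.cf (g b))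
  have hxy := hx.relY_eq_cf hR hg (hf b).le_ht_c
  have hyx := hy.relX_eq hR hg (R.cf (g b))
  have hyy := hy.relY_eq_cf hR hg (hf b).le_ht_c
  simp only [ev, if_true, Bool.false_eq_true, if_false] at hxx hxy hyx hyy
  unfold ht at hzb
  set c1 := R.crd1 (R.cf (g b)) (g b) z
  set c2 := R.crd2 (R.cf (g b)) (g b) z
  set L := sz b
  have e1 : c1 / L * L = c1 := by field_simp
  have e2 : c2 / L * L = c2 := by field_simp
  have hα : 0 ≤ 1 - c1 / L - c2 / L := by
    rw [sub_sub, ← add_div, sub_nonneg, div_le_one hb]; exact hzb.le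
  have hβ := div_nonneg h1 hb.le
  have hγ := div_nonneg h2 hb.le
  rw [← e1, ← e2] at hX hY
  have := R.ht_concave (k := g a) hR.eps_pm (R.sgn_eq (g b)) hα hβ hγ
    (x := R.V (g b)) (y := x) (w := y) (z := z) (by ring) (by
      unfold relX at hX hxx hyx
      linear_combination hX - c1 / L * hxx - c2 / L * hyx) (by
      unfold relY cf at hY hxy hyy
      linear_combination hY - c1 / L * hxy - c2 / L * hyy)
  have i1 := mul_le_mul_of_nonneg_left hp hα
  have i2 := mul_le_mul_of_nonneg_left hxa hβ
  have i3 := mul_le_mul_of_nonneg_left hya hγ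
  linarith

end STRep

namespace STRep

variable {d m D : ℕ} [NeZero d] [NeZero D] {R : STRep d m} {g : Fin D → Fin d} {a : Fin D}
  {u : Fin m → ℤ} {k : Fin d}

omit [NeZero d] in
lemma exists_rel (R : STRep d m) (u : Fin m → ℤ) (k : Fin d) (X Y : ℝ) :
    ∃ z, R.relX k z = X ∧ R.relY u k z = Y :=
  ⟨![R.V k 0 + X, Y + (R.V k 1 + R.shift u (R.V k 0)) - R.shift u (R.V k 0 + X)],
    by simp [relX], by simp [relY]⟩

lemma sl2Apply_zero (M : SpecialLinearGroup (Fin 2) ℤ) (x : Pt) :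
    sl2Apply M x 0 = M.1 0 0 * x 0 + M.1 0 1 * x 1 := by
  simp [sl2Apply, Matrix.mulVec, dotProduct, Fin.sum_univ_two]

lemma sl2Apply_one (M : SpecialLinearGroup (Fin 2) ℤ) (x : Pt) :
    sl2Apply M x 1 = M.1 1 0 * x 0 + M.1 1 1 * x 1 := by
  simp [sl2Apply, Matrix.mulVec, dotProduct, Fin.sum_univ_two]

omit [NeZero d] in
lemma stMap_zero (n : ℤ) (t : ℝ) (z : Pt) : stMap R.c n t u z 0 = z 0 := rfl

omit [NeZero d] in
lemma stMap_one (n : ℤ) (t : ℝ) (z : Pt) :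
    stMap R.c n t u z 1 = z 1 + n * z 0 + t + R.shift u (z 0) := rfl

/-- The matrix with columns the primitive vectors at `V k` in the canonical representative. -/
noncomputable def IsValid.cornerMatrix (hR : R.IsValid) (hk : R.IsHDCorner k) :
    SpecialLinearGroup (Fin 2) ℤ :=
  ⟨!![R.e1 (R.cf k) k 0, R.e2 (R.cf k) k 0; R.e1 (R.cf k) k 1, R.e2 (R.cf k) k 1], by
    rw [det_fin_two_of, ← hR.detZ_sgn hk]; unfold detZ cf; ring⟩

lemma IsValid.cornerTri_image (hR : R.IsValid) (hg : IsCornerEnum R g) {lam : ℝ}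
    (hf : R.Fits g a lam) :
    stMap R.c 0 0 (R.cf (g a)) '' R.cornerTri g a lam =
      (fun x => sl2Apply (hR.cornerMatrix (isHDCorner_g hg a)) x +
        stMap R.c 0 0 (R.cf (g a)) (R.V (g a))) '' modelTriangle lam := by
  have hk := isHDCorner_g hg a
  have hdet : (R.e1 (R.cf (g a)) (g a) 0 : ℝ) * R.e2 (R.cf (g a)) (g a) 1 -
      R.e1 (R.cf (g a)) (g a) 1 * R.e2 (R.cf (g a)) (g a) 0 = 1 := by
    exact_mod_cast hR.detZ_sgn hk
  have key : ∀ x z : Pt, R.relX (g a) z = x 0 * R.e1 (R.cf (g a)) (g a) 0 +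
      x 1 * R.e2 (R.cf (g a)) (g a) 0 → R.relY (R.cf (g a)) (g a) z =
      x 0 * R.e1 (R.cf (g a)) (g a) 1 + x 1 * R.e2 (R.cf (g a)) (g a) 1 →
      sl2Apply (hR.cornerMatrix hk) x + stMap R.c 0 0 (R.cf (g a)) (R.V (g a)) =
        stMap R.c 0 0 (R.cf (g a)) z := by
    intro x z hX hY
    unfold relX at hX
    unfold relY at hY
    have hx : sl2Apply (hR.cornerMatrix hk) x 0 = R.e1 (R.cf (g a)) (g a) 0 * x 0 +
      R.e2 (R.cf (g a)) (g a) 0 * x 1 := sl2Apply_zero _ x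
    have hy : sl2Apply (hR.cornerMatrix hk) x 1 = R.e1 (R.cf (g a)) (g a) 1 * x 0 +
      R.e2 (R.cf (g a)) (g a) 1 * x 1 := sl2Apply_one _ x
    ext l
    fin_cases l
    · simp only [Fin.zero_eta, Pi.add_apply, stMap_zero]
      linarith
    · simp only [Fin.mk_one, Pi.add_apply, stMap_one, Int.cast_zero, zero_mul, add_zero]
      linarith
  ext w
  constructor
  · rintro ⟨z, ⟨hz, hlt⟩, rfl⟩
    obtain ⟨h1, h2⟩ := hR.crd_nonneg hk (adm_cf (g a)) hz
    refine ⟨![R.crd1 (R.cf (g a)) (g a) z, R.crd2 (R.cf (g a)) (g a) z], ?_, ?_⟩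
    · exact ⟨h1, h2, hlt⟩
    · exact key _ _ (hR.relX_eq_crd hk z) (hR.relY_eq_crd hk z)
  · rintro ⟨x, ⟨h1, h2, hlt⟩, rfl⟩
    obtain ⟨z, hX, hY⟩ := R.exists_rel (R.cf (g a)) (g a)
      (x 0 * R.e1 (R.cf (g a)) (g a) 0 + x 1 * R.e2 (R.cf (g a)) (g a) 0)
      (x 0 * R.e1 (R.cf (g a)) (g a) 1 + x 1 * R.e2 (R.cf (g a)) (g a) 1)
    have c1 : R.crd1 (R.cf (g a)) (g a) z = x 0 := by
      unfold crd1; rw [hX, hY]; linear_combination x 0 * hdet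
    have c2 : R.crd2 (R.cf (g a)) (g a) z = x 1 := by
      unfold crd2; rw [hX, hY]; linear_combination x 1 * hdet
    have hF : R.ht (R.cf (g a)) (g a) z < lam := by rw [ht, c1, c2]; exact hlt
    exact ⟨z, ⟨hf.mem_carrier hR hg (c1 ▸ h1) (c2 ▸ h2) hF.le, hF⟩, (key x z hX hY).symm⟩

lemma isSTPackedTriangle_cornerTri (hR : R.IsValid) (hg : IsCornerEnum R g) {lam : ℝ}
    (hf : R.Fits g a lam) (hlam : 0 < lam) :
    IsSTPackedTriangle R (R.V (g a)) lam (R.cornerTri g a lam) := by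
  refine ⟨hlam, fun z hz => hz.1, fun j hj => (hf.le_ht_c j).not_gt hj.2, 0, 0, R.cf (g a),
    adm_cf _, ⟨_, hR.cornerTri_image hg hf⟩, ?_⟩
  set A : ℝ := R.e2 (R.cf (g a)) (g a) 1 - R.e1 (R.cf (g a)) (g a) 1
  set B : ℝ := R.e1 (R.cf (g a)) (g a) 0 - R.e2 (R.cf (g a)) (g a) 0
  set p := stMap R.c 0 0 (R.cf (g a)) (R.V (g a))
  have key : ∀ z, R.ht (R.cf (g a)) (g a) z =
      (stMap R.c 0 0 (R.cf (g a)) z 0 - p 0) * A + (stMap R.c 0 0 (R.cf (g a)) z 1 - p 1) * B := by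
    intro z
    simp only [p, stMap_zero, stMap_one, ht, crd1, crd2, relX, relY, A, B]
    push_cast
    ring
  refine ⟨{w | (w 0 - p 0) * A + (w 1 - p 1) * B < lam}, ?_, by simpa using hlam, ?_⟩
  · exact isOpen_lt (by fun_prop) continuous_const
  · ext w
    constructor
    · rintro ⟨⟨z, hz, rfl⟩, hw⟩
      exact ⟨⟨z, hz.1, rfl⟩, hw⟩
    · rintro ⟨⟨z, hz, rfl⟩, hw⟩
      exact ⟨⟨z, ⟨hz, (key z).trans_lt hw⟩, rfl⟩, hw⟩

end STRep

namespace STRep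

variable {d m D : ℕ} [NeZero d] [NeZero D] {R : STRep d m} {g : Fin D → Fin d} {a : Fin D}
  {u : Fin m → ℤ} {k : Fin d}

omit [NeZero d] in
lemma continuous_stMap (n : ℤ) (t : ℝ) : Continuous (stMap R.c n t u) := by
  have := (R.continuous_shift (u := u)).comp (continuous_apply (A := fun _ : Fin 2 => ℝ) 0)
  refine continuous_pi fun l => ?_
  fin_cases l
  · exact continuous_apply 0
  · exact (((continuous_apply 1).add (continuous_const.mul (continuous_apply 0))).add
      continuous_const).add this

omit [NeZero d] in
lemma stMap_injective (n : ℤ) (t : ℝ) : Function.Injective (stMap R.c n t u) := by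
  intro z w h
  have h0 : z 0 = w 0 := congrFun h 0
  have h1 := congrFun h 1
  rw [stMap_one, stMap_one, h0] at h1
  ext l
  fin_cases l
  · exact h0
  · exact by simpa using h1

omit [NeZero d] in
/-- An admissibly packed triangle in coordinates centred at its corner. -/
lemma _root_.IsSTPackedTriangle.exists_coords {lam : ℝ} {B : Set Pt}
    (h : IsSTPackedTriangle R (R.V k) lam B) :
    ∃ u, R.Adm u ∧ ∃ m1 m2 : Fin 2 → ℤ, detZ m1 m2 = 1 ∧
      (∀ z, z ∈ B ↔ ∃ x y : ℝ, 0 ≤ x ∧ 0 ≤ y ∧ x + y < lam ∧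
        R.relX k z = x * m1 0 + y * m2 0 ∧ R.relY u k z = x * m1 1 + y * m2 1) ∧
      ∀ᶠ z in nhds (R.V k), z ∈ R.carrier → z ∈ B := by
  obtain ⟨hlam, hB, hc, n, t, u, hu, ⟨M, hM⟩, U, hU, hpU, hUeq⟩ := h
  refine ⟨u, hu, ![M.1 0 0, M.1 1 0 - n * M.1 0 0], ![M.1 0 1, M.1 1 1 - n * M.1 0 1],
    ?_, ?_, ?_⟩
  · have := M.2
    rw [det_fin_two] at this
    simp only [detZ, cons_val_zero, cons_val_one, cons_val_fin_one]
    linarith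
  · intro z
    have key : ∀ x : Pt, sl2Apply M x + stMap R.c n t u (R.V k) = stMap R.c n t u z ↔
        R.relX k z = x 0 * M.1 0 0 + x 1 * M.1 0 1 ∧
        R.relY u k z = x 0 * (M.1 1 0 - n * M.1 0 0) + x 1 * (M.1 1 1 - n * M.1 0 1) := by
      intro x
      constructor
      · intro hx
        have h0 := congrFun hx 0
        have h1 := congrFun hx 1
        rw [Pi.add_apply, sl2Apply_zero, stMap_zero, stMap_zero] at h0
        rw [Pi.add_apply, sl2Apply_one, stMap_one, stMap_one] at h1
        unfold relX relY
        constructor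
        · linarith
        · linear_combination (-h1) + n * h0
      · rintro ⟨h0, h1⟩
        unfold relX at h0
        unfold relY at h1
        ext l
        fin_cases l
        · simp only [Fin.zero_eta]
          rw [Pi.add_apply, sl2Apply_zero, stMap_zero, stMap_zero]
          linarith
        · simp only [Fin.mk_one]
          rw [Pi.add_apply, sl2Apply_one, stMap_one, stMap_one]
          linear_combination (-h1) - n * h0
    have hzB : z ∈ B ↔ stMap R.c n t u z ∈ stMap R.c n t u '' B :=
      ((stMap_injective n t).mem_set_image).symm
    rw [hzB, hM]
    constructor
    · rintro ⟨x, ⟨h1, h2, h3⟩, hx⟩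
      obtain ⟨hX, hY⟩ := (key x).1 hx
      exact ⟨x 0, x 1, h1, h2, h3, by simpa using hX, by simpa using hY⟩
    · rintro ⟨x, y, h1, h2, h3, hX, hY⟩
      exact ⟨![x, y], ⟨h1, h2, h3⟩, (key _).2 ⟨by simpa using hX, by simpa using hY⟩⟩
  · have := (continuous_stMap (R := R) (u := u) n t).continuousAt.preimage_mem_nhds
      (hU.mem_nhds hpU)
    filter_upwards [this] with z hz hzR
    have : stMap R.c n t u z ∈ stMap R.c n t u '' B ∩ U := by
      rw [hUeq]; exact ⟨⟨z, hzR, rfl⟩, hz⟩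
    exact (stMap_injective n t).mem_set_image.1 this.1

lemma ev_zero_flips_one_true : R.ev 0 k true 1 = R.dir k 1 := by
  simp [ev, slope]

lemma ev_zero_flips_one_false : R.ev 0 k false 1 = -R.dir (k - 1) 1 := by
  simp [ev, slope]

/-- The polygon contains a small initial segment of each edge at a vertex. -/
lemma IsValid.exists_near (hR : R.IsValid) (u : Fin m → ℤ) (k : Fin d) (i : Bool)
    {W : Set Pt} (hW : W ∈ nhds (R.V k)) :
    ∃ z ∈ W, z ∈ R.carrier ∧ ∃ r > 0, R.relX k z = r * R.ev u k i 0 ∧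
      R.relY u k z = r * R.ev u k i 1 := by
  obtain ⟨ε, hε, hcut⟩ := R.eventually_between (R.V k 0)
  set v : Pt := ![R.ev u k i 0, R.ev 0 k i 1]
  have hcont : Continuous fun r : ℝ => R.V k + r • v := by fun_prop
  have h1 : ∀ᶠ r : ℝ in nhds 0, R.V k + r • v ∈ W := by
    refine hcont.continuousAt.preimage_mem_nhds ?_
    simpa using hW
  have h2 : ∀ᶠ r : ℝ in nhds 0, |r * R.ev u k i 0| < ε := by
    have : Continuous fun r : ℝ => |r * R.ev u k i 0| := by fun_prop
    exact this.continuousAt.eventually_lt continuousAt_const (by simpa using hε)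
  have hl : ∃ L > (0 : ℝ), ∀ r : ℝ, 0 ≤ r → r ≤ L → R.V k + r • v ∈ R.carrier := by
    cases i
    · refine ⟨R.len (k - 1), hR.len_pos _, fun r h0 h1 => R.carrier_isClosed.frontier_subset
        (hR.edge_mem_frontier (i := k - 1) (s := R.len (k - 1) - r) (by linarith) (by linarith)
          fun l => ?_)⟩
      have := hR.V_pred k l
      fin_cases l
      · simp [v, ev] at this ⊢; linarith
      · simp [v, ev_zero_flips_one_false] at this ⊢; linarith
    · refine ⟨R.len k, hR.len_pos _, fun r h0 h1 => R.carrier_isClosed.frontier_subset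
        (hR.edge_mem_frontier h0 h1 fun l => ?_)⟩
      fin_cases l
      · simp [v, ev]
      · simp [v, ev_zero_flips_one_true]
  obtain ⟨L, hL, hmem⟩ := hl
  have h3 : ∀ᶠ r : ℝ in nhds 0, r < L := gt_mem_nhds hL
  obtain ⟨r, ⟨hr1, hr2, hr3⟩, hr0⟩ := ((h1.and (h2.and h3)).filter_mono
    (nhdsWithin_le_nhds (s := Ioi 0)) |>.and self_mem_nhdsWithin).exists
  have hr0 : 0 < r := hr0
  have hX : R.relX k (R.V k + r • v) = r * R.ev u k i 0 := by simp [relX, v]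
  refine ⟨_, hr1, hmem r hr0.le hr3.le, r, hr0, hX, ?_⟩
  have := relY_sub_eq_of_noCut hr0.le hX (hcut _ hr2)
  have h4 : (R.V k + r • v) 1 - R.V k 1 - r * R.ev 0 k i 1 = 0 := by simp [v]
  linarith

omit [NeZero d] in
lemma crd1_eq {z : Pt} {x : ℝ} {v : Fin 2 → ℤ} (hX : R.relX k z = x * v 0)
    (hY : R.relY u k z = x * v 1) : R.crd1 u k z = x * detZ v (R.e2 u k) := by
  unfold crd1 detZ; rw [hX, hY]; push_cast; ring

lemma crd2_eq {z : Pt} {x : ℝ} {v : Fin 2 → ℤ} (hX : R.relX k z = x * v 0)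
    (hY : R.relY u k z = x * v 1) : R.crd2 u k z = x * detZ (R.e1 u k) v := by
  unfold crd2 detZ; rw [hX, hY]; push_cast; ring

lemma IsValid.eq_one_of_dvd_ev (hR : R.IsValid) (u : Fin m → ℤ) (k : Fin d) (i : Bool) {n : ℤ}
    (hn : 0 ≤ n) (h0 : n ∣ R.ev u k i 0) (h1 : n ∣ R.ev u k i 1) : n = 1 := by
  obtain ⟨l, hl0, hl1⟩ : ∃ l, n ∣ R.dir l 0 ∧ n ∣ R.dir l 1 := by
    cases i
    · simp only [ev, Bool.false_eq_true, if_false, e1_zero, e1_one] at h0 h1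
      rw [dvd_neg] at h0
      refine ⟨k - 1, h0, ?_⟩
      have := (dvd_sub_left (h0.mul_left _)).1 h1
      rwa [dvd_neg] at this
    · simp only [ev, if_true, e2_zero, e2_one] at h0 h1
      exact ⟨k, h0, (dvd_add_left (h0.mul_left _)).1 h1⟩
  have := Int.dvd_coe_gcd hl0 hl1
  rw [hR.primitive l] at this
  exact Int.eq_one_of_dvd_one hn this

/-- The sides of an admissibly packed triangle are the edges at its corner. -/
lemma IsValid.eq_e_of_cone (hR : R.IsValid) (hk : R.IsHDCorner k) (hu : R.Adm u) {lam : ℝ}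
    (hlam : 0 < lam) {B : Set Pt} (hB : B ⊆ R.carrier) {m1 m2 : Fin 2 → ℤ}
    (hdet : detZ m1 m2 = 1)
    (hmem : ∀ z, z ∈ B ↔ ∃ x y : ℝ, 0 ≤ x ∧ 0 ≤ y ∧ x + y < lam ∧
        R.relX k z = x * m1 0 + y * m2 0 ∧ R.relY u k z = x * m1 1 + y * m2 1)
    (hnear : ∀ᶠ z in nhds (R.V k), z ∈ R.carrier → z ∈ B) :
    m1 = R.e1 u k ∧ m2 = R.e2 u k := by
  have hmpos : ∀ v, v = m1 ∨ v = m2 → 0 ≤ detZ v (R.e2 u k) ∧ 0 ≤ detZ (R.e1 u k) v := by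
    intro v hv
    obtain ⟨z, hX, hY⟩ := R.exists_rel u k (lam / 2 * v 0) (lam / 2 * v 1)
    have hz : z ∈ B := by
      rw [hmem]
      rcases hv with rfl | rfl
      · exact ⟨lam / 2, 0, by linarith, le_rfl, by linarith, by linarith, by linarith⟩
      · exact ⟨0, lam / 2, le_rfl, by linarith, by linarith, by linarith, by linarith⟩
    obtain ⟨h1, h2⟩ := hR.crd_nonneg hk hu (hB hz)
    rw [crd1_eq hX hY] at h1
    rw [crd2_eq hX hY] at h2
    exact ⟨by exact_mod_cast nonneg_of_mul_nonneg_right h1 (half_pos hlam),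
      by exact_mod_cast nonneg_of_mul_nonneg_right h2 (half_pos hlam)⟩
  have hepos : ∀ i, 0 ≤ detZ m1 (R.ev u k i) ∧ 0 ≤ detZ (R.ev u k i) m2 := by
    intro i
    obtain ⟨z, hzB, hz, r, hr, hX, hY⟩ := hR.exists_near u k i hnear
    obtain ⟨x, y, hx, hy, -, hX', hY'⟩ := (hmem z).1 (hzB hz)
    have hdet' : (m1 0 : ℝ) * m2 1 - m1 1 * m2 0 = 1 := by exact_mod_cast hdet
    have e1 : r * (detZ m1 (R.ev u k i) : ℝ) = y := by
      unfold detZ; push_cast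
      linear_combination m1 0 * (hY' - hY) - m1 1 * (hX' - hX) + y * hdet'
    have e2 : r * (detZ (R.ev u k i) m2 : ℝ) = x := by
      unfold detZ; push_cast
      linear_combination m2 1 * (hX' - hX) - m2 0 * (hY' - hY) + x * hdet'
    exact ⟨by exact_mod_cast nonneg_of_mul_nonneg_right (e1 ▸ hy : 0 ≤ r * _) hr,
      by exact_mod_cast nonneg_of_mul_nonneg_right (e2 ▸ hx : 0 ≤ r * _) hr⟩
  have a1 := hmpos m1 (.inl rfl)
  have a2 := hmpos m2 (.inr rfl)
  have b1 := hepos false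
  have b2 := hepos true
  have anti : ∀ v w, detZ v w = -detZ w v := by intro v w; unfold detZ; ring
  have c1 : detZ m1 (R.e1 u k) = 0 := le_antisymm (by rw [anti]; linarith [a1.2]) b1.1
  have c2 : detZ (R.e2 u k) m2 = 0 := le_antisymm (by rw [anti]; linarith [a2.1]) b2.2
  have expand : ∀ (v : Fin 2 → ℤ) l, v l = detZ v m2 * m1 l + detZ m1 v * m2 l := by
    intro v l
    have : v l = v l * detZ m1 m2 := by rw [hdet, mul_one]
    rw [this]
    unfold detZ
    fin_cases l <;> simp <;> ring
  constructor
  · have h : ∀ l, R.e1 u k l = detZ (R.e1 u k) m2 * m1 l := fun l => by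
      have := expand (R.e1 u k) l; rwa [c1, zero_mul, add_zero] at this
    have := hR.eq_one_of_dvd_ev u k false b1.2 (Dvd.intro _ (h 0).symm) (Dvd.intro _ (h 1).symm)
    ext l
    rw [h l]
    simp only [ev, Bool.false_eq_true, if_false] at this
    rw [this, one_mul]
  · have h : ∀ l, R.e2 u k l = detZ m1 (R.e2 u k) * m2 l := fun l => by
      have := expand (R.e2 u k) l; rwa [c2, zero_mul, zero_add] at this
    have := hR.eq_one_of_dvd_ev u k true b2.1 (Dvd.intro _ (h 0).symm) (Dvd.intro _ (h 1).symm)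
    ext l
    rw [h l]
    simp only [ev, if_true] at this
    rw [this, one_mul]

end STRep

namespace STRep

variable {d m D : ℕ} [NeZero d] [NeZero D] {R : STRep d m} {g : Fin D → Fin d} {a : Fin D}
  {u : Fin m → ℤ} {k : Fin d}

omit [NeZero d] in
lemma slope_sub_slope {w : Fin m → ℤ} {x : ℝ} (h : ∀ j, R.c j 0 = x → u j = w j) (v : ℝ) :
    R.slope u x v - R.slope w x v = R.slope u x 0 - R.slope w x 0 := by
  unfold slope
  rw [← Finset.sum_sub_distrib, ← Finset.sum_sub_distrib]
  refine Finset.sum_congr rfl fun j _ => ?_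
  by_cases hj : R.c j 0 = x
  · simp [h j hj]
  · simp [hj]

lemma ht_sub_ht {w : Fin m → ℤ} (h : ∀ j, R.c j 0 = R.V k 0 → u j = w j) (z : Pt) :
    R.ht u k z - R.ht w k z = ∑ j, -(R.dir (k - 1) 0 + R.dir k 0 : ℝ) * (u j - w j) *
      (max (z 0 - R.c j 0) 0 - max (R.V k 0 - R.c j 0) 0 -
        if R.c j 0 < R.V k 0 then z 0 - R.V k 0 else 0) := by
  have h1 := slope_sub_slope h (R.dir k 0)
  have h2 := slope_sub_slope h (-R.dir (k - 1) 0)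
  have h1' : (R.slope u (R.V k 0) (R.dir k 0) : ℝ) - R.slope w (R.V k 0) (R.dir k 0) =
    R.slope u (R.V k 0) 0 - R.slope w (R.V k 0) 0 := by exact_mod_cast h1
  have h2' : (R.slope u (R.V k 0) (-R.dir (k - 1) 0) : ℝ) - R.slope w (R.V k 0) (-R.dir (k - 1) 0) =
    R.slope u (R.V k 0) 0 - R.slope w (R.V k 0) 0 := by exact_mod_cast h2
  have hS : (R.relY u k z - R.relY w k z) -
      (R.slope u (R.V k 0) 0 - R.slope w (R.V k 0) 0 : ℝ) * R.relX k z =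
      ∑ j, (u j - w j : ℝ) *
      (max (z 0 - R.c j 0) 0 - max (R.V k 0 - R.c j 0) 0 -
        if R.c j 0 < R.V k 0 then z 0 - R.V k 0 else 0) := by
    have : R.relY u k z - R.relY w k z = R.shift u (z 0) - R.shift u (R.V k 0) -
        (R.shift w (z 0) - R.shift w (R.V k 0)) := by unfold relY; ring
    rw [this]
    unfold relX shift slope
    push_cast
    simp only [← Finset.sum_sub_distrib, Finset.sum_mul]
    refine Finset.sum_congr rfl fun j _ => ?_
    simp only [lt_irrefl, and_false, or_false]
    split_ifs <;> ring
  simp only [mul_assoc, ← Finset.mul_sum]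
  rw [← hS]
  unfold ht crd1 crd2
  simp only [e1_zero, e1_one, e2_zero, e2_one]
  push_cast
  linear_combination (R.relX k z * R.dir k 0) * h1' + (R.relX k z * R.dir (k - 1) 0) * h2'

/-- The canonical flips minimise the height over all unimodular flips. -/
lemma IsValid.ht_cf_le (hR : R.IsValid) (hk : R.IsHDCorner k) (hu : R.Adm u)
    (hdet : detZ (R.e1 u k) (R.e2 u k) = 1) (z : Pt) : R.ht (R.cf k) k z ≤ R.ht u k z := by
  have h : ∀ j, R.c j 0 = R.V k 0 → u j = R.cf k j := fun j hj => hR.eq_flips_of_detZ hu hk hdet hj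
  rw [← sub_nonneg, ht_sub_ht h z]
  refine Finset.sum_nonneg fun j _ => ?_
  by_cases hj : R.c j 0 = R.V k 0
  · simp [h j hj]
  refine mul_nonneg ?_ ?_
  · have hs := R.sgn_mul k
    have habs := abs_nonneg (R.dir (k - 1) 0 + R.dir k 0 : ℝ)
    rw [← hs] at habs
    unfold cf flips
    rcases R.sgn_eq k with h1 | h1 <;> rcases hu j with h2 | h2 <;>
      rcases hR.eps_pm j with h3 | h3 <;> rw [h1] at habs ⊢ <;> rw [h2] <;> (try rw [h3]) <;>
      push_cast at habs <;> simp <;> linarith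
  · split_ifs with h1
    · rcases max_cases (z 0 - R.c j 0) 0 with h2 | h2 <;>
        rcases max_cases (R.V k 0 - R.c j 0) 0 with h3 | h3 <;> linarith
    · have h1 : R.V k 0 - R.c j 0 ≤ 0 := by linarith [not_lt.1 h1]
      rw [max_eq_right h1]
      simp

lemma _root_.IsSTPackedTriangle.exists_crd {lam : ℝ} {B : Set Pt} (hR : R.IsValid)
    (hk : R.IsHDCorner k) (h : IsSTPackedTriangle R (R.V k) lam B) :
    ∃ u, R.Adm u ∧ detZ (R.e1 u k) (R.e2 u k) = 1 ∧
      ∀ z, z ∈ B ↔ 0 ≤ R.crd1 u k z ∧ 0 ≤ R.crd2 u k z ∧ R.ht u k z < lam := by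
  obtain ⟨u, hu, m1, m2, hdet, hmem, hnear⟩ := h.exists_coords
  obtain ⟨rfl, rfl⟩ := hR.eq_e_of_cone hk hu h.1 h.2.1 hdet hmem hnear
  refine ⟨u, hu, hdet, fun z => ?_⟩
  have hdet' : (R.e1 u k 0 : ℝ) * R.e2 u k 1 - R.e1 u k 1 * R.e2 u k 0 = 1 := by
    exact_mod_cast hdet
  rw [hmem]
  constructor
  · rintro ⟨x, y, hx, hy, hxy, hX, hY⟩
    have e1 : R.crd1 u k z = x := by
      unfold crd1; linear_combination hX * R.e2 u k 1 - hY * R.e2 u k 0 + x * hdet'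
    have e2 : R.crd2 u k z = y := by
      unfold crd2; linear_combination hY * R.e1 u k 0 - hX * R.e1 u k 1 + y * hdet'
    unfold ht
    rw [e1, e2]
    exact ⟨hx, hy, hxy⟩
  · rintro ⟨h1, h2, h3⟩
    have hX := R.detZ_mul_relX (u := u) (k := k) z
    have hY := R.detZ_mul_relY (u := u) (k := k) z
    rw [hdet, Int.cast_one, one_mul] at hX hY
    exact ⟨_, _, h1, h2, h3, hX, hY⟩

omit [NeZero d] in
lemma detZ_self (v : Fin 2 → ℤ) : detZ v v = 0 := by unfold detZ; ring

lemma detZ_ev_nonneg (hdet : detZ (R.e1 u k) (R.e2 u k) = 1) (i : Bool) :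
    0 ≤ detZ (R.ev u k i) (R.e2 u k) ∧ 0 ≤ detZ (R.e1 u k) (R.ev u k i) := by
  cases i <;> simp [ev, hdet, detZ_self]

/-- Points of the rays along the sides of a packed triangle. -/
lemma exists_ray {lam : ℝ} {B : Set Pt} (hdet : detZ (R.e1 u k) (R.e2 u k) = 1)
    (hmem : ∀ z, z ∈ B ↔ 0 ≤ R.crd1 u k z ∧ 0 ≤ R.crd2 u k z ∧ R.ht u k z < lam)
    (i : Bool) {t : ℝ} (h0 : 0 ≤ t) (h1 : t < lam) :
    ∃ q ∈ B, R.relX k q = t * R.ev u k i 0 ∧ R.relY u k q = t * R.ev u k i 1 := by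
  obtain ⟨q, hX, hY⟩ := R.exists_rel u k (t * R.ev u k i 0) (t * R.ev u k i 1)
  refine ⟨q, (hmem q).2 ?_, hX, hY⟩
  rw [crd1_eq hX hY, crd2_eq hX hY, ht_eq_mul_detZ hX hY, hdet]
  obtain ⟨h2, h3⟩ := detZ_ev_nonneg hdet i
  exact ⟨mul_nonneg h0 (by exact_mod_cast h2), mul_nonneg h0 (by exact_mod_cast h3), by simpa⟩

lemma _root_.IsSTPackedTriangle.mem_iff {lam : ℝ} {B : Set Pt} (hR : R.IsValid)
    (hk : R.IsHDCorner k) (h : IsSTPackedTriangle R (R.V k) lam B) (z : Pt) :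
    z ∈ B ↔ z ∈ R.carrier ∧ R.ht (R.cf k) k z < lam := by
  obtain ⟨u, hu, hdet, hmem⟩ := h.exists_crd hR hk
  refine ⟨fun hz => ⟨h.2.1 hz, (hR.ht_cf_le hk hu hdet z).trans_lt ((hmem z).1 hz).2.2⟩, ?_⟩
  rintro ⟨hz, hlt⟩
  obtain ⟨hz1, hz2⟩ := hR.crd_nonneg hk hu hz
  refine (hmem z).2 ⟨hz1, hz2, ?_⟩
  obtain ⟨hz1', hz2'⟩ := hR.crd_nonneg hk (R.adm_cf k) hz
  obtain ⟨i, t, -, ht0, hX, hmin⟩ := hR.exists_good (u := R.cf k) hk hz1' hz2' (hR.relX_eq_crd hk z)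
  have htl : t < lam := (hmin _ _ hz1' hz2' (hR.relX_eq_crd hk z)).trans_lt hlt
  obtain ⟨q, hqB, hqX, hqY⟩ := exists_ray hdet hmem i ht0 htl
  have hXq : R.relX k z = R.relX k q := by rw [hX, hqX, ev_zero_eq]
  obtain ⟨hq1, hq2⟩ := hR.crd_nonneg hk (R.adm_cf k) (h.2.1 hqB)
  have hq := hmin _ _ hq1 hq2 (hXq.trans (hR.relX_eq_crd hk q))
  have hqu := ht_eq_mul_detZ hqX hqY
  rw [hdet, Int.cast_one, mul_one] at hqu
  have hz0 : z 0 = q 0 := by unfold relX at hXq; linarith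
  have e1 := R.ht_sub u k hz0
  have e2 := R.ht_sub (R.cf k) k hz0
  have : R.ht (R.cf k) k q = R.crd1 (R.cf k) k q + R.crd2 (R.cf k) k q := rfl
  linarith

/-- The far end of a semitoric edge. -/
lemma exists_leg_end (hR : R.IsValid) (g : Fin D → Fin d) (i : Bool) (a : Fin D) :
    ∃ b, R.Leg g i a (R.V (g b)) (R.legLen g i a) := by
  cases i
  · refine ⟨a - 1, ?_⟩
    simpa [Leg, legLen] using onEdge_start hR g (a - 1)
  · refine ⟨a + 1, ?_⟩
    simpa [Leg, legLen] using onEdge_end hR g a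

lemma legLen_pos (hR : R.IsValid) (i : Bool) (a : Fin D) : 0 < R.legLen g i a := by
  cases i
  · simpa [legLen] using stEdgeLen_pos hR (a - 1)
  · simpa [legLen] using stEdgeLen_pos hR a

omit [NeZero d] in
lemma relY_eq_of_relX_zero {z : Pt} (h : R.relX k z = 0) (w : Fin m → ℤ) :
    R.relY u k z = R.relY w k z := by
  have : z 0 = R.V k 0 := by unfold relX at h; linarith
  unfold relY
  rw [this]
  ring

lemma ev_one_of_zero {i : Bool} (h : R.ev u k i 0 = 0) (w : Fin m → ℤ) :
    R.ev u k i 1 = R.ev w k i 1 := by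
  cases i
  · simp only [ev, Bool.false_eq_true, if_false, e1_zero, e1_one, neg_eq_zero] at h ⊢
    simp [h]
  · simp only [ev, if_true, e2_zero, e2_one] at h ⊢
    simp [h]

/-- A packed triangle of size exceeding the length of an adjacent semitoric edge contains the
far end of that edge on its side. -/
lemma Leg.relY_eq_of_packed (hR : R.IsValid) (hg : IsCornerEnum R g) (hu : R.Adm u) {lam : ℝ}
    {B : Set Pt} (hB : B ⊆ R.carrier) (hdet : detZ (R.e1 u (g a)) (R.e2 u (g a)) = 1)
    (hmem : ∀ z, z ∈ B ↔ 0 ≤ R.crd1 u (g a) z ∧ 0 ≤ R.crd2 u (g a) z ∧ R.ht u (g a) z < lam)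
    {i : Bool} {p : Pt} {t : ℝ} (h : R.Leg g i a p t) (ht : t < lam) :
    R.relY u (g a) p = t * R.ev u (g a) i 1 := by
  have hk := isHDCorner_g hg a
  have hX := h.relX_eq hR hg u
  by_cases h0 : R.ev u (g a) i 0 = 0
  · have h0' : R.relX (g a) p = 0 := by rw [hX, h0]; simp
    rw [relY_eq_of_relX_zero h0' (R.flips 1), ev_one_of_zero h0 (R.flips 1)]
    refine h.relY_eq hR hg (.inl rfl) ?_
    rw [R.ev_zero_eq _ u, h0]
    simp
  obtain ⟨q, hqB, hqX, hqY⟩ := exists_ray hdet hmem i (h.nonneg hR) ht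
  have hqp : q 0 = p 0 := by
    have := hqX.trans hX.symm
    unfold relX at this
    linarith
  obtain ⟨s, hs, hsi⟩ : ∃ s : ℤ, (s = 1 ∨ s = -1) ∧ 0 < s * osgn i * R.ev u (g a) i 0 := by
    rcases lt_or_gt_of_ne h0 with h1 | h1 <;> cases i
    · exact ⟨1, .inl rfl, by simp [osgn]; linarith⟩
    · exact ⟨-1, .inr rfl, by simp [osgn]; linarith⟩
    · exact ⟨-1, .inr rfl, by simp [osgn]; linarith⟩
    · exact ⟨1, .inl rfl, by simp [osgn]; linarith⟩
  have hext := h.extremal hR hg hs hsi (hB hqB) hqp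
  obtain ⟨hc1, hc2⟩ := hR.crd_nonneg hk hu (h.mem_carrier hR)
  have hd : R.relY u (g a) p = R.relY u (g a) q + (p 1 - q 1) := by
    unfold relY; rw [hqp]; ring
  have hsi' : (0 : ℝ) < s * osgn i * R.ev u (g a) i 0 := by exact_mod_cast hsi
  have key : (p 1 - q 1) * (osgn i * R.ev u (g a) i 0) ≤ 0 := by
    unfold crd1 at hc1
    unfold crd2 at hc2
    cases i
    · simp only [ev, Bool.false_eq_true, if_false, osgn] at hX hqY ⊢
      rw [hd, hqY, hX] at hc2
      push_cast
      nlinarith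
    · simp only [ev, if_true, osgn] at hX hqY ⊢
      rw [hd, hqY, hX] at hc1
      push_cast
      nlinarith
  have : p 1 = q 1 := by
    rcases hs with rfl | rfl
    · push_cast at hext hsi'
      nlinarith
    · push_cast at hext hsi'
      nlinarith
  rw [hd, hqY, this]
  ring

lemma _root_.IsSTPackedTriangle.le_legLen {lam : ℝ} {B : Set Pt} (hR : R.IsValid)
    (hg : IsCornerEnum R g) (h : IsSTPackedTriangle R (R.V (g a)) lam B) (i : Bool) :
    lam ≤ R.legLen g i a := by
  obtain ⟨u, hu, hdet, hmem⟩ := h.exists_crd hR (isHDCorner_g hg a)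
  by_contra! hlt
  obtain ⟨b, hb⟩ := exists_leg_end hR g i a
  have hpos := legLen_pos (g := g) hR i a
  have hpX := hb.relX_eq hR hg u
  have hpY := hb.relY_eq_of_packed hR hg hu h.2.1 hdet hmem hlt
  set l := R.legLen g i a
  obtain ⟨w, hwB, hwX, hwY⟩ := exists_ray hdet hmem i (t := (l + lam) / 2) (by linarith)
    (by linarith)
  have hkb := isHDCorner_g hg b
  obtain ⟨hw1, hw2⟩ := hR.crd_nonneg hkb hu (h.2.1 hwB)
  obtain ⟨ha1, ha2⟩ := hR.crd_nonneg hkb hu (R.V_mem (g a))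
  have hbwX : R.relX (g b) w = ((lam - l) / 2) * R.ev u (g a) i 0 := by
    unfold relX at *; linarith
  have hbwY : R.relY u (g b) w = ((lam - l) / 2) * R.ev u (g a) i 1 := by
    unfold relY at *; linarith
  have hbaX : R.relX (g b) (R.V (g a)) = (-l) * R.ev u (g a) i 0 := by
    unfold relX at *; linarith
  have hbaY : R.relY u (g b) (R.V (g a)) = (-l) * R.ev u (g a) i 1 := by
    unfold relY at *; linarith
  rw [crd1_eq hbwX hbwY] at hw1
  rw [crd2_eq hbwX hbwY] at hw2
  rw [crd1_eq hbaX hbaY] at ha1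
  rw [crd2_eq hbaX hbaY] at ha2
  have z1 : detZ (R.ev u (g a) i) (R.e2 u (g b)) = 0 := by
    have : (detZ (R.ev u (g a) i) (R.e2 u (g b)) : ℝ) = 0 := by nlinarith
    exact_mod_cast this
  have z2 : detZ (R.e1 u (g b)) (R.ev u (g a) i) = 0 := by
    have : (detZ (R.e1 u (g b)) (R.ev u (g a) i) : ℝ) = 0 := by nlinarith
    exact_mod_cast this
  have hd := hR.detZ_pos hkb hu
  have hev : ∀ l, R.ev u (g a) i l = 0 := by
    intro l
    have : detZ (R.e1 u (g b)) (R.e2 u (g b)) * R.ev u (g a) i l =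
        detZ (R.ev u (g a) i) (R.e2 u (g b)) * R.e1 u (g b) l +
        detZ (R.e1 u (g b)) (R.ev u (g a) i) * R.e2 u (g b) l := by
      unfold detZ; fin_cases l <;> simp <;> ring
    rw [z1, z2, zero_mul, zero_mul, add_zero] at this
    exact (mul_eq_zero.1 this).resolve_left (by linarith)
  have h0 := hev 0
  have h1 := hev 1
  unfold detZ at hdet
  cases i
  · simp only [ev, Bool.false_eq_true, if_false] at h0 h1
    rw [h0, h1] at hdet
    simp at hdet
  · simp only [ev, if_true] at h0 h1
    rw [h0, h1] at hdet
    simp at hdet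

omit [NeZero D] in
lemma _root_.IsSTPackedTriangle.eq_cornerTri {lam : ℝ} {B : Set Pt} (hR : R.IsValid)
    (hg : IsCornerEnum R g) (h : IsSTPackedTriangle R (R.V (g a)) lam B) :
    B = R.cornerTri g a lam :=
  Set.ext fun z => by simpa [cornerTri] using h.mem_iff hR (isHDCorner_g hg a) z

lemma _root_.IsSTPackedTriangle.fits {lam : ℝ} {B : Set Pt} (hR : R.IsValid)
    (hg : IsCornerEnum R g) (h : IsSTPackedTriangle R (R.V (g a)) lam B) : R.Fits g a lam where
  le_ht_c j := by
    by_contra! hlt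
    exact h.2.2.1 j ((h.mem_iff hR (isHDCorner_g hg a) _).2
      ⟨interior_subset (hR.marked_interior j), hlt⟩)
  le_legLen := h.le_legLen hR hg

lemma Fits.alphaBound (hR : R.IsValid) (hg : IsCornerEnum R g) {lam : ℝ} (hf : R.Fits g a lam) :
    AlphaBound R g a lam := by
  intro j q t hq hqj _
  obtain ⟨i, hi⟩ := onEmanating_iff_leg.1 hq
  have h1 := hi.ht_le hR hg
  have h2 := R.ht_sub (R.cf (g a)) (g a) hqj.symm
  have h3 := hf.le_ht_c j
  have h4 : (q 1 - R.c j 1) * (R.dir (g a - 1) 0 + R.dir (g a) 0 : ℝ) ≤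
      |q 1 - R.c j 1| * |((R.dir (g a) 0 + R.dir (g a - 1) 0 : ℤ) : ℝ)| := by
    rw [← abs_mul]
    push_cast
    rw [add_comm (R.dir (g a) 0 : ℝ)]
    exact le_abs_self _
  linarith

end STRep

namespace STRep

variable {d m D : ℕ} [NeZero d] [NeZero D] {R : STRep d m} {g : Fin D → Fin d} {a : Fin D}
  {u : Fin m → ℤ} {k : Fin d}

omit [NeZero D] in
lemma IsValid.ht_nonneg (hR : R.IsValid) (hg : IsCornerEnum R g) {z : Pt} (hz : z ∈ R.carrier) :
    0 ≤ R.ht (R.cf (g a)) (g a) z :=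
  add_nonneg (hR.crd_nonneg (isHDCorner_g hg a) (adm_cf _) hz).1
    (hR.crd_nonneg (isHDCorner_g hg a) (adm_cf _) hz).2

omit [NeZero D] in
lemma cornerTri_zero (hR : R.IsValid) (hg : IsCornerEnum R g) : R.cornerTri g a 0 = ∅ :=
  Set.eq_empty_of_forall_notMem fun _ hz => (hR.ht_nonneg hg hz.1).not_gt hz.2

lemma IsValid.fits_zero (hR : R.IsValid) (hg : IsCornerEnum R g) : R.Fits g a 0 where
  le_ht_c j := hR.ht_nonneg hg (interior_subset (hR.marked_interior j))
  le_legLen i := (legLen_pos hR i a).le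

lemma _root_.IsSTPacking.eq_cornerTri {sz : Fin D → ℝ} {P : Set Pt} (hR : R.IsValid)
    (hg : IsCornerEnum R g) (h : IsSTPacking R g sz P) :
    (∀ a, 0 ≤ sz a) ∧ (∀ a, R.Fits g a (sz a)) ∧ (P = ⋃ a, R.cornerTri g a (sz a)) ∧
      Pairwise (Function.onFun Disjoint fun a => R.cornerTri g a (sz a)) := by
  obtain ⟨tri, rfl, htri, hdisj⟩ := h
  have heq : tri = fun a => R.cornerTri g a (sz a) := by
    ext1 a
    rcases htri a with ⟨h1, h2⟩ | h1
    · rw [h1, h2, cornerTri_zero hR hg]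
    · exact h1.eq_cornerTri hR hg
  refine ⟨fun a => ?_, fun a => ?_, by rw [heq], by rwa [heq] at hdisj⟩
  · rcases htri a with ⟨h1, -⟩ | h1
    · exact h1.ge
    · exact h1.1.le
  · rcases htri a with ⟨h1, -⟩ | h1
    · rw [h1]; exact hR.fits_zero hg
    · exact h1.fits hR hg

lemma add_le_stEdgeLen (hR : R.IsValid) (hg : IsCornerEnum R g) {sz : Fin D → ℝ}
    (hf : ∀ a, R.Fits g a (sz a))
    (hdisj : Pairwise (Function.onFun Disjoint fun a => R.cornerTri g a (sz a))) (a : Fin D) :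
    sz a + sz (a + 1) ≤ stEdgeLen R g a := by
  by_contra! hlt
  have h1 : sz a ≤ stEdgeLen R g a := by simpa [legLen] using (hf a).le_legLen true
  have h2 : sz (a + 1) ≤ stEdgeLen R g a := by simpa [legLen] using (hf (a + 1)).le_legLen false
  set l := stEdgeLen R g a with hl
  obtain ⟨q, hq⟩ := R.exists_onEdge g a (t := (l - sz (a + 1) + sz a) / 2)
    (by linarith) (by linarith)
  have hqa : R.Leg g true a q ((l - sz (a + 1) + sz a) / 2) := by simpa [Leg] using hq
  have hqb : R.Leg g false (a + 1) q (l - (l - sz (a + 1) + sz a) / 2) := by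
    simpa [Leg, ← hl] using hq
  refine Set.disjoint_left.1 (hdisj (hR.add_one_ne hg a).symm)
    ⟨hq.mem_carrier hR, (hqa.ht_le hR hg).trans_lt ?_⟩
    ⟨hq.mem_carrier hR, (hqb.ht_le hR hg).trans_lt ?_⟩ <;> linarith

lemma _root_.IsSTPacking.mem_polytope {sz : Fin D → ℝ} {P : Set Pt} (hR : R.IsValid)
    (hg : IsCornerEnum R g) (h : IsSTPacking R g sz P) : sz ∈ STPolytope R g := by
  obtain ⟨h1, h2, -, h4⟩ := h.eq_cornerTri hR hg
  exact fun a => ⟨h1 a, add_le_stEdgeLen hR hg h2 h4 a, (h2 a).alphaBound hR hg⟩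

lemma fits_of_mem_polytope (hR : R.IsValid) (hg : IsCornerEnum R g) {sz : Fin D → ℝ}
    (h : sz ∈ STPolytope R g) (a : Fin D) : R.Fits g a (sz a) := by
  have hlen : ∀ i, sz a ≤ R.legLen g i a := by
    rintro (_ | _)
    · have := (h (a - 1)).2.1
      rw [sub_add_cancel] at this
      simpa [legLen] using (by linarith [(h (a - 1)).1] : sz a ≤ stEdgeLen R g (a - 1))
    · simpa [legLen] using (by linarith [(h a).2.1, (h (a + 1)).1] : sz a ≤ stEdgeLen R g a)
  exact ⟨fun j => hR.le_ht_c hg (h a).2.2 hlen j, hlen⟩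

lemma exists_isSTPacking (hR : R.IsValid) (hg : IsCornerEnum R g)
    (hinj : Function.Injective R.V) {sz : Fin D → ℝ} (h : sz ∈ STPolytope R g) :
    ∃ P, IsSTPacking R g sz P := by
  refine ⟨_, fun a => R.cornerTri g a (sz a), rfl, fun a => ?_, fun a b hab =>
    cornerTri_disjoint hR hg hinj (fun a => (h a).1) (fun a => (h a).2.1)
      (fits_of_mem_polytope hR hg h) hab⟩
  rcases (h a).1.eq_or_lt with h0 | h0
  · exact .inl ⟨h0.symm, by simp only [← h0, cornerTri_zero hR hg]⟩
  · exact .inr (isSTPackedTriangle_cornerTri hR hg (fits_of_mem_polytope hR hg h a) h0)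

/-- The sizes of the triangles are determined by their union. -/
lemma size_le_of_iUnion_subset (hR : R.IsValid) (hg : IsCornerEnum R g)
    (hinj : Function.Injective R.V) {sz sz' : Fin D → ℝ} (h : sz ∈ STPolytope R g)
    (hsub : (⋃ a, R.cornerTri g a (sz' a)) ⊆ ⋃ a, R.cornerTri g a (sz a)) (a : Fin D) :
    sz' a ≤ sz a := by
  by_contra! hlt
  have hf := fits_of_mem_polytope hR hg h
  obtain ⟨q, hq⟩ := R.exists_leg g true a (h a).1 ((hf a).le_legLen true)
  have hqmem : q ∈ ⋃ a, R.cornerTri g a (sz' a) :=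
    Set.mem_iUnion.2 ⟨a, hq.mem_carrier hR, (hq.ht_le hR hg).trans_lt hlt⟩
  obtain ⟨b, hqR, hqb⟩ := Set.mem_iUnion.1 (hsub hqmem)
  rcases eq_or_ne b a with rfl | hab
  · have hht := ht_eq_mul_detZ (hq.relX_eq hR hg _) (hq.relY_eq_cf hR hg (hf b).le_ht_c)
    have hdet := hR.detZ_sgn (isHDCorner_g hg b)
    unfold cf at hht hqb
    rw [hdet] at hht
    rw [hht] at hqb
    simp at hqb
  · have hqe : R.OnEdge g a q (sz a) := by simpa [Leg] using hq
    obtain ⟨i, hi⟩ := (hf b).leg_of_frontier hR hg (hqe.mem_frontier hR) hqb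
    exact Leg.disjoint hR hg hinj (fun a => (h a).1) (fun a => (h a).2.1) hab hi hq hqb le_rfl

lemma isClosed_setOf_alphaBound (R : STRep d m) (g : Fin D → Fin d) (a : Fin D) :
    IsClosed {lam | AlphaBound R g a lam} := by
  simp only [AlphaBound, Set.ofPred_forall]
  exact isClosed_iInter fun _ => isClosed_iInter fun _ => isClosed_iInter fun _ =>
    isClosed_iInter fun _ => isClosed_iInter fun _ => isClosed_iInter fun _ =>
      isClosed_le continuous_id continuous_const

lemma isCompact_STPolytope (R : STRep d m) (g : Fin D → Fin d) : IsCompact (STPolytope R g) := by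
  refine (isCompact_Icc (a := (0 : Fin D → ℝ)) (b := stEdgeLen R g)).of_isClosed_subset ?_
    fun sz h => ⟨fun a => (h a).1, fun a => by linarith [(h a).2.1, (h (a + 1)).1]⟩
  unfold STPolytope
  simp only [Set.ofPred_forall, Set.ofPred_and]
  refine isClosed_iInter fun a => ?_
  refine (isClosed_le continuous_const (continuous_apply a)).inter
    ((isClosed_le ((continuous_apply a).add (continuous_apply (a + 1))) continuous_const).inter ?_)
  exact (isClosed_setOf_alphaBound R g a).preimage (continuous_apply (A := fun _ : Fin D => ℝ) a)

lemma convex_STPolytope (R : STRep d m) (g : Fin D → Fin d) : Convex ℝ (STPolytope R g) := by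
  intro x hx y hy α β hα hβ hαβ a
  obtain ⟨x1, x2, x3⟩ := hx a
  obtain ⟨y1, y2, y3⟩ := hy a
  have hconv : ∀ {p q c : ℝ}, p ≤ c → q ≤ c → α * p + β * q ≤ c := fun {p q c} hp hq => by
    calc α * p + β * q ≤ α * c + β * c := by gcongr
      _ = c := by rw [← add_mul, hαβ, one_mul]
  simp only [Pi.add_apply, Pi.smul_apply, smul_eq_mul]
  refine ⟨by positivity, ?_, fun j q t h1 h2 h3 => hconv (x3 j q t h1 h2 h3) (y3 j q t h1 h2 h3)⟩
  linarith [hconv x2 y2]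

end STRep

lemma measurePreserving_stMap {m : ℕ} (c : Fin m → Pt) (u : Fin m → ℤ) :
    MeasurePreserving (stMap c 0 0 u) := by
  have h1 := volume_preserving_finTwoArrow ℝ
  have hs : Continuous fun x : ℝ => ∑ j, (u j : ℝ) * max (x - c j 0) 0 := by fun_prop
  have h2 : MeasurePreserving (fun p : ℝ × ℝ =>
      (id p.1, p.2 + ∑ j, (u j : ℝ) * max (p.1 - c j 0) 0)) (volume.prod volume)
      (volume.prod volume) := by
    refine (MeasurePreserving.id volume).skew_product
      (g := fun x y => y + ∑ j, (u j : ℝ) * max (x - c j 0) 0) ?_ ?_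
    · exact (continuous_snd.add (hs.comp continuous_fst)).measurable
    · exact .of_forall fun x => map_add_right_eq_self _ _
  have h3 := h1.symm.comp (h2.comp h1)
  have h4 : stMap c 0 0 u = MeasurableEquiv.finTwoArrow.symm ∘ (fun p : ℝ × ℝ =>
      (id p.1, p.2 + ∑ j, (u j : ℝ) * max (p.1 - c j 0) 0)) ∘ MeasurableEquiv.finTwoArrow := by
    funext z
    ext l
    fin_cases l <;> simp [stMap, MeasurableEquiv.finTwoArrow]
  rw [h4]
  exact h3

lemma volume_modelTriangle {lam : ℝ} (h : 0 ≤ lam) :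
    volume (modelTriangle lam) = ENNReal.ofReal (lam ^ 2 / 2) := by
  have hT : MeasurableSet {p : ℝ × ℝ | 0 ≤ p.1 ∧ 0 ≤ p.2 ∧ p.1 + p.2 < lam} :=
    (measurableSet_le measurable_const measurable_fst).inter
      ((measurableSet_le measurable_const measurable_snd).inter
        (measurableSet_lt (measurable_fst.add measurable_snd) measurable_const))
  have h1 : modelTriangle lam = (MeasurableEquiv.finTwoArrow : Pt ≃ᵐ ℝ × ℝ) ⁻¹'
      {p : ℝ × ℝ | 0 ≤ p.1 ∧ 0 ≤ p.2 ∧ p.1 + p.2 < lam} := rfl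
  rw [h1, (volume_preserving_finTwoArrow ℝ).measure_preimage hT.nullMeasurableSet,
    Measure.volume_eq_prod, Measure.prod_apply hT]
  have h2 : ∀ x : ℝ, volume (Prod.mk x ⁻¹' {p : ℝ × ℝ | 0 ≤ p.1 ∧ 0 ≤ p.2 ∧ p.1 + p.2 < lam}) =
      (Icc 0 lam).indicator (fun x => ENNReal.ofReal (lam - x)) x := by
    intro x
    by_cases hx : x ∈ Icc 0 lam
    · rw [Set.indicator_of_mem hx]
      have : Prod.mk x ⁻¹' {p : ℝ × ℝ | 0 ≤ p.1 ∧ 0 ≤ p.2 ∧ p.1 + p.2 < lam} =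
          Ico 0 (lam - x) := by
        ext y
        simp [hx.1, lt_sub_iff_add_lt']
      rw [this, Real.volume_Ico, sub_zero]
    · rw [Set.indicator_of_notMem hx]
      have : Prod.mk x ⁻¹' {p : ℝ × ℝ | 0 ≤ p.1 ∧ 0 ≤ p.2 ∧ p.1 + p.2 < lam} = ∅ := by
        refine Set.eq_empty_of_forall_notMem fun y ⟨hx0, hy0, hxy⟩ => hx ⟨hx0, ?_⟩
        linarith [(hy0 : 0 ≤ y), (hxy : x + y < lam)]
      rw [this, measure_empty]
  simp only [h2]
  rw [lintegral_indicator measurableSet_Icc, ← ofReal_integral_eq_lintegral_ofReal,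
    integral_Icc_eq_integral_Ioc, ← intervalIntegral.integral_of_le h]
  · rw [intervalIntegral.integral_sub (by simp) (by simp)]
    simp only [intervalIntegral.integral_const, integral_id, smul_eq_mul]
    congr 1
    ring
  · exact (continuous_const.sub continuous_id).integrableOn_Icc
  · exact (ae_restrict_mem measurableSet_Icc).mono fun x hx => by simpa using hx.2

lemma convex_modelTriangle (lam : ℝ) : Convex ℝ (modelTriangle lam) := by
  rintro x ⟨x0, x1, x2⟩ y ⟨y0, y1, y2⟩ α β hα hβ hαβ
  refine ⟨?_, ?_, ?_⟩
  · simp only [Pi.add_apply, Pi.smul_apply, smul_eq_mul]; positivity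
  · simp only [Pi.add_apply, Pi.smul_apply, smul_eq_mul]; positivity
  · have := convex_Iio (𝕜 := ℝ) lam x2 y2 hα hβ hαβ
    simp only [smul_eq_mul, Set.mem_Iio] at this
    simp only [Pi.add_apply, Pi.smul_apply, smul_eq_mul]
    linarith

/-- The affine image of the model triangle under an element of `SL₂(ℤ)`. -/
lemma volume_image_modelTriangle (M : SpecialLinearGroup (Fin 2) ℤ) (p : Pt) {lam : ℝ}
    (h : 0 ≤ lam) :
    NullMeasurableSet ((fun x => sl2Apply M x + p) '' modelTriangle lam) ∧
    volume ((fun x => sl2Apply M x + p) '' modelTriangle lam) =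
      ENNReal.ofReal (lam ^ 2 / 2) := by
  set L : Pt →ₗ[ℝ] Pt := Matrix.toLin' ((M : Matrix (Fin 2) (Fin 2) ℤ).map (Int.cast : ℤ → ℝ))
  have hL : (fun x => sl2Apply M x + p) '' modelTriangle lam =
      (fun x => x + p) '' (L '' modelTriangle lam) := by
    rw [Set.image_image]; rfl
  have hdet : LinearMap.det L = 1 := by
    rw [LinearMap.det_toLin']
    have := M.2
    rw [det_fin_two] at this ⊢
    simp only [map_apply]
    exact_mod_cast this
  rw [hL]
  constructor
  · have := ((convex_modelTriangle lam).linear_image L).vadd p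
    simp only [add_comm _ p]
    exact this.nullMeasurableSet _
  · rw [Set.image_add_right, measure_preimage_add_right, Measure.addHaar_image_linearMap, hdet,
      volume_modelTriangle h]
    simp

namespace STRep

variable {d m D : ℕ} [NeZero d] [NeZero D] {R : STRep d m} {g : Fin D → Fin d} {a : Fin D}

lemma volume_cornerTri (hR : R.IsValid) (hg : IsCornerEnum R g) {lam : ℝ} (h : 0 ≤ lam)
    (hf : R.Fits g a lam) : volume (R.cornerTri g a lam) = ENNReal.ofReal (lam ^ 2 / 2) := by
  obtain ⟨h1, h2⟩ := volume_image_modelTriangle (hR.cornerMatrix (isHDCorner_g hg a))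
    (stMap R.c 0 0 (R.cf (g a)) (R.V (g a))) h
  rw [← (stMap_injective (R := R) (u := R.cf (g a)) 0 0).preimage_image (R.cornerTri g a lam),
    hR.cornerTri_image hg hf, (measurePreserving_stMap R.c _).measure_preimage h1, h2]

omit [NeZero D] in
lemma measurableSet_cornerTri (a : Fin D) (lam : ℝ) : MeasurableSet (R.cornerTri g a lam) :=
  R.carrier_isClosed.measurableSet.inter (measurableSet_lt continuous_ht.measurable measurable_const)

lemma _root_.IsSTPacking.area_eq {sz : Fin D → ℝ} {P : Set Pt} (hR : R.IsValid)
    (hg : IsCornerEnum R g) (h : IsSTPacking R g sz P) : area P = (∑ a, sz a ^ 2) / 2 := by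
  obtain ⟨h1, h2, rfl, h4⟩ := h.eq_cornerTri hR hg
  unfold area
  rw [measure_iUnion h4 fun a => measurableSet_cornerTri a _, tsum_fintype,
    ENNReal.toReal_sum fun a _ => by rw [volume_cornerTri hR hg (h1 a) (h2 a)]; simp,
    Finset.sum_div]
  refine Finset.sum_congr rfl fun a _ => ?_
  rw [volume_cornerTri hR hg (h1 a) (h2 a), ENNReal.toReal_ofReal (by positivity)]

end STRep

/-- For a semitoric polygon with hidden and Delzant corners
`p₁, …, p_D` (labeled clockwise starting from the lexicographically minimal one),
semitoric edge `SL₂(ℤ)`-lengths `ℓ_a` and marked-point bounds `α_a`, the map `Λ` sending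
a semitoric packing to the tuple of `SL₂(ℤ)`-sizes of its packed triangles is a bijection
onto the compact convex polytope
`𝒫̃_ST = {λ : λ_a ≥ 0, λ_a + λ_{a+1} ≤ ℓ_a, λ_a ≤ α_a}`, and
`area [P] = ½ ‖Λ([P])‖²` for every semitoric packing. -/
theorem stmt10 {d m D : ℕ} [NeZero d] [NeZero D] (R : STRep d m) (hR : R.IsValid)
    (g : Fin D → Fin d) (hg : IsCornerEnum R g)
    (hlex : ∀ a : Fin D, a ≠ 0 →
      R.V (g 0) 0 < R.V (g a) 0 ∨
        (R.V (g 0) 0 = R.V (g a) 0 ∧ R.V (g 0) 1 < R.V (g a) 1)) :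
    (∀ sz P, IsSTPacking R g sz P → sz ∈ STPolytope R g) ∧
    (∀ sz ∈ STPolytope R g, ∃ P, IsSTPacking R g sz P) ∧
    (∀ sz sz' P, IsSTPacking R g sz P → IsSTPacking R g sz' P → sz = sz') ∧
    (∀ sz P P', IsSTPacking R g sz P → IsSTPacking R g sz P' → P = P') ∧
    (∀ sz P, IsSTPacking R g sz P → area P = (∑ a, sz a ^ 2) / 2) ∧
    IsCompact (STPolytope R g) ∧ Convex ℝ (STPolytope R g) := by
  have hinj := hR.V_injective hg hlex
  refine ⟨fun sz P h => h.mem_polytope hR hg, fun sz h => STRep.exists_isSTPacking hR hg hinj h,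
    fun sz sz' P h h' => ?_, fun sz P P' h h' => ?_, fun sz P h => h.area_eq hR hg,
    STRep.isCompact_STPolytope R g, STRep.convex_STPolytope R g⟩
  · have hP := (h.eq_cornerTri hR hg).2.2.1
    have hP' := (h'.eq_cornerTri hR hg).2.2.1
    exact funext fun a => le_antisymm
      (STRep.size_le_of_iUnion_subset hR hg hinj (h'.mem_polytope hR hg) (hP ▸ hP').le a)
      (STRep.size_le_of_iUnion_subset hR hg hinj (h.mem_polytope hR hg) (hP' ▸ hP).le a)
  · rw [(h.eq_cornerTri hR hg).2.2.1, (h'.eq_cornerTri hR hg).2.2.1]
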